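/- If Erase(M) = Erase(M') and Δ ⊢ M : A and Δ ⊢ M' : A are both valid typing judgments, then for every interpretation Θ in a linear category for duplication, ⟦M⟧^c = ⟦M'⟧^c; and if M and M' are values, also ⟦M⟧^v = ⟦M'⟧^v. That is, the denotation of a term does not depend on its indexation. -/

import Mathlib

/- The call-by-value linear lambda calculus of Selinger-Valiron, with Type-valued
   subtyping and typing derivations (used to define the categorical semantics). -/

namespace QLamSem

/-- Types: A,B ::= α | A ⊸ B | A ⊗ B | ⊤ | !A -/
inductive Ty : Type where
  | tconst : ℕ → Ty
  | arrow : Ty → Ty → Ty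
  | tensor : Ty → Ty → Ty
  | unit : Ty
  | bang : Ty → Ty
deriving DecidableEq

/-- `bangN n A` is `!ⁿA`. -/
def bangN : ℕ → Ty → Ty
  | 0, A => A
  | n + 1, A => Ty.bang (bangN n A)

/-- Derivations of the subtyping relation `A <: B`. -/
inductive SubD : Ty → Ty → Type where
  | tconst (n m a : ℕ) : (m = 0 ∨ 1 ≤ n) →
      SubD (bangN n (Ty.tconst a)) (bangN m (Ty.tconst a))
  | unit (n m : ℕ) : (m = 0 ∨ 1 ≤ n) →
      SubD (bangN n Ty.unit) (bangN m Ty.unit)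
  | arrow (n m : ℕ) (A A' B B' : Ty) : (m = 0 ∨ 1 ≤ n) → SubD A A' → SubD B B' →
      SubD (bangN n (Ty.arrow A' B)) (bangN m (Ty.arrow A B'))
  | tensor (n m : ℕ) (A A' B B' : Ty) : (m = 0 ∨ 1 ≤ n) → SubD A A' → SubD B B' →
      SubD (bangN n (Ty.tensor A B)) (bangN m (Ty.tensor A' B'))

/-- The subtyping relation `A <: B`. -/
def Sub (A B : Ty) : Prop := Nonempty (SubD A B)

/-- Indexed terms (with the `let` forms as primitive constructs). -/
inductive Tm : Type where
  | var : ℕ → Ty → Tm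
  | cst : ℕ → Ty → Tm
  | star : ℕ → Tm
  | lam : ℕ → ℕ → Ty → Tm → Tm
  | app : Tm → Tm → Tm
  | pair : ℕ → Tm → Tm → Tm
  | letv : ℕ → Ty → Tm → Tm → Tm
  | letPair : ℕ → ℕ → Ty → ℕ → Ty → Tm → Tm → Tm
  | letUnit : Tm → Tm → Tm
deriving DecidableEq

/-- The values among the terms. -/
def isValue : Tm → Bool
  | .var _ _ => true
  | .cst _ _ => true
  | .star _ => true
  | .lam _ _ _ _ => true
  | .app _ _ => false
  | .pair _ V W => isValue V && isValue W
  | .letv _ _ V W => isValue V && isValue W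
  | .letPair _ _ _ _ _ V W => isValue V && isValue W
  | .letUnit V W => isValue V && isValue W

/-- Untyped (pure) terms. -/
inductive PTm : Type where
  | var : ℕ → PTm
  | cst : ℕ → PTm
  | star : PTm
  | lam : ℕ → PTm → PTm
  | app : PTm → PTm → PTm
  | pair : PTm → PTm → PTm
  | letv : ℕ → PTm → PTm → PTm
  | letPair : ℕ → ℕ → PTm → PTm → PTm
  | letUnit : PTm → PTm → PTm
deriving DecidableEq

/-- The erasure operation, deleting all type and integer annotations. -/
def erase : Tm → PTm
  | .var x _ => .var x
  | .cst c _ => .cst c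
  | .star _ => .star
  | .lam _ x _ M => .lam x (erase M)
  | .app M N => .app (erase M) (erase N)
  | .pair _ M N => .pair (erase M) (erase N)
  | .letv x _ M N => .letv x (erase M) (erase N)
  | .letPair _ x _ y _ M N => .letPair x y (erase M) (erase N)
  | .letUnit M N => .letUnit (erase M) (erase N)

/-- `FreeAt x A M` : the term `M` has a free instance `x^A` of the variable `x`. -/
inductive FreeAt (x : ℕ) : Ty → Tm → Prop where
  | var (A : Ty) : FreeAt x A (.var x A)
  | lam {A : Ty} {M : Tm} (n y : ℕ) (B : Ty) : y ≠ x → FreeAt x A M →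
      FreeAt x A (.lam n y B M)
  | appL {A : Ty} {M : Tm} (N : Tm) : FreeAt x A M → FreeAt x A (.app M N)
  | appR {A : Ty} {N : Tm} (M : Tm) : FreeAt x A N → FreeAt x A (.app M N)
  | pairL {A : Ty} {M : Tm} (n : ℕ) (N : Tm) : FreeAt x A M → FreeAt x A (.pair n M N)
  | pairR {A : Ty} {N : Tm} (n : ℕ) (M : Tm) : FreeAt x A N → FreeAt x A (.pair n M N)
  | letvL {A : Ty} {M : Tm} (y : ℕ) (B : Ty) (N : Tm) : FreeAt x A M →
      FreeAt x A (.letv y B M N)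
  | letvR {A : Ty} {N : Tm} (y : ℕ) (B : Ty) (M : Tm) : y ≠ x → FreeAt x A N →
      FreeAt x A (.letv y B M N)
  | letPairL {A : Ty} {M : Tm} (n y : ℕ) (B : Ty) (z : ℕ) (C : Ty) (N : Tm) :
      FreeAt x A M → FreeAt x A (.letPair n y B z C M N)
  | letPairR {A : Ty} {N : Tm} (n y : ℕ) (B : Ty) (z : ℕ) (C : Ty) (M : Tm) :
      y ≠ x → z ≠ x → FreeAt x A N → FreeAt x A (.letPair n y B z C M N)
  | letUnitL {A : Ty} {M : Tm} (N : Tm) : FreeAt x A M → FreeAt x A (.letUnit M N)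
  | letUnitR {A : Ty} {N : Tm} (M : Tm) : FreeAt x A N → FreeAt x A (.letUnit M N)

/-- `x` occurs free in `M`. -/
def Free (x : ℕ) (M : Tm) : Prop := ∃ A, FreeAt x A M

/-- Substitution on untyped terms. -/
def psubst (x : ℕ) (V : PTm) : PTm → PTm
  | .var y => if y = x then V else .var y
  | .cst c => .cst c
  | .star => .star
  | .lam y M => if y = x then .lam y M else .lam y (psubst x V M)
  | .app M N => .app (psubst x V M) (psubst x V N)
  | .pair M N => .pair (psubst x V M) (psubst x V N)
  | .letv y M N => .letv y (psubst x V M) (if y = x then N else psubst x V N)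
  | .letPair y z M N =>
      .letPair y z (psubst x V M) (if y = x ∨ z = x then N else psubst x V N)
  | .letUnit M N => .letUnit (psubst x V M) (psubst x V N)

/-- Typing contexts as (ordered) lists of typed variables. -/
abbrev CtxL : Type := List (ℕ × Ty)

/-- The names of the variables of a context. -/
def names (Γ : CtxL) : List ℕ := Γ.map Prod.fst

/-- `!Δ`: the context obtained from `Δ` by prefixing every type with `!`. -/
def bangify (Δ : CtxL) : CtxL := Δ.map (fun p => (p.1, Ty.bang p.2))

/-- Typing derivations for the rules of Table 1.  Contexts are treated as lists with
an explicit exchange rule `swap`.  The parameter `cty` assigns to each constant `c`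
the type `A_c` (the type assigned to `c` being `!A_c`). -/
inductive TypingD (cty : ℕ → Ty) : CtxL → Tm → Ty → Type where
  | swap {Γ₁ Γ₂ : CtxL} {p q : ℕ × Ty} {M : Tm} {A : Ty} :
      TypingD cty (Γ₁ ++ p :: q :: Γ₂) M A →
      TypingD cty (Γ₁ ++ q :: p :: Γ₂) M A
  | var {Δ : CtxL} {x : ℕ} {A B : Ty} :
      x ∉ names Δ → SubD A B →
      TypingD cty (bangify Δ ++ [(x, A)]) (.var x B) B
  | cst {Δ : CtxL} {c : ℕ} {B : Ty} :
      SubD (.bang (cty c)) B →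
      TypingD cty (bangify Δ) (.cst c B) B
  | star {Δ : CtxL} {n : ℕ} :
      TypingD cty (bangify Δ) (.star n) (bangN n .unit)
  | lam0 {Δ : CtxL} {x : ℕ} {A : Ty} {M : Tm} {B : Ty} :
      x ∉ names Δ → TypingD cty (Δ ++ [(x, A)]) M B →
      TypingD cty Δ (.lam 0 x A M) (.arrow A B)
  | lamS {Δ : CtxL} {n x : ℕ} {A : Ty} {M : Tm} {B : Ty} :
      x ∉ names Δ → TypingD cty (bangify Δ ++ [(x, A)]) M B →
      TypingD cty (bangify Δ) (.lam (n + 1) x A M) (bangN (n + 1) (.arrow A B))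
  | app {Δ Γ₁ Γ₂ : CtxL} {M N : Tm} {A B : Ty} :
      (names (bangify Δ ++ Γ₁ ++ Γ₂)).Nodup →
      TypingD cty (bangify Δ ++ Γ₁) M (.arrow A B) →
      TypingD cty (bangify Δ ++ Γ₂) N A →
      TypingD cty (bangify Δ ++ Γ₁ ++ Γ₂) (.app M N) B
  | pair {Δ Γ₁ Γ₂ : CtxL} {n : ℕ} {M₁ M₂ : Tm} {A₁ A₂ : Ty} :
      (names (bangify Δ ++ Γ₁ ++ Γ₂)).Nodup →
      TypingD cty (bangify Δ ++ Γ₁) M₁ (bangN n A₁) →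
      TypingD cty (bangify Δ ++ Γ₂) M₂ (bangN n A₂) →
      TypingD cty (bangify Δ ++ Γ₁ ++ Γ₂) (.pair n M₁ M₂) (bangN n (.tensor A₁ A₂))
  | letv {Δ Γ₁ Γ₂ : CtxL} {x : ℕ} {A : Ty} {M N : Tm} {B : Ty} :
      (names (bangify Δ ++ Γ₁ ++ Γ₂)).Nodup →
      x ∉ names (bangify Δ ++ Γ₁ ++ Γ₂) →
      TypingD cty (bangify Δ ++ Γ₁) M A →
      TypingD cty ((bangify Δ ++ Γ₂) ++ [(x, A)]) N B →
      TypingD cty (bangify Δ ++ Γ₁ ++ Γ₂) (.letv x A M N) B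
  | letUnit {Δ Γ₁ Γ₂ : CtxL} {M N : Tm} {A : Ty} :
      (names (bangify Δ ++ Γ₁ ++ Γ₂)).Nodup →
      TypingD cty (bangify Δ ++ Γ₁) M .unit →
      TypingD cty (bangify Δ ++ Γ₂) N A →
      TypingD cty (bangify Δ ++ Γ₁ ++ Γ₂) (.letUnit M N) A
  | letPair {Δ Γ₁ Γ₂ : CtxL} {n x₁ : ℕ} {A₁ : Ty} {x₂ : ℕ} {A₂ : Ty} {M N : Tm} {A : Ty} :
      (names (bangify Δ ++ Γ₁ ++ Γ₂)).Nodup →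
      x₁ ≠ x₂ →
      x₁ ∉ names (bangify Δ ++ Γ₁ ++ Γ₂) →
      x₂ ∉ names (bangify Δ ++ Γ₁ ++ Γ₂) →
      TypingD cty (bangify Δ ++ Γ₁) M (bangN n (.tensor A₁ A₂)) →
      TypingD cty ((bangify Δ ++ Γ₂) ++ [(x₁, bangN n A₁), (x₂, bangN n A₂)]) N A →
      TypingD cty (bangify Δ ++ Γ₁ ++ Γ₂) (.letPair n x₁ A₁ x₂ A₂ M N) A

/-- Validity of a typing judgment. -/
def Typ (cty : ℕ → Ty) (Γ : CtxL) (M : Tm) (A : Ty) : Prop :=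
  Nonempty (TypingD cty Γ M A)

end QLamSem

namespace QLamSem

/-- The data of a linear category for duplication: a symmetric monoidal category,
an idempotent strongly monoidal linear exponential comonad `(L,δ,ε,m₂,m₀,△,◇)`,
a strong monad `(T,η,μ,t)`, and Kleisli exponentials `⊸` with `Φ`. -/
structure LCDData : Type 1 where
  Obj : Type
  Hom : Obj → Obj → Type
  id : ∀ A, Hom A A
  comp : ∀ {A B C}, Hom A B → Hom B C → Hom A C
  tens : Obj → Obj → Obj
  unit : Obj
  tmap : ∀ {A B X Y}, Hom A B → Hom X Y → Hom (tens A X) (tens B Y)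
  assoc : ∀ A B X, Hom (tens (tens A B) X) (tens A (tens B X))
  assocInv : ∀ A B X, Hom (tens A (tens B X)) (tens (tens A B) X)
  lunit : ∀ A, Hom (tens unit A) A
  lunitInv : ∀ A, Hom A (tens unit A)
  runit : ∀ A, Hom (tens A unit) A
  runitInv : ∀ A, Hom A (tens A unit)
  symm : ∀ A B, Hom (tens A B) (tens B A)
  L : Obj → Obj
  Lmap : ∀ {A B}, Hom A B → Hom (L A) (L B)
  eps : ∀ A, Hom (L A) A
  delta : ∀ A, Hom (L A) (L (L A))
  deltaInv : ∀ A, Hom (L (L A)) (L A)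
  m2 : ∀ A B, Hom (tens (L A) (L B)) (L (tens A B))
  m2Inv : ∀ A B, Hom (L (tens A B)) (tens (L A) (L B))
  m0 : Hom unit (L unit)
  m0Inv : Hom (L unit) unit
  dup : ∀ A, Hom (L A) (tens (L A) (L A))
  disc : ∀ A, Hom (L A) unit
  T : Obj → Obj
  Tmap : ∀ {A B}, Hom A B → Hom (T A) (T B)
  eta : ∀ A, Hom A (T A)
  mu : ∀ A, Hom (T (T A)) (T A)
  str : ∀ A B, Hom (tens A (T B)) (T (tens A B))
  lolli : Obj → Obj → Obj
  lolliL : ∀ {A' A} (_ : Hom A' A) (B : Obj), Hom (lolli A B) (lolli A' B)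
  lolliR : ∀ (A : Obj) {B B'} (_ : Hom B B'), Hom (lolli A B) (lolli A B')
  Phi : ∀ {X A B}, Hom X (lolli A B) → Hom (tens X A) (T B)
  PhiInv : ∀ {X A B}, Hom (tens X A) (T B) → Hom X (lolli A B)

namespace LCDData

variable (D : LCDData)

/-- Kleisli lifting `f* = T f ; μ`. -/
def klift {A B : D.Obj} (f : D.Hom A (D.T B)) : D.Hom (D.T A) (D.T B) :=
  D.comp (D.Tmap f) (D.mu B)

/-- `Ψ₁ : TA ⊗ TB → T(A ⊗ B)` (first component first). -/
def Psi1 (A B : D.Obj) : D.Hom (D.tens (D.T A) (D.T B)) (D.T (D.tens A B)) :=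
  D.comp (D.symm (D.T A) (D.T B))
    (D.comp (D.str (D.T B) A)
      (D.klift (D.comp (D.symm (D.T B) A) (D.str A B))))

/-- The evaluation map `(A ⊸ B) ⊗ A → T B` induced by `Φ`. -/
def appnt (A B : D.Obj) : D.Hom (D.tens (D.lolli A B) A) (D.T B) :=
  D.Phi (D.id (D.lolli A B))

/-- Transport of homs along equalities of objects. -/
def castHom {A A' B B' : D.Obj} (h₁ : A = A') (h₂ : B = B') (f : D.Hom A B) :
    D.Hom A' B' := h₁ ▸ h₂ ▸ f

end LCDData

/-- The laws of a linear category for duplication (Definition of linear category for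
duplication: symmetric monoidal category, idempotent strongly monoidal linear
exponential comonad, strong monad, Kleisli exponentials). -/
structure LCDLaws (D : LCDData) : Prop where
  /- category -/
  id_comp : ∀ {A B} (f : D.Hom A B), D.comp (D.id A) f = f
  comp_id : ∀ {A B} (f : D.Hom A B), D.comp f (D.id B) = f
  comp_assoc : ∀ {A B C E} (f : D.Hom A B) (g : D.Hom B C) (h : D.Hom C E),
    D.comp (D.comp f g) h = D.comp f (D.comp g h)
  /- monoidal structure -/
  tmap_id : ∀ A B, D.tmap (D.id A) (D.id B) = D.id (D.tens A B)
  tmap_comp : ∀ {A B C X Y Z} (f : D.Hom A B) (g : D.Hom B C)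
    (h : D.Hom X Y) (k : D.Hom Y Z),
    D.tmap (D.comp f g) (D.comp h k) = D.comp (D.tmap f h) (D.tmap g k)
  assoc_iso₁ : ∀ A B X, D.comp (D.assoc A B X) (D.assocInv A B X) = D.id _
  assoc_iso₂ : ∀ A B X, D.comp (D.assocInv A B X) (D.assoc A B X) = D.id _
  assoc_natural : ∀ {A A' B B' X X'} (f : D.Hom A A') (g : D.Hom B B') (h : D.Hom X X'),
    D.comp (D.tmap (D.tmap f g) h) (D.assoc A' B' X')
      = D.comp (D.assoc A B X) (D.tmap f (D.tmap g h))
  lunit_iso₁ : ∀ A, D.comp (D.lunit A) (D.lunitInv A) = D.id _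
  lunit_iso₂ : ∀ A, D.comp (D.lunitInv A) (D.lunit A) = D.id _
  lunit_natural : ∀ {A A'} (f : D.Hom A A'),
    D.comp (D.tmap (D.id D.unit) f) (D.lunit A') = D.comp (D.lunit A) f
  runit_iso₁ : ∀ A, D.comp (D.runit A) (D.runitInv A) = D.id _
  runit_iso₂ : ∀ A, D.comp (D.runitInv A) (D.runit A) = D.id _
  runit_natural : ∀ {A A'} (f : D.Hom A A'),
    D.comp (D.tmap f (D.id D.unit)) (D.runit A') = D.comp (D.runit A) f
  pentagon : ∀ A B X Y,
    D.comp (D.assoc (D.tens A B) X Y) (D.assoc A B (D.tens X Y))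
      = D.comp (D.tmap (D.assoc A B X) (D.id Y))
          (D.comp (D.assoc A (D.tens B X) Y) (D.tmap (D.id A) (D.assoc B X Y)))
  triangle : ∀ A B,
    D.comp (D.assoc A D.unit B) (D.tmap (D.id A) (D.lunit B))
      = D.tmap (D.runit A) (D.id B)
  symm_natural : ∀ {A A' B B'} (f : D.Hom A A') (g : D.Hom B B'),
    D.comp (D.tmap f g) (D.symm A' B') = D.comp (D.symm A B) (D.tmap g f)
  symm_symm : ∀ A B, D.comp (D.symm A B) (D.symm B A) = D.id _
  hexagon : ∀ A B X,
    D.comp (D.assoc A B X) (D.comp (D.symm A (D.tens B X)) (D.assoc B X A))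
      = D.comp (D.tmap (D.symm A B) (D.id X))
          (D.comp (D.assoc B A X) (D.tmap (D.id B) (D.symm A X)))
  /- the comonad L -/
  Lmap_id : ∀ A, D.Lmap (D.id A) = D.id (D.L A)
  Lmap_comp : ∀ {A B C} (f : D.Hom A B) (g : D.Hom B C),
    D.Lmap (D.comp f g) = D.comp (D.Lmap f) (D.Lmap g)
  eps_natural : ∀ {A B} (f : D.Hom A B),
    D.comp (D.Lmap f) (D.eps B) = D.comp (D.eps A) f
  delta_natural : ∀ {A B} (f : D.Hom A B),
    D.comp (D.Lmap f) (D.delta B) = D.comp (D.delta A) (D.Lmap (D.Lmap f))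
  delta_assoc : ∀ A, D.comp (D.delta A) (D.delta (D.L A))
    = D.comp (D.delta A) (D.Lmap (D.delta A))
  delta_counit_left : ∀ A, D.comp (D.delta A) (D.eps (D.L A)) = D.id (D.L A)
  delta_counit_right : ∀ A, D.comp (D.delta A) (D.Lmap (D.eps A)) = D.id (D.L A)
  /- idempotency -/
  delta_iso₁ : ∀ A, D.comp (D.delta A) (D.deltaInv A) = D.id _
  delta_iso₂ : ∀ A, D.comp (D.deltaInv A) (D.delta A) = D.id _
  /- monoidality of L (strong monoidal comonad) -/
  m2_natural : ∀ {A A' B B'} (f : D.Hom A A') (g : D.Hom B B'),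
    D.comp (D.tmap (D.Lmap f) (D.Lmap g)) (D.m2 A' B')
      = D.comp (D.m2 A B) (D.Lmap (D.tmap f g))
  m2_iso₁ : ∀ A B, D.comp (D.m2 A B) (D.m2Inv A B) = D.id _
  m2_iso₂ : ∀ A B, D.comp (D.m2Inv A B) (D.m2 A B) = D.id _
  m0_iso₁ : D.comp D.m0 D.m0Inv = D.id _
  m0_iso₂ : D.comp D.m0Inv D.m0 = D.id _
  m2_assoc : ∀ A B X,
    D.comp (D.tmap (D.m2 A B) (D.id (D.L X)))
      (D.comp (D.m2 (D.tens A B) X) (D.Lmap (D.assoc A B X)))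
    = D.comp (D.assoc (D.L A) (D.L B) (D.L X))
        (D.comp (D.tmap (D.id (D.L A)) (D.m2 B X)) (D.m2 A (D.tens B X)))
  m2_left_unit : ∀ B,
    D.comp (D.tmap D.m0 (D.id (D.L B))) (D.comp (D.m2 D.unit B) (D.Lmap (D.lunit B)))
      = D.lunit (D.L B)
  m2_right_unit : ∀ A,
    D.comp (D.tmap (D.id (D.L A)) D.m0) (D.comp (D.m2 A D.unit) (D.Lmap (D.runit A)))
      = D.runit (D.L A)
  eps_monoidal : ∀ A B,
    D.comp (D.m2 A B) (D.eps (D.tens A B)) = D.tmap (D.eps A) (D.eps B)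
  eps_monoidal_unit : D.comp D.m0 (D.eps D.unit) = D.id D.unit
  delta_monoidal : ∀ A B,
    D.comp (D.m2 A B) (D.delta (D.tens A B))
      = D.comp (D.tmap (D.delta A) (D.delta B))
          (D.comp (D.m2 (D.L A) (D.L B)) (D.Lmap (D.m2 A B)))
  delta_monoidal_unit : D.comp D.m0 (D.delta D.unit) = D.comp D.m0 (D.Lmap D.m0)
  /- each LA is a commutative comonoid (LA, △, ◇) -/
  dup_natural : ∀ {A B} (f : D.Hom A B),
    D.comp (D.Lmap f) (D.dup B) = D.comp (D.dup A) (D.tmap (D.Lmap f) (D.Lmap f))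
  disc_natural : ∀ {A B} (f : D.Hom A B),
    D.comp (D.Lmap f) (D.disc B) = D.disc A
  dup_comm : ∀ A, D.comp (D.dup A) (D.symm (D.L A) (D.L A)) = D.dup A
  dup_assoc : ∀ A,
    D.comp (D.dup A) (D.comp (D.tmap (D.dup A) (D.id (D.L A)))
      (D.assoc (D.L A) (D.L A) (D.L A)))
    = D.comp (D.dup A) (D.tmap (D.id (D.L A)) (D.dup A))
  dup_counit_left : ∀ A,
    D.comp (D.dup A) (D.comp (D.tmap (D.disc A) (D.id (D.L A))) (D.lunit (D.L A)))
      = D.id (D.L A)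
  dup_counit_right : ∀ A,
    D.comp (D.dup A) (D.comp (D.tmap (D.id (D.L A)) (D.disc A)) (D.runit (D.L A)))
      = D.id (D.L A)
  /- △ and ◇ are monoidal natural transformations (Table 3, first group) -/
  dup_monoidal : ∀ A B,
    D.comp (D.m2 A B) (D.dup (D.tens A B))
      = D.comp (D.tmap (D.dup A) (D.dup B))
          (D.comp (D.comp (D.assoc (D.L A) (D.L A) (D.tens (D.L B) (D.L B)))
              (D.comp (D.tmap (D.id (D.L A)) (D.comp
                  (D.assocInv (D.L A) (D.L B) (D.L B))
                  (D.comp (D.tmap (D.symm (D.L A) (D.L B)) (D.id (D.L B)))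
                    (D.assoc (D.L B) (D.L A) (D.L B)))))
                (D.assocInv (D.L A) (D.L B) (D.tens (D.L A) (D.L B)))))
            (D.tmap (D.m2 A B) (D.m2 A B)))
  dup_monoidal_unit :
    D.comp D.m0 (D.dup D.unit) = D.comp (D.lunitInv D.unit) (D.tmap D.m0 D.m0)
  disc_monoidal : ∀ A B,
    D.comp (D.m2 A B) (D.disc (D.tens A B))
      = D.comp (D.tmap (D.disc A) (D.disc B)) (D.lunit D.unit)
  disc_monoidal_unit : D.comp D.m0 (D.disc D.unit) = D.id D.unit
  /- △ and ◇ are L-coalgebra morphisms (Table 3, second group) -/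
  dup_coalgebra : ∀ A,
    D.comp (D.delta A) (D.Lmap (D.dup A))
      = D.comp (D.dup A) (D.comp (D.tmap (D.delta A) (D.delta A)) (D.m2 (D.L A) (D.L A)))
  disc_coalgebra : ∀ A,
    D.comp (D.delta A) (D.Lmap (D.disc A)) = D.comp (D.disc A) D.m0
  /- δ is a comonoid morphism (Table 3, third group) -/
  delta_comonoid_dup : ∀ A,
    D.comp (D.delta A) (D.dup (D.L A)) = D.comp (D.dup A) (D.tmap (D.delta A) (D.delta A))
  delta_comonoid_disc : ∀ A,
    D.comp (D.delta A) (D.disc (D.L A)) = D.disc A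
  /- the monad T -/
  Tmap_id : ∀ A, D.Tmap (D.id A) = D.id (D.T A)
  Tmap_comp : ∀ {A B C} (f : D.Hom A B) (g : D.Hom B C),
    D.Tmap (D.comp f g) = D.comp (D.Tmap f) (D.Tmap g)
  eta_natural : ∀ {A B} (f : D.Hom A B),
    D.comp f (D.eta B) = D.comp (D.eta A) (D.Tmap f)
  mu_natural : ∀ {A B} (f : D.Hom A B),
    D.comp (D.Tmap (D.Tmap f)) (D.mu B) = D.comp (D.mu A) (D.Tmap f)
  mu_assoc : ∀ A, D.comp (D.Tmap (D.mu A)) (D.mu A) = D.comp (D.mu (D.T A)) (D.mu A)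
  mu_unit_left : ∀ A, D.comp (D.eta (D.T A)) (D.mu A) = D.id (D.T A)
  mu_unit_right : ∀ A, D.comp (D.Tmap (D.eta A)) (D.mu A) = D.id (D.T A)
  /- tensorial strength -/
  str_natural : ∀ {A A' B B'} (f : D.Hom A A') (g : D.Hom B B'),
    D.comp (D.tmap f (D.Tmap g)) (D.str A' B') = D.comp (D.str A B) (D.Tmap (D.tmap f g))
  str_lunit : ∀ B,
    D.comp (D.str D.unit B) (D.Tmap (D.lunit B)) = D.lunit (D.T B)
  str_assoc : ∀ A B X,
    D.comp (D.assoc A B (D.T X)) (D.comp (D.tmap (D.id A) (D.str B X)) (D.str A (D.tens B X)))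
      = D.comp (D.str (D.tens A B) X) (D.Tmap (D.assoc A B X))
  str_eta : ∀ A B, D.comp (D.tmap (D.id A) (D.eta B)) (D.str A B) = D.eta (D.tens A B)
  str_mu : ∀ A B,
    D.comp (D.tmap (D.id A) (D.mu B)) (D.str A B)
      = D.comp (D.str A (D.T B)) (D.comp (D.Tmap (D.str A B)) (D.mu (D.tens A B)))
  /- Kleisli exponentials -/
  lolliL_id : ∀ A B, D.lolliL (D.id A) B = D.id (D.lolli A B)
  lolliR_id : ∀ A B, D.lolliR A (D.id B) = D.id (D.lolli A B)
  lolliL_comp : ∀ {A'' A' A} (f : D.Hom A'' A') (g : D.Hom A' A) (B : D.Obj),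
    D.lolliL (D.comp f g) B = D.comp (D.lolliL g B) (D.lolliL f B)
  lolliR_comp : ∀ (A : D.Obj) {B B' B''} (f : D.Hom B B') (g : D.Hom B' B''),
    D.lolliR A (D.comp f g) = D.comp (D.lolliR A f) (D.lolliR A g)
  Phi_iso₁ : ∀ {X A B} (f : D.Hom X (D.lolli A B)), D.PhiInv (D.Phi f) = f
  Phi_iso₂ : ∀ {X A B} (g : D.Hom (D.tens X A) (D.T B)), D.Phi (D.PhiInv g) = g
  Phi_natural_left : ∀ {X' X A B} (f : D.Hom X' X) (g : D.Hom X (D.lolli A B)),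
    D.Phi (D.comp f g) = D.comp (D.tmap f (D.id A)) (D.Phi g)
  Phi_natural_right : ∀ {X A B B'} (g : D.Hom X (D.lolli A B)) (h : D.Hom B B'),
    D.Phi (D.comp g (D.lolliR A h)) = D.comp (D.Phi g) (D.Tmap h)
  Phi_natural_arg : ∀ {X A' A B} (f : D.Hom A' A) (g : D.Hom X (D.lolli A B)),
    D.Phi (D.comp g (D.lolliL f B)) = D.comp (D.tmap (D.id X) f) (D.Phi g)

end QLamSem

namespace QLamSem

variable (D : LCDData)

/-- `Ln n X = Lⁿ X`. -/
def Ln : ℕ → D.Obj → D.Obj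
  | 0, X => X
  | n + 1, X => D.L (Ln n X)

/-- `Lⁿ` on morphisms. -/
def LnMap : ∀ (n : ℕ) {X Y : D.Obj}, D.Hom X Y → D.Hom (Ln D n X) (Ln D n Y)
  | 0, _, _, f => f
  | n + 1, _, _, f => D.Lmap (LnMap n f)

/-- Iterated counit `Lⁿ X → X`. -/
def collapseL : ∀ (n : ℕ) (X : D.Obj), D.Hom (Ln D n X) X
  | 0, X => D.id X
  | n + 1, X => D.comp (D.eps (Ln D n X)) (collapseL n X)

/-- Iterated comultiplication `L X → Lᵐ⁺¹ X`. -/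
def padL : ∀ (m : ℕ) (X : D.Obj), D.Hom (D.L X) (Ln D (m + 1) X)
  | 0, X => D.id (D.L X)
  | m + 1, X => D.comp (padL m X) (D.delta (Ln D m X))

/-- The canonical morphism `Lⁿ X → Lᵐ X` for `m = 0 ∨ 1 ≤ n`. -/
def bangAdj : ∀ (n m : ℕ) (X : D.Obj), (m = 0 ∨ 1 ≤ n) → D.Hom (Ln D n X) (Ln D m X)
  | n, 0, X, _ => collapseL D n X
  | 0, m + 1, _, h => False.elim (by omega)
  | n + 1, m + 1, X, _ =>
      D.comp (D.Lmap (collapseL D n X)) (padL D m X)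

/-- Iterated monoidality map `Lⁿ a ⊗ Lⁿ b → Lⁿ (a ⊗ b)`. -/
def m2n : ∀ (n : ℕ) (a b : D.Obj), D.Hom (D.tens (Ln D n a) (Ln D n b)) (Ln D n (D.tens a b))
  | 0, a, b => D.id (D.tens a b)
  | n + 1, a, b => D.comp (D.m2 (Ln D n a) (Ln D n b)) (D.Lmap (m2n n a b))

/-- Inverse of `m2n`. -/
def m2nInv : ∀ (n : ℕ) (a b : D.Obj), D.Hom (Ln D n (D.tens a b)) (D.tens (Ln D n a) (Ln D n b))
  | 0, a, b => D.id (D.tens a b)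
  | n + 1, a, b => D.comp (D.Lmap (m2nInv n a b)) (D.m2Inv (Ln D n a) (Ln D n b))

variable (Θ : ℕ → D.Obj)

/-- Interpretation of types. -/
def denTy : Ty → D.Obj
  | .tconst a => Θ a
  | .arrow A B => D.lolli (denTy A) (denTy B)
  | .tensor A B => D.tens (denTy A) (denTy B)
  | .unit => D.unit
  | .bang A => D.L (denTy A)

theorem denTy_bangN (n : ℕ) (A : Ty) : denTy D Θ (bangN n A) = Ln D n (denTy D Θ A) := by
  induction n with
  | zero => rfl
  | succ n ih => simp [bangN, denTy, Ln, ih]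


/-- The identity viewed along an equality of objects. -/
def eqHom {A B : D.Obj} (h : A = B) : D.Hom A B := h ▸ D.id A

/-- Interpretation of contexts: `⟦x₁:A₁,…,xₙ:Aₙ⟧ = ⟦A₁⟧ ⊗ (… ⊗ (⟦Aₙ⟧ ⊗ ⊤))`. -/
def denCtx : CtxL → D.Obj
  | [] => D.unit
  | p :: Γ => D.tens (denTy D Θ p.2) (denCtx Γ)

/-- Splitting `⟦Γ₁ ++ Γ₂⟧ → ⟦Γ₁⟧ ⊗ ⟦Γ₂⟧`. -/
def splitCtx : ∀ (Γ₁ Γ₂ : CtxL), D.Hom (denCtx D Θ (Γ₁ ++ Γ₂)) (D.tens (denCtx D Θ Γ₁) (denCtx D Θ Γ₂))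
  | [], Γ₂ => D.lunitInv (denCtx D Θ Γ₂)
  | p :: Γ₁, Γ₂ =>
      D.comp (D.tmap (D.id (denTy D Θ p.2)) (splitCtx Γ₁ Γ₂))
        (D.assocInv (denTy D Θ p.2) (denCtx D Θ Γ₁) (denCtx D Θ Γ₂))

/-- Joining `⟦Γ₁⟧ ⊗ ⟦Γ₂⟧ → ⟦Γ₁ ++ Γ₂⟧`. -/
def joinCtx : ∀ (Γ₁ Γ₂ : CtxL), D.Hom (D.tens (denCtx D Θ Γ₁) (denCtx D Θ Γ₂)) (denCtx D Θ (Γ₁ ++ Γ₂))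
  | [], Γ₂ => D.lunit (denCtx D Θ Γ₂)
  | p :: Γ₁, Γ₂ =>
      D.comp (D.assoc (denTy D Θ p.2) (denCtx D Θ Γ₁) (denCtx D Θ Γ₂))
        (D.tmap (D.id (denTy D Θ p.2)) (joinCtx Γ₁ Γ₂))

/-- The middle-four interchange `(a⊗b)⊗(c⊗d) → (a⊗c)⊗(b⊗d)`. -/
def mid4 (a b c d : D.Obj) :
    D.Hom (D.tens (D.tens a b) (D.tens c d)) (D.tens (D.tens a c) (D.tens b d)) :=
  D.comp (D.assoc a b (D.tens c d))
    (D.comp (D.tmap (D.id a)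
        (D.comp (D.assocInv b c d)
          (D.comp (D.tmap (D.symm b c) (D.id d)) (D.assoc c b d))))
      (D.assocInv a c (D.tens b d)))

/-- Duplication of a `!`-context, built from the comonoid comultiplications `△`. -/
def dupCtx : ∀ (Δ : CtxL), D.Hom (denCtx D Θ (bangify Δ)) (D.tens (denCtx D Θ (bangify Δ)) (denCtx D Θ (bangify Δ)))
  | [] => D.lunitInv D.unit
  | p :: Δ =>
      D.comp (D.tmap (D.dup (denTy D Θ p.2)) (dupCtx Δ))
        (mid4 D (D.L (denTy D Θ p.2)) (D.L (denTy D Θ p.2))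
          (denCtx D Θ (bangify Δ)) (denCtx D Θ (bangify Δ)))

/-- Discarding of a `!`-context, built from the comonoid counits `◇`. -/
def discCtx : ∀ (Δ : CtxL), D.Hom (denCtx D Θ (bangify Δ)) D.unit
  | [] => D.id D.unit
  | p :: Δ => D.comp (D.tmap (D.disc (denTy D Θ p.2)) (discCtx Δ)) (D.lunit D.unit)

/-- Promotion of a `!`-context: `⟦!Δ⟧ → L ⟦!Δ⟧`, built from `δ` and `m₂`. -/
def promCtx : ∀ (Δ : CtxL), D.Hom (denCtx D Θ (bangify Δ)) (D.L (denCtx D Θ (bangify Δ)))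
  | [] => D.m0
  | p :: Δ =>
      D.comp (D.tmap (D.delta (denTy D Θ p.2)) (promCtx Δ))
        (D.m2 (D.L (denTy D Θ p.2)) (denCtx D Θ (bangify Δ)))

/-- `Split_{!Δ,Γ₁,Γ₂} : ⟦!Δ,Γ₁,Γ₂⟧ → ⟦!Δ,Γ₁⟧ ⊗ ⟦!Δ,Γ₂⟧`, duplicating the `!Δ` part. -/
def splitDup (Δ Γ₁ Γ₂ : CtxL) :
    D.Hom (denCtx D Θ (bangify Δ ++ Γ₁ ++ Γ₂))
      (D.tens (denCtx D Θ (bangify Δ ++ Γ₁)) (denCtx D Θ (bangify Δ ++ Γ₂))) :=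
  D.comp (eqHom D (congrArg (denCtx D Θ) (List.append_assoc (bangify Δ) Γ₁ Γ₂)))
  <| D.comp (splitCtx D Θ (bangify Δ) (Γ₁ ++ Γ₂))
    (D.comp (D.tmap (dupCtx D Θ Δ) (splitCtx D Θ Γ₁ Γ₂))
      (D.comp (mid4 D (denCtx D Θ (bangify Δ)) (denCtx D Θ (bangify Δ))
          (denCtx D Θ Γ₁) (denCtx D Θ Γ₂))
        (D.tmap (joinCtx D Θ (bangify Δ) Γ₁) (joinCtx D Θ (bangify Δ) Γ₂))))

/-- `⟦Γ⟧ ⊗ ⟦A⟧ → ⟦Γ, x:A⟧`. -/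
def extHom (Γ : CtxL) (x : ℕ) (A : Ty) :
    D.Hom (D.tens (denCtx D Θ Γ) (denTy D Θ A)) (denCtx D Θ (Γ ++ [(x, A)])) :=
  D.comp (D.tmap (D.id (denCtx D Θ Γ)) (D.runitInv (denTy D Θ A)))
    (joinCtx D Θ Γ [(x, A)])

/-- `⟦Γ⟧ ⊗ (⟦A₁⟧ ⊗ ⟦A₂⟧) → ⟦Γ, x₁:A₁, x₂:A₂⟧`. -/
def ext2Hom (Γ : CtxL) (x₁ : ℕ) (A₁ : Ty) (x₂ : ℕ) (A₂ : Ty) :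
    D.Hom (D.tens (denCtx D Θ Γ) (D.tens (denTy D Θ A₁) (denTy D Θ A₂)))
      (denCtx D Θ (Γ ++ [(x₁, A₁), (x₂, A₂)])) :=
  D.comp (D.tmap (D.id (denCtx D Θ Γ))
      (D.tmap (D.id (denTy D Θ A₁)) (D.runitInv (denTy D Θ A₂))))
    (joinCtx D Θ Γ [(x₁, A₁), (x₂, A₂)])

/-- The exchange morphism interpreting the `swap` rule. -/
def swapMor (Γ₁ : CtxL) (p q : ℕ × Ty) (Γ₂ : CtxL) :
    D.Hom (denCtx D Θ (Γ₁ ++ q :: p :: Γ₂)) (denCtx D Θ (Γ₁ ++ p :: q :: Γ₂)) :=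
  D.comp (splitCtx D Θ Γ₁ (q :: p :: Γ₂))
    (D.comp (D.tmap (D.id (denCtx D Θ Γ₁))
        (D.comp (D.assocInv (denTy D Θ q.2) (denTy D Θ p.2) (denCtx D Θ Γ₂))
          (D.comp (D.tmap (D.symm (denTy D Θ q.2) (denTy D Θ p.2)) (D.id (denCtx D Θ Γ₂)))
            (D.assoc (denTy D Θ p.2) (denTy D Θ q.2) (denCtx D Θ Γ₂)))))
      (joinCtx D Θ Γ₁ (p :: q :: Γ₂)))

/-- The canonical arrow `I_{A,B} : ⟦A⟧ → ⟦B⟧` interpreting a subtyping `A <: B`. -/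
def Isub : ∀ {A B : Ty}, SubD A B → D.Hom (denTy D Θ A) (denTy D Θ B)
  | _, _, .tconst n m a h =>
      D.castHom (denTy_bangN D Θ n (Ty.tconst a)).symm (denTy_bangN D Θ m (Ty.tconst a)).symm
        (bangAdj D n m (denTy D Θ (Ty.tconst a)) h)
  | _, _, .unit n m h =>
      D.castHom (denTy_bangN D Θ n Ty.unit).symm (denTy_bangN D Θ m Ty.unit).symm
        (bangAdj D n m (denTy D Θ Ty.unit) h)
  | _, _, .arrow n m A A' B B' h sA sB =>
      D.castHom (denTy_bangN D Θ n (Ty.arrow A' B)).symm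
        (denTy_bangN D Θ m (Ty.arrow A B')).symm
        (D.comp (bangAdj D n m (denTy D Θ (Ty.arrow A' B)) h)
          (LnMap D m (D.comp (D.lolliL (Isub sA) (denTy D Θ B)) (D.lolliR (denTy D Θ A) (Isub sB)))))
  | _, _, .tensor n m A A' B B' h sA sB =>
      D.castHom (denTy_bangN D Θ n (Ty.tensor A B)).symm
        (denTy_bangN D Θ m (Ty.tensor A' B')).symm
        (D.comp (bangAdj D n m (denTy D Θ (Ty.tensor A B)) h)
          (LnMap D m (D.tmap (Isub sA) (Isub sB))))

/-- `m2n` expressed on interpretations of types. -/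
def m2nD (n : ℕ) (A B : Ty) :
    D.Hom (D.tens (denTy D Θ (bangN n A)) (denTy D Θ (bangN n B)))
      (denTy D Θ (bangN n (Ty.tensor A B))) :=
  D.castHom
    (show D.tens (Ln D n (denTy D Θ A)) (Ln D n (denTy D Θ B))
        = D.tens (denTy D Θ (bangN n A)) (denTy D Θ (bangN n B)) by
      rw [denTy_bangN, denTy_bangN])
    (denTy_bangN D Θ n (Ty.tensor A B)).symm
    (m2n D n (denTy D Θ A) (denTy D Θ B))

/-- Inverse of `m2nD`. -/
def m2nDInv (n : ℕ) (A B : Ty) :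
    D.Hom (denTy D Θ (bangN n (Ty.tensor A B)))
      (D.tens (denTy D Θ (bangN n A)) (denTy D Θ (bangN n B))) :=
  D.castHom (denTy_bangN D Θ n (Ty.tensor A B)).symm
    (show D.tens (Ln D n (denTy D Θ A)) (Ln D n (denTy D Θ B))
        = D.tens (denTy D Θ (bangN n A)) (denTy D Θ (bangN n B)) by
      rw [denTy_bangN, denTy_bangN])
    (m2nInv D n (denTy D Θ A) (denTy D Θ B))

/-- `⊤ → ⟦!ⁿ⊤⟧`. -/
def starMap : ∀ n : ℕ, D.Hom D.unit (denTy D Θ (bangN n Ty.unit))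
  | 0 => D.id D.unit
  | n + 1 =>
      D.comp D.m0 (D.castHom rfl (denTy_bangN D Θ (n + 1) Ty.unit).symm (padL D n D.unit))

/-- An interpretation `Θ` of the language: an object for each type constant and an
arrow `⊤ → ⟦!A_c⟧` for each constant `c` (whose assigned type is `!A_c`). -/
structure Interp (cty : ℕ → Ty) : Type where
  obj : ℕ → D.Obj
  cst : ∀ c : ℕ, D.Hom D.unit (denTy D obj (Ty.bang (cty c)))

variable {D}
variable {cty : ℕ → Ty} (I : Interp D cty)

/-- The computational interpretation `⟦π⟧^c : ⟦Γ⟧ → T ⟦A⟧` of a typing derivation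
`π` of `Γ ⊢ M : A` (Table 5). -/
def denC : ∀ {Γ : CtxL} {M : Tm} {A : Ty}, TypingD cty Γ M A →
    D.Hom (denCtx D I.obj Γ) (D.T (denTy D I.obj A))
  | _, _, _, .swap (Γ₁ := Γ₁) (Γ₂ := Γ₂) (p := p) (q := q) d =>
      D.comp (swapMor D I.obj Γ₁ p q Γ₂) (denC d)
  | _, _, _, .var (Δ := Δ) (x := x) (A := A) _ s =>
      D.comp (splitCtx D I.obj (bangify Δ) [(x, A)])
        (D.comp (D.tmap (discCtx D I.obj Δ) (D.runit (denTy D I.obj A)))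
          (D.comp (D.lunit (denTy D I.obj A))
            (D.comp (Isub D I.obj s) (D.eta _))))
  | _, _, _, .cst (Δ := Δ) (c := c) s =>
      D.comp (discCtx D I.obj Δ)
        (D.comp (I.cst c) (D.comp (Isub D I.obj s) (D.eta _)))
  | _, _, _, .star (Δ := Δ) (n := n) =>
      D.comp (discCtx D I.obj Δ) (D.comp (starMap D I.obj n) (D.eta _))
  | _, _, _, .lam0 (Δ := Δ) (x := x) (A := A) _ d =>
      D.comp (D.PhiInv (D.comp (extHom D I.obj Δ x A) (denC d))) (D.eta _)
  | _, _, _, .lamS (Δ := Δ) (n := n) (x := x) (A := A) (B := B) _ d =>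
      D.comp (promCtx D I.obj Δ)
        (D.comp (D.Lmap (D.PhiInv (D.comp (extHom D I.obj (bangify Δ) x A) (denC d))))
          (D.comp (D.castHom rfl (denTy_bangN D I.obj (n + 1) (Ty.arrow A B)).symm
              (padL D n (denTy D I.obj (Ty.arrow A B))))
            (D.eta _)))
  | _, _, _, .app (Δ := Δ) (Γ₁ := Γ₁) (Γ₂ := Γ₂) (A := A) (B := B) _ d₁ d₂ =>
      D.comp (splitDup D I.obj Δ Γ₁ Γ₂)
        (D.comp (D.tmap (denC d₁) (denC d₂))
          (D.comp (D.Psi1 (denTy D I.obj (Ty.arrow A B)) (denTy D I.obj A))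
            (D.klift (D.appnt (denTy D I.obj A) (denTy D I.obj B)))))
  | _, _, _, .pair (Δ := Δ) (Γ₁ := Γ₁) (Γ₂ := Γ₂) (n := n) (A₁ := A₁) (A₂ := A₂) _ d₁ d₂ =>
      D.comp (splitDup D I.obj Δ Γ₁ Γ₂)
        (D.comp (D.tmap (denC d₁) (denC d₂))
          (D.comp (D.Psi1 (denTy D I.obj (bangN n A₁)) (denTy D I.obj (bangN n A₂)))
            (D.Tmap (m2nD D I.obj n A₁ A₂))))
  | _, _, _, .letv (Δ := Δ) (Γ₁ := Γ₁) (Γ₂ := Γ₂) (x := x) (A := A) _ _ d₁ d₂ =>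
      D.comp (splitDup D I.obj Δ Γ₁ Γ₂)
        (D.comp (D.tmap (denC d₁) (D.id _))
          (D.comp (D.symm _ _)
            (D.comp (D.str (denCtx D I.obj (bangify Δ ++ Γ₂)) (denTy D I.obj A))
              (D.comp (D.Tmap (extHom D I.obj (bangify Δ ++ Γ₂) x A))
                (D.klift (denC d₂))))))
  | _, _, _, .letUnit (Δ := Δ) (Γ₁ := Γ₁) (Γ₂ := Γ₂) _ d₁ d₂ =>
      D.comp (splitDup D I.obj Δ Γ₁ Γ₂)
        (D.comp (D.tmap (denC d₁) (D.id _))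
          (D.comp (D.symm _ _)
            (D.comp (D.str (denCtx D I.obj (bangify Δ ++ Γ₂)) D.unit)
              (D.comp (D.Tmap (D.runit _)) (D.klift (denC d₂))))))
  | _, _, _, .letPair (Δ := Δ) (Γ₁ := Γ₁) (Γ₂ := Γ₂) (n := n) (x₁ := x₁) (A₁ := A₁)
      (x₂ := x₂) (A₂ := A₂) _ _ _ _ d₁ d₂ =>
      D.comp (splitDup D I.obj Δ Γ₁ Γ₂)
        (D.comp (D.tmap (denC d₁) (D.id _))
          (D.comp (D.symm _ _)
            (D.comp (D.str (denCtx D I.obj (bangify Δ ++ Γ₂))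
                (denTy D I.obj (bangN n (Ty.tensor A₁ A₂))))
              (D.comp (D.Tmap (D.comp (D.tmap (D.id _) (m2nDInv D I.obj n A₁ A₂))
                  (ext2Hom D I.obj (bangify Δ ++ Γ₂) x₁ (bangN n A₁) x₂ (bangN n A₂))))
                (D.klift (denC d₂))))))

/-- The value interpretation `⟦π⟧^v : ⟦Γ⟧ → ⟦A⟧` of a typing derivation `π` of
`Γ ⊢ V : A` with `V` a value (Table 5). -/
def denV : ∀ {Γ : CtxL} {M : Tm} {A : Ty}, TypingD cty Γ M A → isValue M = true →
    D.Hom (denCtx D I.obj Γ) (denTy D I.obj A)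
  | _, _, _, .swap (Γ₁ := Γ₁) (Γ₂ := Γ₂) (p := p) (q := q) d, h =>
      D.comp (swapMor D I.obj Γ₁ p q Γ₂) (denV d h)
  | _, _, _, .var (Δ := Δ) (x := x) (A := A) _ s, _ =>
      D.comp (splitCtx D I.obj (bangify Δ) [(x, A)])
        (D.comp (D.tmap (discCtx D I.obj Δ) (D.runit (denTy D I.obj A)))
          (D.comp (D.lunit (denTy D I.obj A)) (Isub D I.obj s)))
  | _, _, _, .cst (Δ := Δ) (c := c) s, _ =>
      D.comp (discCtx D I.obj Δ) (D.comp (I.cst c) (Isub D I.obj s))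
  | _, _, _, .star (Δ := Δ) (n := n), _ =>
      D.comp (discCtx D I.obj Δ) (starMap D I.obj n)
  | _, _, _, .lam0 (Δ := Δ) (x := x) (A := A) _ d, _ =>
      D.PhiInv (D.comp (extHom D I.obj Δ x A) (denC I d))
  | _, _, _, .lamS (Δ := Δ) (n := n) (x := x) (A := A) (B := B) _ d, _ =>
      D.comp (promCtx D I.obj Δ)
        (D.comp (D.Lmap (D.PhiInv (D.comp (extHom D I.obj (bangify Δ) x A) (denC I d))))
          (D.castHom rfl (denTy_bangN D I.obj (n + 1) (Ty.arrow A B)).symm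
            (padL D n (denTy D I.obj (Ty.arrow A B)))))
  | _, _, _, .app _ _ _, h => nomatch h
  | _, _, _, .pair (Δ := Δ) (Γ₁ := Γ₁) (Γ₂ := Γ₂) (n := n) (A₁ := A₁) (A₂ := A₂) _ d₁ d₂, h =>
      D.comp (splitDup D I.obj Δ Γ₁ Γ₂)
        (D.comp (D.tmap (denV d₁ (by simp [isValue] at h; exact h.1))
            (denV d₂ (by simp [isValue] at h; exact h.2)))
          (m2nD D I.obj n A₁ A₂))
  | _, _, _, .letv (Δ := Δ) (Γ₁ := Γ₁) (Γ₂ := Γ₂) (x := x) (A := A) _ _ d₁ d₂, h =>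
      D.comp (splitDup D I.obj Δ Γ₁ Γ₂)
        (D.comp (D.tmap (denV d₁ (by simp [isValue] at h; exact h.1)) (D.id _))
          (D.comp (D.symm _ _)
            (D.comp (extHom D I.obj (bangify Δ ++ Γ₂) x A)
              (denV d₂ (by simp [isValue] at h; exact h.2)))))
  | _, _, _, .letUnit (Δ := Δ) (Γ₁ := Γ₁) (Γ₂ := Γ₂) _ d₁ d₂, h =>
      D.comp (splitDup D I.obj Δ Γ₁ Γ₂)
        (D.comp (D.tmap (denV d₁ (by simp [isValue] at h; exact h.1)) (D.id _))
          (D.comp (D.symm _ _)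
            (D.comp (D.runit _) (denV d₂ (by simp [isValue] at h; exact h.2)))))
  | _, _, _, .letPair (Δ := Δ) (Γ₁ := Γ₁) (Γ₂ := Γ₂) (n := n) (x₁ := x₁) (A₁ := A₁)
      (x₂ := x₂) (A₂ := A₂) _ _ _ _ d₁ d₂, h =>
      D.comp (splitDup D I.obj Δ Γ₁ Γ₂)
        (D.comp (D.tmap (denV d₁ (by simp [isValue] at h; exact h.1)) (D.id _))
          (D.comp (D.symm _ _)
            (D.comp (D.tmap (D.id _) (m2nDInv D I.obj n A₁ A₂))
              (D.comp (ext2Hom D I.obj (bangify Δ ++ Γ₂) x₁ (bangN n A₁) x₂ (bangN n A₂))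
                (denV d₂ (by simp [isValue] at h; exact h.2))))))

end QLamSem

namespace QLamSem

/-- The laws of a linear category for duplication, as a type class. -/
class LC (D : LCDData) : Prop where
  laws : LCDLaws D

section Algebra

local notation:80 f:81 ";;" g:80 => LCDData.comp _ f g
local notation:90 f:91 "⊠" g:90 => LCDData.tmap _ f g

variable {D : LCDData} [LC D]

@[simp] theorem id_comp' {A B : D.Obj} (f : D.Hom A B) : D.id A ;; f = f := LC.laws.id_comp f

@[simp] theorem comp_id' {A B : D.Obj} (f : D.Hom A B) : f ;; D.id B = f := LC.laws.comp_id f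

@[simp] theorem comp_assoc' {A B X Y : D.Obj} (f : D.Hom A B) (g : D.Hom B X) (h : D.Hom X Y) :
    (f ;; g) ;; h = f ;; g ;; h := LC.laws.comp_assoc f g h

@[simp] theorem tmap_id' (A B : D.Obj) : D.id A ⊠ D.id B = D.id (D.tens A B) :=
  LC.laws.tmap_id A B

@[simp] theorem tmap_comp_tmap {A B X A' B' X' : D.Obj} (f : D.Hom A B) (g : D.Hom B X)
    (f' : D.Hom A' B') (g' : D.Hom B' X') :
    (f ⊠ f') ;; (g ⊠ g') = (f ;; g) ⊠ (f' ;; g') := (LC.laws.tmap_comp f g f' g').symm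

@[simp] theorem tmap_comp_tmap_assoc {A B X A' B' X' Y : D.Obj} (f : D.Hom A B) (g : D.Hom B X)
    (f' : D.Hom A' B') (g' : D.Hom B' X') (h : D.Hom (D.tens X X') Y) :
    (f ⊠ f') ;; (g ⊠ g') ;; h = ((f ;; g) ⊠ (f' ;; g')) ;; h := by
  rw [← comp_assoc', tmap_comp_tmap]

/-- Rewriting the first two factors of a composite. -/
theorem comp_congr_assoc {A B B' X Y : D.Obj} {f : D.Hom A B} {g : D.Hom B X}
    {f' : D.Hom A B'} {g' : D.Hom B' X} (e : f ;; g = f' ;; g') (h : D.Hom X Y) :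
    f ;; g ;; h = f' ;; g' ;; h := by
  rw [← comp_assoc', e, comp_assoc']

@[simp] theorem assoc_assocInv (A B X : D.Obj) :
    D.assoc A B X ;; D.assocInv A B X = D.id _ := LC.laws.assoc_iso₁ A B X

@[simp] theorem assocInv_assoc (A B X : D.Obj) :
    D.assocInv A B X ;; D.assoc A B X = D.id _ := LC.laws.assoc_iso₂ A B X

@[simp] theorem symm_symm' (A B : D.Obj) : D.symm A B ;; D.symm B A = D.id _ :=
  LC.laws.symm_symm A B

@[simp] theorem lunit_lunitInv (A : D.Obj) : D.lunit A ;; D.lunitInv A = D.id _ :=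
  LC.laws.lunit_iso₁ A

@[simp] theorem lunitInv_lunit (A : D.Obj) : D.lunitInv A ;; D.lunit A = D.id _ :=
  LC.laws.lunit_iso₂ A

@[simp] theorem runit_runitInv (A : D.Obj) : D.runit A ;; D.runitInv A = D.id _ :=
  LC.laws.runit_iso₁ A

@[simp] theorem runitInv_runit (A : D.Obj) : D.runitInv A ;; D.runit A = D.id _ :=
  LC.laws.runit_iso₂ A

/-- Collapsing the first two factors of a composite. -/
theorem comp_eq_assoc {A B X Y : D.Obj} {f : D.Hom A B} {g : D.Hom B X}
    {f' : D.Hom A X} (e : f ;; g = f') (h : D.Hom X Y) :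
    f ;; g ;; h = f' ;; h := by
  rw [← comp_assoc', e]

theorem inv_unique {A B : D.Obj} {f : D.Hom A B} {g h : D.Hom B A} (e₁ : g ;; f = D.id B)
    (e₂ : f ;; h = D.id A) : g = h := by
  rw [← comp_id' g, ← e₂, ← comp_assoc', e₁, id_comp']

@[simp] theorem assoc_assocInv_assoc (A B X : D.Obj) {Y : D.Obj} (h : D.Hom _ Y) :
    D.assoc A B X ;; D.assocInv A B X ;; h = h := by
  rw [comp_eq_assoc (assoc_assocInv A B X), id_comp']

@[simp] theorem assocInv_assoc_assoc (A B X : D.Obj) {Y : D.Obj} (h : D.Hom _ Y) :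
    D.assocInv A B X ;; D.assoc A B X ;; h = h := by
  rw [comp_eq_assoc (assocInv_assoc A B X), id_comp']

@[simp] theorem symm_symm_assoc (A B : D.Obj) {Y : D.Obj} (h : D.Hom _ Y) :
    D.symm A B ;; D.symm B A ;; h = h := by
  rw [comp_eq_assoc (symm_symm' A B), id_comp']

@[simp] theorem lunitInv_lunit_assoc (A : D.Obj) {Y : D.Obj} (h : D.Hom _ Y) :
    D.lunitInv A ;; D.lunit A ;; h = h := by
  rw [comp_eq_assoc (lunitInv_lunit A), id_comp']

@[simp] theorem runitInv_runit_assoc (A : D.Obj) {Y : D.Obj} (h : D.Hom _ Y) :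
    D.runitInv A ;; D.runit A ;; h = h := by
  rw [comp_eq_assoc (runitInv_runit A), id_comp']

theorem hexagon_reverse' (A B X : D.Obj) :
    D.assocInv A B X ;; D.symm (D.tens A B) X ;; D.assocInv X A B =
      (D.id A ⊠ D.symm B X) ;; D.assocInv A X B ;; (D.symm A X ⊠ D.id B) := by
  refine inv_unique (f := D.assoc X A B ;; D.symm X (D.tens A B) ;; D.assoc A B X) ?_ ?_
  · simp
  · rw [LC.laws.hexagon]
    simp

end Algebra

section Coherence

open CategoryTheory MonoidalCategory

local notation:80 f:81 ";;" g:80 => LCDData.comp _ f g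
local notation:90 f:91 "⊠" g:90 => LCDData.tmap _ f g

/-- The objects of a linear category for duplication. -/
def CObj (D : LCDData) : Type := D.Obj

variable (D : LCDData) [LC D]

instance : Category (CObj D) where
  Hom A B := D.Hom A B
  id A := D.id A
  comp f g := D.comp f g
  id_comp f := LC.laws.id_comp f
  comp_id f := LC.laws.comp_id f
  assoc f g h := LC.laws.comp_assoc f g h

instance : MonoidalCategoryStruct (CObj D) where
  tensorObj A B := D.tens A B
  tensorUnit := D.unit
  tensorHom f g := D.tmap f g
  whiskerLeft X _ _ f := D.tmap (D.id X) f
  whiskerRight f Y := D.tmap f (D.id Y)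
  associator A B X := ⟨D.assoc A B X, D.assocInv A B X, LC.laws.assoc_iso₁ A B X,
    LC.laws.assoc_iso₂ A B X⟩
  leftUnitor A := ⟨D.lunit A, D.lunitInv A, LC.laws.lunit_iso₁ A, LC.laws.lunit_iso₂ A⟩
  rightUnitor A := ⟨D.runit A, D.runitInv A, LC.laws.runit_iso₁ A, LC.laws.runit_iso₂ A⟩

instance : MonoidalCategory (CObj D) := MonoidalCategory.ofTensorHom
  (id_tensorHom_id := fun A B => LC.laws.tmap_id A B)
  (id_tensorHom := fun _ _ _ _ => rfl)
  (tensorHom_id := fun _ _ => rfl)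
  (tensorHom_comp_tensorHom := fun f g h k => (LC.laws.tmap_comp f h g k).symm)
  (associator_naturality := fun f g h => LC.laws.assoc_natural f g h)
  (leftUnitor_naturality := fun f => LC.laws.lunit_natural f)
  (rightUnitor_naturality := fun f => LC.laws.runit_natural f)
  (pentagon := fun A B X Y => (LC.laws.pentagon A B X Y).symm)
  (triangle := fun A B => LC.laws.triangle A B)

instance : SymmetricCategory (CObj D) where
  braiding A B := ⟨D.symm A B, D.symm B A, LC.laws.symm_symm A B, LC.laws.symm_symm B A⟩
  braiding_naturality_right X _ _ f := LC.laws.symm_natural (D.id X) f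
  braiding_naturality_left f Y := LC.laws.symm_natural f (D.id Y)
  hexagon_forward A B X := LC.laws.hexagon A B X
  hexagon_reverse A B X := hexagon_reverse' A B X
  symmetry A B := LC.laws.symm_symm A B

/-- The symmetric swap `a ⊗ (b ⊗ c) → b ⊗ (a ⊗ c)`. -/
def swp (a b c : D.Obj) : D.Hom (D.tens a (D.tens b c)) (D.tens b (D.tens a c)) :=
  D.assocInv a b c ;; (D.symm a b ⊠ D.id c) ;; D.assoc b a c

variable {D}

section Generic

variable {C : Type} [Category.{0} C] [MonoidalCategory C] [SymmetricCategory C]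

/-- `swp` in a symmetric monoidal category. -/
def gswp (a b c : C) : a ⊗ (b ⊗ c) ⟶ b ⊗ (a ⊗ c) :=
  (α_ a b c).inv ≫ ((β_ a b).hom ⊗ₘ 𝟙 c) ≫ (α_ b a c).hom

/-- The middle-four interchange in a symmetric monoidal category. -/
def gmid (a b c d : C) : (a ⊗ b) ⊗ (c ⊗ d) ⟶ (a ⊗ c) ⊗ (b ⊗ d) :=
  (α_ a b (c ⊗ d)).hom ≫ (𝟙 a ⊗ₘ ((α_ b c d).inv ≫ ((β_ b c).hom ⊗ₘ 𝟙 d) ≫ (α_ c b d).hom)) ≫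
    (α_ a c (b ⊗ d)).inv

theorem gmid_eq (a b c d : C) : gmid a b c d = tensorμ a b c d := by
  simp [gmid, tensorμ]

theorem gswp_lunit (q c : C) : gswp q (𝟙_ C) c ≫ (λ_ (q ⊗ c)).hom = 𝟙 q ⊗ₘ (λ_ c).hom := by
  simp [gswp]

theorem gswp_unit (p c : C) : gswp (𝟙_ C) p c ≫ (𝟙 p ⊗ₘ (λ_ c).hom) = (λ_ (p ⊗ c)).hom := by
  simp [gswp]

theorem gmid_lunit (a b : C) :
    ((λ_ (𝟙_ C)).inv ⊗ₘ 𝟙 (a ⊗ b)) ≫ gmid _ _ a b ≫ ((λ_ a).hom ⊗ₘ (λ_ b).hom) =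
      (λ_ (a ⊗ b)).hom := by
  rw [gmid_eq, tensor_left_unitality, tensorHom_id]

theorem gmid_assoc (a b c d e f : C) :
    (gmid a b c d ⊗ₘ 𝟙 (e ⊗ f)) ≫ gmid (a ⊗ c) (b ⊗ d) e f ≫ ((α_ a c e).hom ⊗ₘ (α_ b d f).hom) =
      (α_ (a ⊗ b) (c ⊗ d) (e ⊗ f)).hom ≫ (𝟙 (a ⊗ b) ⊗ₘ gmid c d e f) ≫
        gmid a b (c ⊗ e) (d ⊗ f) := by
  simp only [gmid_eq, id_tensorHom, tensorHom_id]
  exact tensor_associativity a b c d e f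

theorem gmid_braid (a b c d : C) :
    (β_ (a ⊗ b) (c ⊗ d)).hom ≫ gmid c d a b = gmid a b c d ≫ ((β_ a c).hom ⊗ₘ (β_ b d).hom) := by
  simp only [gmid_eq]
  simp [tensorμ, SymmetricCategory.braiding_swap_eq_inv_braiding d a, MonoidalCategory.tensorHom_def]

theorem gmid_runit (a b c : C) :
    ((ρ_ a).inv ⊗ₘ 𝟙 (b ⊗ c)) ≫ gmid a (𝟙_ C) b c ≫ (𝟙 (a ⊗ b) ⊗ₘ (λ_ c).hom) =
      (α_ a b c).inv := by
  simp [gmid]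

theorem gmid_lunitInv (a b : C) :
    ((λ_ a).inv ⊗ₘ (λ_ b).inv) ≫ gmid (𝟙_ C) a (𝟙_ C) b ≫ ((λ_ (𝟙_ C)).hom ⊗ₘ 𝟙 (a ⊗ b)) =
      (λ_ (a ⊗ b)).inv := by
  rw [gmid_eq]
  have h := leftUnitor_monoidal a b
  rw [← cancel_mono (λ_ (a ⊗ b)).hom, Category.assoc, Category.assoc, tensorHom_id, ← h]
  simp

theorem gmid_natural {a b c d a' b' c' d' : C} (f : a ⟶ a') (g : b ⟶ b') (h : c ⟶ c')
    (k : d ⟶ d') :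
    ((f ⊗ₘ g) ⊗ₘ (h ⊗ₘ k)) ≫ gmid a' b' c' d' = gmid a b c d ≫ ((f ⊗ₘ h) ⊗ₘ (g ⊗ₘ k)) := by
  simp only [gmid_eq]
  exact tensorμ_natural f g h k

theorem gmid_swp (q₁ q₂ p₁ p₂ g₁ g₂ : C) :
    gswp (q₁ ⊗ q₂) (p₁ ⊗ p₂) (g₁ ⊗ g₂) ≫ (𝟙 (p₁ ⊗ p₂) ⊗ₘ gmid q₁ q₂ g₁ g₂) ≫
        gmid p₁ p₂ (q₁ ⊗ g₁) (q₂ ⊗ g₂) =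
      (𝟙 (q₁ ⊗ q₂) ⊗ₘ gmid p₁ p₂ g₁ g₂) ≫ gmid q₁ q₂ (p₁ ⊗ g₁) (p₂ ⊗ g₂) ≫
        (gswp q₁ p₁ g₁ ⊗ₘ gswp q₂ p₂ g₂) := by
  have e₁ := gmid_assoc p₁ p₂ q₁ q₂ g₁ g₂
  have e₂ := gmid_assoc q₁ q₂ p₁ p₂ g₁ g₂
  have e₃ := gmid_braid q₁ q₂ p₁ p₂
  have e₄ := gmid_natural (β_ q₁ p₁).hom (β_ q₂ p₂).hom (𝟙 g₁) (𝟙 g₂)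
  rw [← cancel_epi (α_ (q₁ ⊗ q₂) (p₁ ⊗ p₂) (g₁ ⊗ g₂)).hom]
  rw [← reassoc_of% e₂]
  simp only [gswp, Category.assoc, Iso.hom_inv_id_assoc, tensorHom_comp_tensorHom]
  rw [← e₁, tensorHom_comp_tensorHom_assoc, e₃]
  simp only [Category.comp_id]
  rw [show (gmid q₁ q₂ p₁ p₂ ≫ ((β_ q₁ p₁).hom ⊗ₘ (β_ q₂ p₂).hom)) ⊗ₘ 𝟙 (g₁ ⊗ g₂) =
    (gmid q₁ q₂ p₁ p₂ ⊗ₘ 𝟙 (g₁ ⊗ g₂)) ≫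
      (((β_ q₁ p₁).hom ⊗ₘ (β_ q₂ p₂).hom) ⊗ₘ (𝟙 g₁ ⊗ₘ 𝟙 g₂)) by simp]
  rw [Category.assoc, reassoc_of% e₄]
  simp only [tensorHom_comp_tensorHom]

theorem symm_assoc_step (x p c : C) :
    (β_ x (p ⊗ c)).hom ≫ (α_ p c x).hom = gswp x p c ≫ (𝟙 p ⊗ₘ (β_ x c).hom) := by
  simp [gswp]

theorem symm_unit_step (a : C) :
    (β_ a (𝟙_ C)).hom ≫ (𝟙 (𝟙_ C) ⊗ₘ (ρ_ a).inv) ≫ (λ_ (a ⊗ 𝟙_ C)).hom = 𝟙 _ := by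
  rw [braiding_tensorUnit_right]
  monoidal

theorem symm_unit_step₂ (a b : C) :
    (α_ a b (𝟙_ C)).inv ≫ (β_ (a ⊗ b) (𝟙_ C)).hom ≫ (𝟙 (𝟙_ C) ⊗ₘ (𝟙 a ⊗ₘ (ρ_ b).inv)) ≫
      (λ_ (a ⊗ b ⊗ 𝟙_ C)).hom = 𝟙 _ := by
  rw [braiding_tensorUnit_right]
  monoidal

theorem assocInv_swp (a b p c : C) :
    (α_ a b (p ⊗ c)).inv ≫ gswp (a ⊗ b) p c =
      (𝟙 a ⊗ₘ gswp b p c) ≫ gswp a p (b ⊗ c) ≫ (𝟙 p ⊗ₘ (α_ a b c).inv) := by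
  simp [gswp]

end Generic

theorem swp_lunit (q c : D.Obj) : swp D q D.unit c ;; D.lunit (D.tens q c) = D.id q ⊠ D.lunit c :=
  gswp_lunit (C := CObj D) q c

theorem swp_unit (p c : D.Obj) :
    swp D D.unit p c ;; (D.id p ⊠ D.lunit c) = D.lunit (D.tens p c) :=
  gswp_unit (C := CObj D) p c

theorem mid4_lunit (a b : D.Obj) :
    (D.lunitInv D.unit ⊠ D.id (D.tens a b)) ;; mid4 D _ _ a b ;; (D.lunit a ⊠ D.lunit b) =
      D.lunit (D.tens a b) :=
  gmid_lunit (C := CObj D) a b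

theorem mid4_assoc (a b c d e f : D.Obj) :
    (mid4 D a b c d ⊠ D.id (D.tens e f)) ;; mid4 D (D.tens a c) (D.tens b d) e f ;;
        (D.assoc a c e ⊠ D.assoc b d f) =
      D.assoc (D.tens a b) (D.tens c d) (D.tens e f) ;; (D.id (D.tens a b) ⊠ mid4 D c d e f) ;;
        mid4 D a b (D.tens c e) (D.tens d f) :=
  gmid_assoc (C := CObj D) a b c d e f

theorem mid4_natural {a b c d a' b' c' d' : D.Obj} (f : D.Hom a a') (g : D.Hom b b')
    (h : D.Hom c c') (k : D.Hom d d') :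
    ((f ⊠ g) ⊠ (h ⊠ k)) ;; mid4 D a' b' c' d' = mid4 D a b c d ;; ((f ⊠ h) ⊠ (g ⊠ k)) :=
  gmid_natural (C := CObj D) f g h k

theorem mid4_runit (a b c : D.Obj) :
    (D.runitInv a ⊠ D.id (D.tens b c)) ;; mid4 D a D.unit b c ;; (D.id (D.tens a b) ⊠ D.lunit c) =
      D.assocInv a b c :=
  gmid_runit (C := CObj D) a b c

theorem mid4_lunitInv (a b : D.Obj) :
    (D.lunitInv a ⊠ D.lunitInv b) ;; mid4 D D.unit a D.unit b ;;
      (D.lunit D.unit ⊠ D.id (D.tens a b)) = D.lunitInv (D.tens a b) :=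
  gmid_lunitInv (C := CObj D) a b

theorem mid4_swp (q₁ q₂ p₁ p₂ g₁ g₂ : D.Obj) :
    swp D (D.tens q₁ q₂) (D.tens p₁ p₂) (D.tens g₁ g₂) ;;
        (D.id (D.tens p₁ p₂) ⊠ mid4 D q₁ q₂ g₁ g₂) ;; mid4 D p₁ p₂ (D.tens q₁ g₁) (D.tens q₂ g₂) =
      (D.id (D.tens q₁ q₂) ⊠ mid4 D p₁ p₂ g₁ g₂) ;; mid4 D q₁ q₂ (D.tens p₁ g₁) (D.tens p₂ g₂) ;;
        (swp D q₁ p₁ g₁ ⊠ swp D q₂ p₂ g₂) :=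
  gmid_swp (C := CObj D) q₁ q₂ p₁ p₂ g₁ g₂

theorem symm_assoc (x p c : D.Obj) :
    D.symm x (D.tens p c) ;; D.assoc p c x = swp D x p c ;; (D.id p ⊠ D.symm x c) :=
  symm_assoc_step (C := CObj D) x p c

theorem symm_unit (a : D.Obj) :
    D.symm a D.unit ;; (D.id D.unit ⊠ D.runitInv a) ;; D.lunit (D.tens a D.unit) = D.id _ :=
  symm_unit_step (C := CObj D) a

theorem symm_unit₂ (a b : D.Obj) :
    D.assocInv a b D.unit ;; D.symm (D.tens a b) D.unit ;;
      (D.id D.unit ⊠ (D.id a ⊠ D.runitInv b)) ;; D.lunit (D.tens a (D.tens b D.unit)) = D.id _ :=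
  symm_unit_step₂ (C := CObj D) a b

theorem assocInv_swp' (a b p c : D.Obj) :
    D.assocInv a b (D.tens p c) ;; swp D (D.tens a b) p c =
      (D.id a ⊠ swp D b p c) ;; swp D a p (D.tens b c) ;; (D.id p ⊠ D.assocInv a b c) :=
  assocInv_swp (C := CObj D) a b p c

theorem assoc_natural' {a b c a' b' c' : D.Obj} (f : D.Hom a a') (g : D.Hom b b')
    (h : D.Hom c c') :
    ((f ⊠ g) ⊠ h) ;; D.assoc a' b' c' = D.assoc a b c ;; (f ⊠ (g ⊠ h)) :=
  LC.laws.assoc_natural f g h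

theorem assocInv_natural {a b c a' b' c' : D.Obj} (f : D.Hom a a') (g : D.Hom b b')
    (h : D.Hom c c') :
    (f ⊠ (g ⊠ h)) ;; D.assocInv a' b' c' = D.assocInv a b c ;; ((f ⊠ g) ⊠ h) := by
  have e := congrArg (fun t => D.assocInv a b c ;; t ;; D.assocInv a' b' c')
    (assoc_natural' f g h)
  simpa using e.symm

theorem symm_natural' {a b a' b' : D.Obj} (f : D.Hom a a') (g : D.Hom b b') :
    (f ⊠ g) ;; D.symm a' b' = D.symm a b ;; (g ⊠ f) := LC.laws.symm_natural f g

theorem lunit_natural' {a a' : D.Obj} (f : D.Hom a a') :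
    (D.id D.unit ⊠ f) ;; D.lunit a' = D.lunit a ;; f := LC.laws.lunit_natural f

theorem runit_natural' {a a' : D.Obj} (f : D.Hom a a') :
    (f ⊠ D.id D.unit) ;; D.runit a' = D.runit a ;; f := LC.laws.runit_natural f

theorem lunitInv_natural {a a' : D.Obj} (f : D.Hom a a') :
    f ;; D.lunitInv a' = D.lunitInv a ;; (D.id D.unit ⊠ f) := by
  have e := congrArg (fun t => D.lunitInv a ;; t ;; D.lunitInv a') (lunit_natural' f)
  simpa using e.symm

theorem runitInv_natural {a a' : D.Obj} (f : D.Hom a a') :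
    f ;; D.runitInv a' = D.runitInv a ;; (f ⊠ D.id D.unit) := by
  have e := congrArg (fun t => D.runitInv a ;; t ;; D.runitInv a') (runit_natural' f)
  simpa using e.symm

theorem swp_natural {a b c a' b' c' : D.Obj} (f : D.Hom a a') (g : D.Hom b b')
    (h : D.Hom c c') :
    (f ⊠ (g ⊠ h)) ;; swp D a' b' c' = swp D a b c ;; (g ⊠ (f ⊠ h)) := by
  simp only [swp, comp_assoc']
  rw [comp_congr_assoc (assocInv_natural f g h), tmap_comp_tmap_assoc, symm_natural', comp_id',
    ← id_comp' h, ← tmap_comp_tmap, comp_assoc', id_comp' h, assoc_natural']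

end Coherence

end QLamSem

namespace QLamSem

section Coalgebras

local notation:80 f:81 ";;" g:80 => LCDData.comp _ f g
local notation:90 f:91 "⊠" g:90 => LCDData.tmap _ f g

variable {D : LCDData} [LC D]

/-- `Y` carries a section of the counit of `L`; by idempotency, such an object is an
`L`-coalgebra in a unique way. -/
def IsCo (D : LCDData) (Y : D.Obj) : Prop := ∃ c : D.Hom Y (D.L Y), c ;; D.eps Y = D.id Y

theorem delta_eps (A : D.Obj) : D.delta A ;; D.eps (D.L A) = D.id (D.L A) :=
  LC.laws.delta_counit_left A

theorem Lmap_eps (A : D.Obj) : D.Lmap (D.eps A) = D.eps (D.L A) := by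
  have e₁ : D.Lmap (D.eps A) = D.deltaInv A := (inv_unique (f := D.delta A)
    (LC.laws.delta_iso₂ A) (LC.laws.delta_counit_right A)).symm
  have e₂ : D.eps (D.L A) = D.deltaInv A := (inv_unique (f := D.delta A)
    (LC.laws.delta_iso₂ A) (LC.laws.delta_counit_left A)).symm
  rw [e₁, e₂]

theorem Lmap_eps_comm {A B : D.Obj} (f : D.Hom A B) : D.Lmap f ;; D.eps B = D.eps A ;; f :=
  LC.laws.eps_natural f

theorem Lmap_comp' {A B X : D.Obj} (f : D.Hom A B) (g : D.Hom B X) :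
    D.Lmap (f ;; g) = D.Lmap f ;; D.Lmap g := LC.laws.Lmap_comp f g

theorem Lmap_id' (A : D.Obj) : D.Lmap (D.id A) = D.id (D.L A) := LC.laws.Lmap_id A

theorem eps_section {Y : D.Obj} {c : D.Hom Y (D.L Y)} (hc : c ;; D.eps Y = D.id Y) :
    D.eps Y ;; c = D.id (D.L Y) := by
  rw [← Lmap_eps_comm, ← Lmap_eps, ← Lmap_comp', hc, Lmap_id']

theorem section_natural {Y Z : D.Obj} {c : D.Hom Y (D.L Y)} (hc : c ;; D.eps Y = D.id Y)
    {d : D.Hom Z (D.L Z)} (hd : d ;; D.eps Z = D.id Z) (f : D.Hom Y Z) :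
    f ;; d = c ;; D.Lmap f := by
  rw [← comp_id' (D.Lmap f), ← eps_section hd, comp_congr_assoc (Lmap_eps_comm f),
    comp_eq_assoc hc, id_comp']

/-- The counit of the comonoid structure on a coalgebra. -/
def coDisc {Y : D.Obj} (c : D.Hom Y (D.L Y)) : D.Hom Y D.unit := c ;; D.disc Y

/-- The comultiplication of the comonoid structure on a coalgebra. -/
def coDup {Y : D.Obj} (c : D.Hom Y (D.L Y)) : D.Hom Y (D.tens Y Y) :=
  c ;; D.dup Y ;; (D.eps Y ⊠ D.eps Y)

theorem coDisc_natural {Y Z : D.Obj} {c : D.Hom Y (D.L Y)} (hc : c ;; D.eps Y = D.id Y)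
    {d : D.Hom Z (D.L Z)} (hd : d ;; D.eps Z = D.id Z) (f : D.Hom Y Z) :
    f ;; coDisc d = coDisc c := by
  rw [coDisc, comp_congr_assoc (section_natural hc hd f), LC.laws.disc_natural]
  rfl

theorem coDup_natural {Y Z : D.Obj} {c : D.Hom Y (D.L Y)} (hc : c ;; D.eps Y = D.id Y)
    {d : D.Hom Z (D.L Z)} (hd : d ;; D.eps Z = D.id Z) (f : D.Hom Y Z) :
    f ;; coDup d = coDup c ;; (f ⊠ f) := by
  rw [coDup, comp_congr_assoc (section_natural hc hd f),
    comp_congr_assoc (LC.laws.dup_natural f), tmap_comp_tmap, Lmap_eps_comm, coDup]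
  simp

theorem coDup_delta (A : D.Obj) : coDup (D.delta A) = D.dup A := by
  rw [coDup, comp_congr_assoc (LC.laws.delta_comonoid_dup A), tmap_comp_tmap, delta_eps,
    tmap_id', comp_id']

theorem coDup_coDisc_left {Y : D.Obj} {c : D.Hom Y (D.L Y)} (hc : c ;; D.eps Y = D.id Y) :
    coDup c ;; (coDisc c ⊠ D.id Y) = D.lunitInv Y := by
  have e : coDup c ;; (coDisc c ⊠ D.id Y) ;; D.lunit Y = D.id Y := by
    have h : (coDup c ;; (coDisc c ⊠ D.id Y) ;; D.lunit Y) =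
        c ;; (D.dup Y ;; (D.disc Y ⊠ D.id (D.L Y)) ;; D.lunit (D.L Y)) ;; D.eps Y := by
      simp only [coDup, coDisc, comp_assoc', tmap_comp_tmap_assoc, comp_id']
      rw [comp_eq_assoc (eps_section hc), id_comp', ← lunit_natural', tmap_comp_tmap_assoc]
      simp
    rw [h, LC.laws.dup_counit_left, id_comp', hc]
  have := congrArg (· ;; D.lunitInv Y) e
  simpa using this

theorem coDup_coDisc_right {Y : D.Obj} {c : D.Hom Y (D.L Y)} (hc : c ;; D.eps Y = D.id Y) :
    coDup c ;; (D.id Y ⊠ coDisc c) = D.runitInv Y := by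
  have e : coDup c ;; (D.id Y ⊠ coDisc c) ;; D.runit Y = D.id Y := by
    have h : (coDup c ;; (D.id Y ⊠ coDisc c) ;; D.runit Y) =
        c ;; (D.dup Y ;; (D.id (D.L Y) ⊠ D.disc Y) ;; D.runit (D.L Y)) ;; D.eps Y := by
      simp only [coDup, coDisc, comp_assoc', tmap_comp_tmap_assoc, comp_id']
      rw [comp_eq_assoc (eps_section hc), id_comp', ← runit_natural', tmap_comp_tmap_assoc]
      simp
    rw [h, LC.laws.dup_counit_right, id_comp', hc]
  have := congrArg (· ;; D.runitInv Y) e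
  simpa using this

theorem isCo_L (A : D.Obj) : IsCo D (D.L A) := ⟨D.delta A, delta_eps A⟩

theorem m0_eps : D.m0 ;; D.eps D.unit = D.id D.unit := LC.laws.eps_monoidal_unit

theorem isCo_unit : IsCo D D.unit := ⟨D.m0, m0_eps⟩

theorem IsCo.tens {Y Z : D.Obj} (hY : IsCo D Y) (hZ : IsCo D Z) : IsCo D (D.tens Y Z) := by
  obtain ⟨c, hc⟩ := hY
  obtain ⟨d, hd⟩ := hZ
  refine ⟨(c ⊠ d) ;; D.m2 Y Z, ?_⟩
  rw [comp_assoc', LC.laws.eps_monoidal, tmap_comp_tmap, hc, hd, tmap_id']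

/-- A morphism from a coalgebra to the unit is the counit. -/
theorem eq_coDisc {Y : D.Obj} {c : D.Hom Y (D.L Y)} (hc : c ;; D.eps Y = D.id Y)
    (f : D.Hom Y D.unit) : f = coDisc c := by
  rw [← coDisc_natural hc m0_eps f, coDisc, LC.laws.disc_monoidal_unit, comp_id']

theorem IsCo.unit_unique {Y : D.Obj} (hY : IsCo D Y) (f g : D.Hom Y D.unit) : f = g := by
  obtain ⟨c, hc⟩ := hY
  rw [eq_coDisc hc f, eq_coDisc hc g]

/-- Morphisms from a coalgebra into `L A` are determined by their composite with `ε`. -/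
theorem IsCo.ext_L {Y A : D.Obj} (hY : IsCo D Y) {f g : D.Hom Y (D.L A)}
    (e : f ;; D.eps A = g ;; D.eps A) : f = g := by
  obtain ⟨c, hc⟩ := hY
  have h (k : D.Hom Y (D.L A)) : k = c ;; D.Lmap (k ;; D.eps A) := by
    rw [Lmap_comp', ← comp_congr_assoc (section_natural hc (delta_eps A) k), Lmap_eps, delta_eps,
      comp_id']
  rw [h f, e, ← h g]

theorem m2_m2Inv (A B : D.Obj) : D.m2 A B ;; D.m2Inv A B = D.id _ := LC.laws.m2_iso₁ A B

theorem m2Inv_m2 (A B : D.Obj) : D.m2Inv A B ;; D.m2 A B = D.id _ := LC.laws.m2_iso₂ A B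

theorem m2_eps (A B : D.Obj) : D.m2 A B ;; D.eps (D.tens A B) = D.eps A ⊠ D.eps B :=
  LC.laws.eps_monoidal A B

theorem m2Inv_eps (A B : D.Obj) : D.m2Inv A B ;; (D.eps A ⊠ D.eps B) = D.eps (D.tens A B) := by
  rw [← m2_eps, comp_eq_assoc (m2Inv_m2 A B), id_comp']

end Coalgebras

section Monad

local notation:80 f:81 ";;" g:80 => LCDData.comp _ f g
local notation:90 f:91 "⊠" g:90 => LCDData.tmap _ f g

variable {D : LCDData} [LC D]

theorem Tmap_comp' {A B X : D.Obj} (f : D.Hom A B) (g : D.Hom B X) :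
    D.Tmap (f ;; g) = D.Tmap f ;; D.Tmap g := LC.laws.Tmap_comp f g

theorem Tmap_id' (A : D.Obj) : D.Tmap (D.id A) = D.id (D.T A) := LC.laws.Tmap_id A

theorem eta_natural' {A B : D.Obj} (f : D.Hom A B) : D.eta A ;; D.Tmap f = f ;; D.eta B :=
  (LC.laws.eta_natural f).symm

theorem mu_natural' {A B : D.Obj} (f : D.Hom A B) :
    D.Tmap (D.Tmap f) ;; D.mu B = D.mu A ;; D.Tmap f := LC.laws.mu_natural f

theorem str_natural' {A A' B B' : D.Obj} (f : D.Hom A A') (g : D.Hom B B') :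
    (f ⊠ D.Tmap g) ;; D.str A' B' = D.str A B ;; D.Tmap (f ⊠ g) := LC.laws.str_natural f g

theorem Tmap_klift {A B X : D.Obj} (f : D.Hom A B) (g : D.Hom B (D.T X)) :
    D.Tmap f ;; D.klift g = D.klift (f ;; g) := by
  simp [LCDData.klift, Tmap_comp']

theorem klift_Tmap {A B X : D.Obj} (f : D.Hom A (D.T B)) (g : D.Hom B X) :
    D.klift f ;; D.Tmap g = D.klift (f ;; D.Tmap g) := by
  simp [LCDData.klift, Tmap_comp', mu_natural']

theorem Psi1_natural {A A' B B' : D.Obj} (f : D.Hom A A') (g : D.Hom B B') :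
    (D.Tmap f ⊠ D.Tmap g) ;; D.Psi1 A' B' = D.Psi1 A B ;; D.Tmap (f ⊠ g) := by
  simp only [LCDData.Psi1, comp_assoc', klift_Tmap]
  rw [comp_congr_assoc (symm_natural' _ _), comp_congr_assoc (str_natural' _ _), Tmap_klift,
    comp_congr_assoc (symm_natural' _ _), str_natural']

end Monad

section Exponential

local notation:80 f:81 ";;" g:80 => LCDData.comp _ f g
local notation:90 f:91 "⊠" g:90 => LCDData.tmap _ f g

variable {D : LCDData} [LC D]

theorem Phi_comp {X' X A B : D.Obj} (f : D.Hom X' X) (g : D.Hom X (D.lolli A B)) :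
    D.Phi (f ;; g) = (f ⊠ D.id A) ;; D.Phi g := LC.laws.Phi_natural_left f g

theorem Phi_eq_appnt {X A B : D.Obj} (f : D.Hom X (D.lolli A B)) :
    (f ⊠ D.id A) ;; D.appnt A B = D.Phi f := by
  rw [LCDData.appnt, ← Phi_comp, comp_id']

theorem tmap_appnt {X Y A B : D.Obj} (f : D.Hom X (D.lolli A B)) (g : D.Hom Y A) :
    (f ⊠ g) ;; D.appnt A B = (D.id X ⊠ g) ;; D.Phi f := by
  rw [← Phi_eq_appnt, tmap_comp_tmap_assoc, id_comp', comp_id']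

theorem Phi_injective {X A B : D.Obj} {f g : D.Hom X (D.lolli A B)} (h : D.Phi f = D.Phi g) :
    f = g := by
  rw [← LC.laws.Phi_iso₁ f, h, LC.laws.Phi_iso₁ g]

theorem Phi_PhiInv {X A B : D.Obj} (g : D.Hom (D.tens X A) (D.T B)) : D.Phi (D.PhiInv g) = g :=
  LC.laws.Phi_iso₂ g

end Exponential

end QLamSem

namespace QLamSem

section LogicalRelation

local notation:80 f:81 ";;" g:80 => LCDData.comp _ f g
local notation:90 f:91 "⊠" g:90 => LCDData.tmap _ f g

variable {D : LCDData}

/-- The types of the form `!A`. -/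
def IsBang : Ty → Prop
  | .bang _ => True
  | _ => False

/-- Closure of a relation under precomposition; when `co` holds, only through coalgebras. -/
def Lift {P P' : D.Obj} (co : Prop) (r : ∀ {X : D.Obj}, D.Hom X P → D.Hom X P' → Prop)
    {X : D.Obj} (a : D.Hom X P) (a' : D.Hom X P') : Prop :=
  ∃ (Y : D.Obj) (u : D.Hom X Y) (v : D.Hom Y P) (v' : D.Hom Y P'),
    (co → IsCo D Y) ∧ r v v' ∧ a = u ;; v ∧ a' = u ;; v'

/-- Lifting of a relation along the monad `T`. -/
def TLift {P P' : D.Obj} (r : ∀ {X : D.Obj}, D.Hom X P → D.Hom X P' → Prop)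
    {X : D.Obj} (c : D.Hom X (D.T P)) (c' : D.Hom X (D.T P')) : Prop :=
  ∃ (Z : D.Obj) (c₀ : D.Hom X (D.T Z)) (v : D.Hom Z P) (v' : D.Hom Z P'),
    r v v' ∧ c = c₀ ;; D.Tmap v ∧ c' = c₀ ;; D.Tmap v'

variable (Θ : ℕ → D.Obj)

/-- Extends a relation between morphisms to `P` and morphisms to non-`!` types to all types, by
composing with counits. -/
def peel (P : D.Obj)
    (r : ∀ (A' : Ty) {X : D.Obj}, D.Hom X P → D.Hom X (denTy D Θ A') → Prop) :
    ∀ (A' : Ty) {X : D.Obj}, D.Hom X P → D.Hom X (denTy D Θ A') → Prop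
  | .bang A', _, a, a' => peel P r A' a (a' ;; D.eps (denTy D Θ A'))
  | .tconst n, _, a, a' => r (.tconst n) a a'
  | .arrow B C, _, a, a' => r (.arrow B C) a a'
  | .tensor B C, _, a, a' => r (.tensor B C) a a'
  | .unit, _, a, a' => r .unit a a'

/-- The logical relation between generalized elements of two types that differ only in their
exponentials, before closing under precomposition through coalgebras. -/
def Core : ∀ (A A' : Ty) {X : D.Obj}, D.Hom X (denTy D Θ A) → D.Hom X (denTy D Θ A') → Prop
  | .bang A, A', _, a, a' => Core A A' (a ;; D.eps (denTy D Θ A)) a'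
  | .tconst n, A', _, a, a' => peel Θ (denTy D Θ (.tconst n)) (fun A'' _ b b' =>
      match A'', b' with
      | .tconst m, b' => n = m ∧ HEq b b'
      | _, _ => False) A' a a'
  | .unit, A', _, a, a' => peel Θ (denTy D Θ .unit) (fun A'' _ b b' =>
      match A'', b' with
      | .unit, b' => b = b'
      | _, _ => False) A' a a'
  | .tensor B C, A', _, a, a' => peel Θ (denTy D Θ (.tensor B C)) (fun A'' X b b' =>
      match A'', b' with
      | .tensor B' C', b' => ∃ (P Q : D.Obj) (u : D.Hom X (D.tens P Q))
          (p : D.Hom P (denTy D Θ B)) (p' : D.Hom P (denTy D Θ B'))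
          (q : D.Hom Q (denTy D Θ C)) (q' : D.Hom Q (denTy D Θ C')),
          Lift (IsBang B ∨ IsBang B') (Core B B') p p' ∧
          Lift (IsBang C ∨ IsBang C') (Core C C') q q' ∧
          b = u ;; (p ⊠ q) ∧ b' = u ;; (p' ⊠ q')
      | _, _ => False) A' a a'
  | .arrow B C, A', _, a, a' => peel Θ (denTy D Θ (.arrow B C)) (fun A'' _ b b' =>
      match A'', b' with
      | .arrow B' C', b' => ∀ (Y : D.Obj) (y : D.Hom Y (denTy D Θ B))
          (y' : D.Hom Y (denTy D Θ B')), Lift (IsBang B ∨ IsBang B') (Core B B') y y' →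
          TLift (Lift (IsBang C ∨ IsBang C') (Core C C'))
            ((b ⊠ y) ;; D.appnt (denTy D Θ B) (denTy D Θ C))
            ((b' ⊠ y') ;; D.appnt (denTy D Θ B') (denTy D Θ C'))
      | _, _ => False) A' a a'

/-- The logical relation between generalized elements of two types. -/
def Rel (A A' : Ty) {X : D.Obj} (a : D.Hom X (denTy D Θ A)) (a' : D.Hom X (denTy D Θ A')) : Prop :=
  Lift (IsBang A ∨ IsBang A') (Core Θ A A') a a'

/-- The logical relation between computations. -/
def RelT (A A' : Ty) {X : D.Obj} (c : D.Hom X (D.T (denTy D Θ A)))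
    (c' : D.Hom X (D.T (denTy D Θ A'))) : Prop :=
  TLift (Rel Θ A A') c c'

variable {Θ}

theorem core_bang_left {A A' : Ty} {X : D.Obj} {a : D.Hom X (denTy D Θ (.bang A))}
    {a' : D.Hom X (denTy D Θ A')} :
    Core Θ (.bang A) A' a a' ↔ Core Θ A A' (a ;; D.eps (denTy D Θ A)) a' := Iff.rfl

theorem core_bang_right {A A' : Ty} {X : D.Obj} {a : D.Hom X (denTy D Θ A)}
    {a' : D.Hom X (denTy D Θ (.bang A'))} :
    Core Θ A (.bang A') a a' ↔ Core Θ A A' a (a' ;; D.eps (denTy D Θ A')) := by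
  induction A with
  | bang A ih => exact ih
  | _ => exact Iff.rfl

theorem core_tensor {B C B' C' : Ty} {X : D.Obj} {a : D.Hom X (denTy D Θ (.tensor B C))}
    {a' : D.Hom X (denTy D Θ (.tensor B' C'))} :
    Core Θ (.tensor B C) (.tensor B' C') a a' ↔ ∃ (P Q : D.Obj) (u : D.Hom X (D.tens P Q))
          (p : D.Hom P (denTy D Θ B)) (p' : D.Hom P (denTy D Θ B'))
          (q : D.Hom Q (denTy D Θ C)) (q' : D.Hom Q (denTy D Θ C')),
          Rel Θ B B' p p' ∧ Rel Θ C C' q q' ∧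
          a = u ;; (p ⊠ q) ∧ a' = u ;; (p' ⊠ q') := Iff.rfl

theorem core_arrow {B C B' C' : Ty} {X : D.Obj} {a : D.Hom X (denTy D Θ (.arrow B C))}
    {a' : D.Hom X (denTy D Θ (.arrow B' C'))} :
    Core Θ (.arrow B C) (.arrow B' C') a a' ↔ ∀ (Y : D.Obj) (y : D.Hom Y (denTy D Θ B))
          (y' : D.Hom Y (denTy D Θ B')), Rel Θ B B' y y' → RelT Θ C C'
            ((a ⊠ y) ;; D.appnt (denTy D Θ B) (denTy D Θ C))
            ((a' ⊠ y') ;; D.appnt (denTy D Θ B') (denTy D Θ C')) := Iff.rfl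

theorem core_unit {X : D.Obj} {a a' : D.Hom X (denTy D Θ .unit)} :
    Core Θ .unit .unit a a' ↔ a = a' := Iff.rfl

variable [LC D]

theorem Rel.pre {A A' : Ty} {X Y : D.Obj} {a : D.Hom X (denTy D Θ A)}
    {a' : D.Hom X (denTy D Θ A')} (h : Rel Θ A A' a a') (f : D.Hom Y X) :
    Rel Θ A A' (f ;; a) (f ;; a') := by
  obtain ⟨Z, u, v, v', hco, hv, rfl, rfl⟩ := h
  exact ⟨Z, f ;; u, v, v', hco, hv, (comp_assoc' ..).symm, (comp_assoc' ..).symm⟩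

theorem RelT.pre {A A' : Ty} {X Y : D.Obj} {c : D.Hom X (D.T (denTy D Θ A))}
    {c' : D.Hom X (D.T (denTy D Θ A'))} (h : RelT Θ A A' c c') (f : D.Hom Y X) :
    RelT Θ A A' (f ;; c) (f ;; c') := by
  obtain ⟨Z, u, v, v', hv, rfl, rfl⟩ := h
  exact ⟨Z, f ;; u, v, v', hv, (comp_assoc' ..).symm, (comp_assoc' ..).symm⟩

theorem peel_pre {P : D.Obj}
    {r : ∀ (A' : Ty) {X : D.Obj}, D.Hom X P → D.Hom X (denTy D Θ A') → Prop}
    (hr : ∀ (A' : Ty) {X Y : D.Obj} (f : D.Hom Y X) (a : D.Hom X P) (a' : D.Hom X (denTy D Θ A')),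
      r A' a a' → r A' (f ;; a) (f ;; a')) {A' : Ty} {X Y : D.Obj} {a : D.Hom X P}
    {a' : D.Hom X (denTy D Θ A')} (h : peel Θ P r A' a a') (f : D.Hom Y X) :
    peel Θ P r A' (f ;; a) (f ;; a') := by
  induction A' with
  | bang A' ih =>
    have e : (f ;; a') ;; D.eps (denTy D Θ A') = f ;; a' ;; D.eps (denTy D Θ A') := comp_assoc' ..
    exact (congrArg (peel Θ P r A' (f ;; a)) e).mpr (ih h)
  | _ => exact hr _ f _ _ h

theorem Core.pre {A A' : Ty} {X Y : D.Obj} {a : D.Hom X (denTy D Θ A)}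
    {a' : D.Hom X (denTy D Θ A')} (h : Core Θ A A' a a') (f : D.Hom Y X) :
    Core Θ A A' (f ;; a) (f ;; a') := by
  induction A with
  | bang A ih =>
    have e : (f ;; a) ;; D.eps (denTy D Θ A) = f ;; a ;; D.eps (denTy D Θ A) := comp_assoc' ..
    exact (congrArg (fun b => Core Θ A A' b (f ;; a')) e).mpr (ih h)
  | tconst n =>
    refine peel_pre (fun A' X Y f a a' h => ?_) h f
    cases A' with
    | tconst m =>
      obtain ⟨rfl, h⟩ := h
      exact ⟨rfl, by rw [eq_of_heq h]⟩
    | _ => exact h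
  | unit =>
    refine peel_pre (fun A' X Y f a a' h => ?_) h f
    cases A' with
    | unit => exact congrArg (f ;; ·) h
    | _ => exact h
  | tensor B C =>
    refine peel_pre (fun A' X Y f a a' h => ?_) h f
    cases A' with
    | tensor B' C' =>
      obtain ⟨P, Q, u, p, p', q, q', h₁, h₂, rfl, rfl⟩ := h
      exact ⟨P, Q, f ;; u, p, p', q, q', h₁, h₂, (comp_assoc' ..).symm, (comp_assoc' ..).symm⟩
    | _ => exact h
  | arrow B C =>
    refine peel_pre (fun A' X Y f a a' h => ?_) h f
    cases A' with
    | arrow B' C' =>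
      intro Z y y' hy
      have := RelT.pre (h Z y y' hy) (f ⊠ D.id Z)
      have e {X Y Z : D.Obj} {B C : Ty} (f : D.Hom Y X) (a : D.Hom X (denTy D Θ (.arrow B C))) (y : D.Hom Z (denTy D Θ B)) :
          ((f ;; a) ⊠ y) ;; D.appnt (denTy D Θ B) (denTy D Θ C) =
            (f ⊠ D.id Z) ;; (a ⊠ y) ;; D.appnt (denTy D Θ B) (denTy D Θ C) := by
        refine .trans ?_ (tmap_comp_tmap_assoc f a (D.id Z) y (D.appnt (denTy D Θ B) _)).symm
        exact congrArg (fun z => ((f ;; a) ⊠ z) ;; D.appnt (denTy D Θ B) _) (id_comp' y).symm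
      exact (congrArg₂ (RelT Θ C C') (e f a y) (e f a' y')).mpr this
    | _ => exact h

theorem Rel.core {A A' : Ty} {X : D.Obj} {a : D.Hom X (denTy D Θ A)}
    {a' : D.Hom X (denTy D Θ A')} (h : Rel Θ A A' a a') : Core Θ A A' a a' := by
  obtain ⟨Y, u, v, v', -, hv, rfl, rfl⟩ := h
  exact hv.pre u

theorem Core.rel {A A' : Ty} {X : D.Obj} {a : D.Hom X (denTy D Θ A)}
    {a' : D.Hom X (denTy D Θ A')} (h : Core Θ A A' a a') (hco : IsBang A ∨ IsBang A' → IsCo D X) :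
    Rel Θ A A' a a' :=
  ⟨X, D.id X, a, a', hco, h, (id_comp' _).symm, (id_comp' _).symm⟩

/-- Transformations of related elements that only depend on the unclosed relation. -/
theorem Rel.map {A A' B B' : Ty} {X : D.Obj} {a : D.Hom X (denTy D Θ A)}
    {a' : D.Hom X (denTy D Θ A')} (h : Rel Θ A A' a a')
    {f : D.Hom (denTy D Θ A) (denTy D Θ B)} {f' : D.Hom (denTy D Θ A') (denTy D Θ B')}
    (hb : IsBang B ∨ IsBang B' → IsBang A ∨ IsBang A')
    (hf : ∀ {Y : D.Obj} (v : D.Hom Y (denTy D Θ A)) (v' : D.Hom Y (denTy D Θ A')),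
      Core Θ A A' v v' → Core Θ B B' (v ;; f) (v' ;; f')) :
    Rel Θ B B' (a ;; f) (a' ;; f') := by
  obtain ⟨Y, u, v, v', hco, hv, rfl, rfl⟩ := h
  exact ⟨Y, u, v ;; f, v' ;; f', fun h => hco (hb h), hf v v' hv, comp_assoc' .., comp_assoc' ..⟩

theorem RelT.map {A A' B B' : Ty} {X : D.Obj} {c : D.Hom X (D.T (denTy D Θ A))}
    {c' : D.Hom X (D.T (denTy D Θ A'))} (h : RelT Θ A A' c c')
    {f : D.Hom (denTy D Θ A) (denTy D Θ B)} {f' : D.Hom (denTy D Θ A') (denTy D Θ B')}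
    (hf : ∀ {Y : D.Obj} (v : D.Hom Y (denTy D Θ A)) (v' : D.Hom Y (denTy D Θ A')),
      Rel Θ A A' v v' → Rel Θ B B' (v ;; f) (v' ;; f')) :
    RelT Θ B B' (c ;; D.Tmap f) (c' ;; D.Tmap f') := by
  obtain ⟨Z, u, v, v', hv, rfl, rfl⟩ := h
  exact ⟨Z, u, v ;; f, v' ;; f', hf v v' hv, by rw [Tmap_comp', comp_assoc'],
    by rw [Tmap_comp', comp_assoc']⟩

/-- Sequencing: computations obtained from a common computation by related continuations. -/
theorem RelT.bind {A A' : Ty} {X Z : D.Obj} (c₀ : D.Hom X (D.T Z))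
    {k : D.Hom Z (D.T (denTy D Θ A))} {k' : D.Hom Z (D.T (denTy D Θ A'))}
    (h : RelT Θ A A' k k') : RelT Θ A A' (c₀ ;; D.klift k) (c₀ ;; D.klift k') := by
  obtain ⟨W, u, v, v', hv, rfl, rfl⟩ := h
  exact ⟨W, c₀ ;; D.klift u, v, v', hv, by rw [← klift_Tmap, comp_assoc'],
    by rw [← klift_Tmap, comp_assoc']⟩

theorem Rel.eta {A A' : Ty} {X : D.Obj} {a : D.Hom X (denTy D Θ A)}
    {a' : D.Hom X (denTy D Θ A')} (h : Rel Θ A A' a a') :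
    RelT Θ A A' (a ;; D.eta _) (a' ;; D.eta _) :=
  ⟨X, D.eta X, a, a', h, (eta_natural' a).symm, (eta_natural' a').symm⟩

theorem core_self (A : Ty) :
    (∀ {X : D.Obj} (a : D.Hom X (denTy D Θ A)), Core Θ A A a a) ∧
    (∀ {X : D.Obj} (a a' : D.Hom X (denTy D Θ A)), (IsBang A → IsCo D X) → Core Θ A A a a' →
      a = a') := by
  have lift {A : Ty} (ih : (∀ {X : D.Obj} (a : D.Hom X (denTy D Θ A)), Core Θ A A a a) ∧
      (∀ {X : D.Obj} (a a' : D.Hom X (denTy D Θ A)), (IsBang A → IsCo D X) → Core Θ A A a a' →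
      a = a')) : Rel Θ A A (D.id _) (D.id _) ∧ ∀ {X : D.Obj} (a a' : D.Hom X (denTy D Θ A)),
        Rel Θ A A a a' → a = a' := by
    constructor
    · refine (ih.1 _).rel fun h => ?_
      cases A with
      | bang A => exact isCo_L _
      | _ => exact (or_self_iff.1 h).elim
    · rintro X a a' ⟨Y, u, v, v', hco, hv, rfl, rfl⟩
      rw [ih.2 v v' (fun h => hco (.inl h)) hv]
  induction A with
  | tconst n => exact ⟨fun a => ⟨rfl, HEq.rfl⟩, fun a a' _ h => eq_of_heq h.2⟩
  | unit => exact ⟨fun a => rfl, fun a a' _ h => h⟩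
  | bang A ih =>
    refine ⟨fun a => core_bang_left.2 (core_bang_right.2 (ih.1 _)), fun a a' hX h => ?_⟩
    exact (hX trivial).ext_L (ih.2 _ _ (fun _ => hX trivial)
      (core_bang_right.1 (core_bang_left.1 h)))
  | tensor B C ihB ihC =>
    refine ⟨fun a => core_tensor.2 ⟨_, _, a, D.id _, D.id _, D.id _, D.id _, (lift ihB).1,
      (lift ihC).1, ?_, ?_⟩, fun a a' _ h => ?_⟩
    · rw [tmap_id']; exact (comp_id' a).symm
    · rw [tmap_id']; exact (comp_id' a).symm
    · obtain ⟨P, Q, u, p, p', q, q', hp, hq, rfl, rfl⟩ := core_tensor.1 h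
      rw [(lift ihB).2 _ _ hp, (lift ihC).2 _ _ hq]
  | arrow B C ihB ihC =>
    refine ⟨fun a => core_arrow.2 fun Y y y' hy => ?_, fun a a' _ h => ?_⟩
    · rw [(lift ihB).2 _ _ hy]
      exact ⟨_, _, D.id _, D.id _, (lift ihC).1, by rw [Tmap_id', comp_id'],
        by rw [Tmap_id', comp_id']⟩
    · obtain ⟨Z, c, v, v', hv, e, e'⟩ := core_arrow.1 h _ _ _ (lift ihB).1
      rw [(lift ihC).2 _ _ hv] at e
      exact Phi_injective ((Phi_eq_appnt a).symm.trans ((e.trans e'.symm).trans (Phi_eq_appnt a')))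

theorem rel_id (A : Ty) : Rel Θ A A (D.id (denTy D Θ A)) (D.id _) := by
  refine ((core_self A).1 _).rel fun h => ?_
  cases A with
  | bang A => exact isCo_L _
  | _ => exact (or_self_iff.1 h).elim

theorem Rel.eq {A : Ty} {X : D.Obj} {a a' : D.Hom X (denTy D Θ A)} (h : Rel Θ A A a a') :
    a = a' := by
  obtain ⟨Y, u, v, v', hco, hv, rfl, rfl⟩ := h
  rw [(core_self A).2 v v' (fun h => hco (.inl h)) hv]

theorem RelT.eq {A : Ty} {X : D.Obj} {c c' : D.Hom X (D.T (denTy D Θ A))}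
    (h : RelT Θ A A c c') : c = c' := by
  obtain ⟨Z, u, v, v', hv, rfl, rfl⟩ := h
  rw [hv.eq]

theorem rel_refl {A : Ty} {X : D.Obj} (a : D.Hom X (denTy D Θ A)) : Rel Θ A A a a := by
  simpa using (rel_id A).pre a

end LogicalRelation

end QLamSem

namespace QLamSem

section Subtyping

local notation:80 f:81 ";;" g:80 => LCDData.comp _ f g
local notation:90 f:91 "⊠" g:90 => LCDData.tmap _ f g

variable {D : LCDData} (Θ : ℕ → D.Obj)

/-- The canonical morphisms interpreting subtypings, with exponentials introduced one at a time. -/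
inductive IsSub : ∀ A B : Ty, D.Hom (denTy D Θ A) (denTy D Θ B) → Prop
  | tconst (a : ℕ) : IsSub (.tconst a) (.tconst a) (D.id (Θ a))
  | unit : IsSub .unit .unit (D.id D.unit)
  | arrow {A A' B B' : Ty} {f : D.Hom (denTy D Θ A) (denTy D Θ A')}
      {g : D.Hom (denTy D Θ B) (denTy D Θ B')} : IsSub A A' f → IsSub B B' g →
      IsSub (.arrow A' B) (.arrow A B') (D.lolliL f (denTy D Θ B) ;; D.lolliR (denTy D Θ A) g)
  | tensor {A A' B B' : Ty} {f : D.Hom (denTy D Θ A) (denTy D Θ A')}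
      {g : D.Hom (denTy D Θ B) (denTy D Θ B')} : IsSub A A' f → IsSub B B' g →
      IsSub (.tensor A B) (.tensor A' B') (f ⊠ g)
  | der {A B : Ty} {f : D.Hom (denTy D Θ A) (denTy D Θ B)} : IsSub A B f →
      IsSub (.bang A) B (D.eps (denTy D Θ A) ;; f)
  | prom {A B : Ty} {f : D.Hom (denTy D Θ (.bang A)) (denTy D Θ B)} : IsSub (.bang A) B f →
      IsSub (.bang A) (.bang B) (D.delta (denTy D Θ A) ;; D.Lmap f)

variable {Θ}

theorem IsSub.isBang {A B : Ty} {f : D.Hom (denTy D Θ A) (denTy D Θ B)} (h : IsSub Θ A B f) :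
    IsBang B → IsBang A := by
  cases h with
  | der | prom => exact fun _ => trivial
  | _ => exact id

theorem eqHom_self {A : D.Obj} (h : A = A) : eqHom D h = D.id A := rfl

variable [LC D]

theorem lolli_appnt {X Y A A' B B' : D.Obj} (a : D.Hom X (D.lolli A' B)) (y : D.Hom Y A)
    (f : D.Hom A A') (g : D.Hom B B') :
    ((a ;; D.lolliL f B ;; D.lolliR A g) ⊠ y) ;; D.appnt A B' =
      ((a ⊠ (y ;; f)) ;; D.appnt A' B) ;; D.Tmap g := by
  rw [tmap_appnt, ← comp_assoc', LC.laws.Phi_natural_right, LC.laws.Phi_natural_arg, tmap_appnt]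
  simp only [comp_assoc', tmap_comp_tmap_assoc, id_comp']

theorem delta_Lmap_eps {A B : D.Obj} (f : D.Hom (D.L A) B) :
    (D.delta A ;; D.Lmap f) ;; D.eps B = f := by
  rw [comp_assoc', Lmap_eps_comm, comp_eq_assoc (delta_eps A), id_comp']

theorem IsSub.core_right {A B : Ty} {f : D.Hom (denTy D Θ A) (denTy D Θ B)}
    (base : ∀ {A' B' : Ty} {f' : D.Hom (denTy D Θ A') (denTy D Θ B')}, IsSub Θ A' B' f' →
      ¬ IsBang A' → ∀ {X : D.Obj} (a : D.Hom X (denTy D Θ A)) (a' : D.Hom X (denTy D Θ A')),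
      Core Θ A A' a a' → Core Θ B B' (a ;; f) (a' ;; f'))
    {A' B' : Ty} {f' : D.Hom (denTy D Θ A') (denTy D Θ B')} (h' : IsSub Θ A' B' f') {X : D.Obj}
    (a : D.Hom X (denTy D Θ A)) (a' : D.Hom X (denTy D Θ A')) (h : Core Θ A A' a a') :
    Core Θ B B' (a ;; f) (a' ;; f') := by
  induction h' with
  | @der A' B' f' h' ih =>
    have := ih _ (core_bang_right.1 h)
    exact (congrArg (Core Θ B B' (a ;; f)) (comp_assoc' a' (D.eps (denTy D Θ A')) f')).mp this
  | @prom A' B' f' h' ih =>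
    have e : (a' ;; D.delta (denTy D Θ A') ;; D.Lmap f') ;; D.eps (denTy D Θ B') = a' ;; f' :=
      (comp_assoc' ..).trans (congrArg (a' ;; ·) (delta_Lmap_eps f'))
    exact core_bang_right.2 ((congrArg (Core Θ B B' (a ;; f)) e).mpr (ih _ h))
  | tconst a => exact base (.tconst a) id _ _ h
  | unit => exact base .unit id _ _ h
  | arrow h₁ h₂ => exact base (.arrow h₁ h₂) id _ _ h
  | tensor h₁ h₂ => exact base (.tensor h₁ h₂) id _ _ h

theorem IsSub.core {A B : Ty} {f : D.Hom (denTy D Θ A) (denTy D Θ B)} (h : IsSub Θ A B f)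
    {A' B' : Ty} {f' : D.Hom (denTy D Θ A') (denTy D Θ B')} (h' : IsSub Θ A' B' f') {X : D.Obj}
    (a : D.Hom X (denTy D Θ A)) (a' : D.Hom X (denTy D Θ A')) (hc : Core Θ A A' a a') :
    Core Θ B B' (a ;; f) (a' ;; f') := by
  induction h generalizing A' B' X with
  | @der A B f h ih =>
    have := ih h' _ _ (core_bang_left.1 hc)
    exact (congrArg (fun b => Core Θ B B' b (a' ;; f'))
      (comp_assoc' a (D.eps (denTy D Θ A)) f)).mp this
  | @prom A B f h ih =>
    have e : (a ;; D.delta (denTy D Θ A) ;; D.Lmap f) ;; D.eps (denTy D Θ B) = a ;; f :=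
      (comp_assoc' ..).trans (congrArg (a ;; ·) (delta_Lmap_eps f))
    exact core_bang_left.2 ((congrArg (fun b => Core Θ B B' b (a' ;; f')) e).mpr (ih h' _ _ hc))
  | tconst n =>
    refine IsSub.core_right (fun h' hb X a a' hc => ?_) h' a a' hc
    cases h' with
    | tconst m =>
      obtain ⟨rfl, hc⟩ := hc
      obtain rfl := eq_of_heq hc
      exact ⟨rfl, HEq.rfl⟩
    | der | prom => exact (hb trivial).elim
    | _ => exact hc.elim
  | unit =>
    refine IsSub.core_right (fun h' hb X a a' hc => ?_) h' a a' hc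
    cases h' with
    | unit => exact congrArg (· ;; D.id D.unit) (core_unit.1 hc)
    | der | prom => exact (hb trivial).elim
    | _ => exact hc.elim
  | @tensor A₁ B₁ A₂ B₂ f₁ f₂ h₁ h₂ ih₁ ih₂ =>
    refine IsSub.core_right (fun h' hb X a a' hc => ?_) h' a a' hc
    cases h' with
    | tensor h₁' h₂' =>
      obtain ⟨P, Q, u, p, p', q, q', hp, hq, rfl, rfl⟩ := core_tensor.1 hc
      exact core_tensor.2 ⟨P, Q, u, _, _, _, _,
        hp.map (Or.imp h₁.isBang h₁'.isBang) fun v v' hv => ih₁ h₁' v v' hv,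
        hq.map (Or.imp h₂.isBang h₂'.isBang) fun v v' hv => ih₂ h₂' v v' hv,
        (comp_assoc' ..).trans (congrArg (u ;; ·) (tmap_comp_tmap ..)),
        (comp_assoc' ..).trans (congrArg (u ;; ·) (tmap_comp_tmap ..))⟩
    | der | prom => exact (hb trivial).elim
    | _ => exact hc.elim
  | @arrow A₁ B₁ A₂ B₂ f₁ f₂ h₁ h₂ ih₁ ih₂ =>
    refine IsSub.core_right (fun h' hb X a a' hc => ?_) h' a a' hc
    cases h' with
    | arrow h₁' h₂' =>
      refine core_arrow.2 fun Y y y' hy => ?_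
      have := (core_arrow.1 hc Y _ _ (hy.map (Or.imp h₁.isBang h₁'.isBang) fun v v' hv =>
        ih₁ h₁' v v' hv)).map fun v v' hv => hv.map (Or.imp h₂.isBang h₂'.isBang) fun v v' hv =>
        ih₂ h₂' v v' hv
      exact (congrArg₂ (RelT Θ _ _) (lolli_appnt a y _ _) (lolli_appnt a' y' _ _)).mpr this
    | der | prom => exact (hb trivial).elim
    | _ => exact hc.elim

theorem IsSub.rel {A B A' B' : Ty} {f : D.Hom (denTy D Θ A) (denTy D Θ B)} (h : IsSub Θ A B f)
    {f' : D.Hom (denTy D Θ A') (denTy D Θ B')} (h' : IsSub Θ A' B' f') {X : D.Obj}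
    {a : D.Hom X (denTy D Θ A)} {a' : D.Hom X (denTy D Θ A')} (hr : Rel Θ A A' a a') :
    Rel Θ B B' (a ;; f) (a' ;; f') :=
  hr.map (Or.imp h.isBang h'.isBang) fun v v' hv => h.core h' v v' hv

/-! Iterated exponentials. -/

theorem castHom_eq {A A' B B' : D.Obj} (h₁ : A = A') (h₂ : B = B') (f : D.Hom A B) :
    D.castHom h₁ h₂ f = eqHom D h₁.symm ;; f ;; eqHom D h₂ := by
  subst h₁ h₂
  simp [LCDData.castHom, eqHom_self]

theorem Lmap_eqHom {A B : D.Obj} (h : A = B) :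
    D.Lmap (eqHom D h) = eqHom D (congrArg D.L h) := by
  subst h
  exact Lmap_id' A

theorem eqHom_comp {A B C : D.Obj} (h : A = B) (h' : B = C) :
    eqHom D h ;; eqHom D h' = eqHom D (h.trans h') := by
  subst h h'
  exact id_comp' _

/-- The iterated counit `⟦!ⁿA⟧ → ⟦A⟧`. -/
def col : ∀ (n : ℕ) (A : Ty), D.Hom (denTy D Θ (bangN n A)) (denTy D Θ A)
  | 0, A => D.id (denTy D Θ A)
  | n + 1, A => D.eps (denTy D Θ (bangN n A)) ;; col n A

theorem col_eq (n : ℕ) (A : Ty) :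
    (col n A : D.Hom (denTy D Θ _) _) =
      eqHom D (denTy_bangN D Θ n A) ;; collapseL D n (denTy D Θ A) := by
  induction n with
  | zero => exact (id_comp' _).symm
  | succ n ih =>
    have e := Lmap_eps_comm (eqHom D (denTy_bangN D Θ n A))
    rw [Lmap_eqHom] at e
    exact (congrArg (_ ;; ·) ih).trans (comp_congr_assoc e _).symm

theorem core_bangN_left {n : ℕ} {A A' : Ty} {X : D.Obj} {a : D.Hom X (denTy D Θ (bangN n A))}
    {a' : D.Hom X (denTy D Θ A')} :
    Core Θ (bangN n A) A' a a' ↔ Core Θ A A' (a ;; col n A) a' := by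
  induction n with
  | zero => exact iff_of_eq (congrArg (fun b => Core Θ A A' b a') (comp_id' a).symm)
  | succ n ih =>
    exact ih.trans (iff_of_eq (congrArg (fun b => Core Θ A A' b a')
      (comp_assoc' a (D.eps (denTy D Θ (bangN n A))) (col n A))))

theorem core_bangN_right {n : ℕ} {A A' : Ty} {X : D.Obj} {a : D.Hom X (denTy D Θ A)}
    {a' : D.Hom X (denTy D Θ (bangN n A'))} :
    Core Θ A (bangN n A') a a' ↔ Core Θ A A' a (a' ;; col n A') := by
  induction n with
  | zero => exact iff_of_eq (congrArg (Core Θ A A' a) (comp_id' a').symm)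
  | succ n ih =>
    exact core_bang_right.trans (ih.trans (iff_of_eq (congrArg (Core Θ A A' a)
      (comp_assoc' a' (D.eps (denTy D Θ (bangN n A'))) (col n A')))))

theorem core_bangN {n m : ℕ} {A A' : Ty} {X : D.Obj} {a : D.Hom X (denTy D Θ (bangN n A))}
    {a' : D.Hom X (denTy D Θ (bangN m A'))} :
    Core Θ (bangN n A) (bangN m A') a a' ↔ Core Θ A A' (a ;; col n A) (a' ;; col m A') :=
  core_bangN_left.trans core_bangN_right

theorem padL_eps (m : ℕ) (X : D.Obj) :
    padL D (m + 1) X ;; D.eps (Ln D (m + 1) X) = padL D m X :=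
  (comp_assoc' ..).trans ((congrArg (padL D m X ;; ·) (delta_eps (Ln D m X))).trans (comp_id' _))

theorem padL_collapseL (m : ℕ) (X : D.Obj) :
    padL D m X ;; collapseL D (m + 1) X = D.eps X := by
  induction m with
  | zero => exact (id_comp' _).trans (comp_id' _)
  | succ m ih => exact (comp_eq_assoc (padL_eps m X) _).trans ih

theorem padL_col (n : ℕ) (A : Ty) :
    D.castHom rfl (denTy_bangN D Θ (n + 1) A).symm (padL D n (denTy D Θ A)) ;; col (n + 1) A =
      D.eps (denTy D Θ A) := by
  rw [castHom_eq, col_eq, eqHom_self, id_comp', comp_assoc', ← comp_assoc' (eqHom D _), eqHom_comp,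
    eqHom_self, id_comp', padL_collapseL]

theorem starMap_col (n : ℕ) : starMap D Θ n ;; col n .unit = D.id D.unit := by
  cases n with
  | zero => exact id_comp' _
  | succ n => exact (comp_assoc' ..).trans ((congrArg (D.m0 ;; ·) (padL_col n .unit)).trans m0_eps)

/-- The morphism `⟦!ⁿA⟧ → ⟦!ᵐB⟧` determined by `f : ⟦A⟧ → ⟦B⟧`. -/
def bangSub (n m : ℕ) (h : m = 0 ∨ 1 ≤ n) {A B : Ty} (f : D.Hom (denTy D Θ A) (denTy D Θ B)) :
    D.Hom (denTy D Θ (bangN n A)) (denTy D Θ (bangN m B)) :=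
  D.castHom (denTy_bangN D Θ n A).symm (denTy_bangN D Θ m B).symm
    (bangAdj D n m (denTy D Θ A) h ;; LnMap D m f)

theorem collapseL_natural (n : ℕ) {X Y : D.Obj} (f : D.Hom X Y) :
    LnMap D n f ;; collapseL D n Y = collapseL D n X ;; f := by
  induction n with
  | zero => exact (comp_id' _).trans (id_comp' _).symm
  | succ n ih =>
    exact (comp_congr_assoc (Lmap_eps_comm (LnMap D n f)) _).trans
      ((congrArg (_ ;; ·) ih).trans (comp_assoc' ..).symm)

theorem bangAdj_collapseL (n m : ℕ) (X : D.Obj) (h : m = 0 ∨ 1 ≤ n) :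
    bangAdj D n m X h ;; collapseL D m X = collapseL D n X := by
  match n, m, h with
  | 0, 0, _ => exact comp_id' _
  | n + 1, 0, _ => exact comp_id' _
  | n + 1, m + 1, _ =>
    exact (comp_assoc' ..).trans ((congrArg (_ ;; ·) (padL_collapseL m X)).trans
      (Lmap_eps_comm (collapseL D n X)))

theorem bangSub_col (n m : ℕ) (h : m = 0 ∨ 1 ≤ n) {A B : Ty}
    (f : D.Hom (denTy D Θ A) (denTy D Θ B)) :
    bangSub n m h f ;; col m B = col n A ;; f := by
  rw [bangSub, castHom_eq, col_eq, col_eq]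
  simp only [comp_assoc']
  rw [← comp_assoc' (eqHom D _) (eqHom D _), eqHom_comp, eqHom_self, id_comp', collapseL_natural,
    ← comp_assoc' (bangAdj D n m _ h), bangAdj_collapseL]

theorem isCo_bangN {n : ℕ} (hn : 1 ≤ n) (A : Ty) : IsCo D (denTy D Θ (bangN n A)) := by
  obtain ⟨n, rfl⟩ : ∃ k, n = k + 1 := ⟨n - 1, by omega⟩
  exact isCo_L _

theorem col_ext {X : D.Obj} (hX : IsCo D X) {n : ℕ} {A : Ty}
    {a b : D.Hom X (denTy D Θ (bangN n A))} (h : a ;; col n A = b ;; col n A) : a = b := by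
  induction n with
  | zero => exact (comp_id' a).symm.trans (h.trans (comp_id' b))
  | succ n ih =>
    exact hX.ext_L (ih ((comp_assoc' ..).trans (h.trans (comp_assoc' ..).symm)))

theorem isSub_bangSub (n m : ℕ) (h : m = 0 ∨ 1 ≤ n) {A B : Ty}
    {f : D.Hom (denTy D Θ A) (denTy D Θ B)} (hf : IsSub Θ A B f) :
    IsSub Θ (bangN n A) (bangN m B) (bangSub n m h f) := by
  induction m with
  | zero =>
    have e (n : ℕ) : IsSub Θ (bangN n A) B (col n A ;; f) := by
      induction n with
      | zero => exact (congrArg (IsSub Θ A B) (id_comp' f)).mpr hf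
      | succ n ih =>
        exact (congrArg (IsSub Θ (bangN (n + 1) A) B) (comp_assoc' ..)).mpr (.der ih)
    have e' : bangSub n 0 h f = col n A ;; f := (comp_id' _).symm.trans (bangSub_col n 0 h f)
    exact (congrArg (IsSub Θ (bangN n A) B) e').mpr (e n)
  | succ m ih =>
    obtain ⟨n, rfl⟩ : ∃ k, n = k + 1 := ⟨n - 1, by omega⟩
    have hn : m = 0 ∨ 1 ≤ n + 1 := .inr (by omega)
    have e : bangSub (n + 1) (m + 1) h f =
        D.delta (denTy D Θ (bangN n A)) ;; D.Lmap (bangSub (n + 1) m hn f) := by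
      refine col_ext (n := m + 1) (isCo_bangN (n := n + 1) (by omega) A)
        ((bangSub_col _ _ h f).trans ?_)
      refine ((comp_eq_assoc (delta_Lmap_eps _) _).trans ?_).symm
      exact bangSub_col _ _ hn f
    exact (congrArg (IsSub Θ (bangN (n + 1) A) (bangN (m + 1) B)) e).mpr (.prom (ih hn))

theorem LnMap_id (m : ℕ) (X : D.Obj) : LnMap D m (D.id X) = D.id (Ln D m X) := by
  induction m with
  | zero => rfl
  | succ m ih => exact (congrArg _ ih).trans (Lmap_id' _)

theorem bangSub_id (n m : ℕ) (h : m = 0 ∨ 1 ≤ n) (A : Ty) :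
    bangSub n m h (D.id (denTy D Θ A)) = D.castHom (denTy_bangN D Θ n A).symm
      (denTy_bangN D Θ m A).symm (bangAdj D n m (denTy D Θ A) h) := by
  rw [bangSub, LnMap_id, comp_id']

theorem isSub_Isub {A B : Ty} (s : SubD A B) : IsSub Θ A B (Isub D Θ s) := by
  induction s with
  | tconst n m a h =>
    exact (congrArg (IsSub Θ _ _) (bangSub_id n m h (.tconst a))).mp
      (isSub_bangSub n m h (IsSub.tconst (Θ := Θ) a))
  | unit n m h =>
    exact (congrArg (IsSub Θ _ _) (bangSub_id n m h .unit)).mp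
      (isSub_bangSub n m h (IsSub.unit (Θ := Θ)))
  | arrow n m A A' B B' h sA sB ihA ihB => exact isSub_bangSub n m h (.arrow ihA ihB)
  | tensor n m A A' B B' h sA sB ihA ihB => exact isSub_bangSub n m h (.tensor ihA ihB)

end Subtyping

end QLamSem

namespace QLamSem

section Splitting

local notation:80 f:81 ";;" g:80 => LCDData.comp _ f g
local notation:90 f:91 "⊠" g:90 => LCDData.tmap _ f g

variable {D : LCDData}

/-- Splits both components of a tensor product and regroups the results. -/
def cons4 {P P₁ P₂ G G₁ G₂ C₁ C₂ : D.Obj} (k : D.Hom P (D.tens P₁ P₂)) (f : D.Hom G (D.tens G₁ G₂))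
    (h₁ : D.Hom (D.tens P₁ G₁) C₁) (h₂ : D.Hom (D.tens P₂ G₂) C₂) :
    D.Hom (D.tens P G) (D.tens C₁ C₂) :=
  (k ⊠ f) ;; mid4 D P₁ P₂ G₁ G₂ ;; (h₁ ⊠ h₂)

section Cons4

variable [LC D] {P P₁ P₂ G G₁ G₂ C₁ C₂ : D.Obj}

theorem cons4_pre {P' G' : D.Obj} (u : D.Hom P' P) (v : D.Hom G' G) (k : D.Hom P (D.tens P₁ P₂))
    (f : D.Hom G (D.tens G₁ G₂)) (h₁ : D.Hom (D.tens P₁ G₁) C₁) (h₂ : D.Hom (D.tens P₂ G₂) C₂) :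
    (u ⊠ v) ;; cons4 k f h₁ h₂ = cons4 (u ;; k) (v ;; f) h₁ h₂ := by
  rw [cons4, tmap_comp_tmap_assoc, cons4]

theorem cons4_post {E₁ E₂ : D.Obj} (k : D.Hom P (D.tens P₁ P₂))
    (f : D.Hom G (D.tens G₁ G₂)) (h₁ : D.Hom (D.tens P₁ G₁) C₁) (h₂ : D.Hom (D.tens P₂ G₂) C₂)
    (s : D.Hom C₁ E₁) (t : D.Hom C₂ E₂) :
    cons4 k f h₁ h₂ ;; (s ⊠ t) = cons4 k f (h₁ ;; s) (h₂ ;; t) := by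
  simp only [cons4, comp_assoc', tmap_comp_tmap]

theorem cons4_mid {P₁' P₂' G₁' G₂' : D.Obj} (k : D.Hom P (D.tens P₁ P₂))
    (f : D.Hom G (D.tens G₁ G₂)) (u : D.Hom P₁ P₁') (v : D.Hom P₂ P₂') (s : D.Hom G₁ G₁')
    (t : D.Hom G₂ G₂') (h₁ : D.Hom (D.tens P₁' G₁') C₁) (h₂ : D.Hom (D.tens P₂' G₂') C₂) :
    cons4 (k ;; (u ⊠ v)) (f ;; (s ⊠ t)) h₁ h₂ = cons4 k f ((u ⊠ s) ;; h₁) ((v ⊠ t) ;; h₂) := by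
  simp only [cons4]
  rw [← tmap_comp_tmap, comp_assoc', comp_congr_assoc (mid4_natural u v s t), tmap_comp_tmap]

theorem cons4_mid_right {G₁' G₂' : D.Obj} (k : D.Hom P (D.tens P₁ P₂))
    (f : D.Hom G (D.tens G₁ G₂)) (s : D.Hom G₁ G₁') (t : D.Hom G₂ G₂')
    (h₁ : D.Hom (D.tens P₁ G₁') C₁) (h₂ : D.Hom (D.tens P₂ G₂') C₂) :
    cons4 k (f ;; (s ⊠ t)) h₁ h₂ =
      cons4 k f ((D.id P₁ ⊠ s) ;; h₁) ((D.id P₂ ⊠ t) ;; h₂) := by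
  rw [← cons4_mid, tmap_id', comp_id']

theorem cons4_swp {Q Q₁ Q₂ : D.Obj} (k : D.Hom P (D.tens P₁ P₂)) (l : D.Hom Q (D.tens Q₁ Q₂))
    (f : D.Hom G (D.tens G₁ G₂)) (h₁ : D.Hom (D.tens P₁ (D.tens Q₁ G₁)) C₁)
    (h₂ : D.Hom (D.tens P₂ (D.tens Q₂ G₂)) C₂) :
    swp D Q P G ;; cons4 k (cons4 l f (D.id _) (D.id _)) h₁ h₂ =
      cons4 l (cons4 k f (D.id _) (D.id _)) (swp D _ _ _ ;; h₁) (swp D _ _ _ ;; h₂) := by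
  simp only [cons4, tmap_id', comp_id']
  rw [← tmap_comp_tmap (swp D Q₁ P₁ G₁) h₁ (swp D Q₂ P₂ G₂) h₂]
  have e {A A' B B' E : D.Obj} (a : D.Hom A A') (b : D.Hom B B') (c : D.Hom B' E) :
      a ⊠ (b ;; c) = (a ⊠ b) ;; (D.id A' ⊠ c) := by rw [tmap_comp_tmap, comp_id']
  rw [e, e, comp_assoc', comp_assoc', ← comp_assoc' (swp D Q P G), ← swp_natural, comp_assoc',
    ← comp_assoc' (D.id _ ⊠ mid4 D Q₁ Q₂ G₁ G₂), ← comp_assoc' (swp D _ _ _), mid4_swp]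
  simp only [comp_assoc']

theorem cons4_lunit (f : D.Hom G (D.tens G₁ G₂)) :
    cons4 (D.lunitInv D.unit) f (D.lunit G₁) (D.lunit G₂) = D.lunit G ;; f := by
  rw [← lunit_natural', ← mid4_lunit, cons4, tmap_comp_tmap_assoc, id_comp', comp_id']

theorem cons4_runitInv (f : D.Hom G (D.tens G₁ G₂)) :
    cons4 (D.runitInv P) f (D.id _) (D.lunit G₂) = (D.id P ⊠ f) ;; D.assocInv P G₁ G₂ := by
  rw [← mid4_runit, cons4, tmap_comp_tmap_assoc, id_comp', comp_id']

theorem cons4_lunitInv :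
    cons4 (D.lunitInv P) (D.lunitInv G) (D.lunit D.unit) (D.id _) = D.lunitInv (D.tens P G) :=
  mid4_lunitInv P G

end Cons4

variable (Θ : ℕ → D.Obj)

/-- The object of an optional type; a missing type is interpreted by the unit. -/
def denOpt : Option Ty → D.Obj
  | none => D.unit
  | some A => denTy D Θ A

/-- Adds an optional variable in front of a context. -/
def ocons (x : ℕ) : Option Ty → CtxL → CtxL
  | none, Γ => Γ
  | some A, Γ => (x, A) :: Γ

/-- The canonical morphism into the interpretation of an optionally extended context. -/
def hmap (x : ℕ) : ∀ (o : Option Ty) (Γ : CtxL),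
    D.Hom (D.tens (denOpt Θ o) (denCtx D Θ Γ)) (denCtx D Θ (ocons x o Γ))
  | none, Γ => D.lunit (denCtx D Θ Γ)
  | some A, Γ => D.id (D.tens (denTy D Θ A) (denCtx D Θ Γ))

/-- Exchange of two adjacent variables. -/
inductive Sw : ∀ Γ Γ' : CtxL, D.Hom (denCtx D Θ Γ) (denCtx D Θ Γ') → Prop
  | head (p q : ℕ × Ty) (Γ : CtxL) : Sw (p :: q :: Γ) (q :: p :: Γ)
      (swp D (denTy D Θ p.2) (denTy D Θ q.2) (denCtx D Θ Γ))
  | tail (p : ℕ × Ty) {Γ Γ' : CtxL} {f : D.Hom (denCtx D Θ Γ) (denCtx D Θ Γ')} : Sw Γ Γ' f →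
      Sw (p :: Γ) (p :: Γ') (D.id (denTy D Θ p.2) ⊠ f)

/-- Permutations of contexts. -/
inductive Perm : ∀ Γ Γ' : CtxL, D.Hom (denCtx D Θ Γ) (denCtx D Θ Γ') → Prop
  | refl (Γ : CtxL) : Perm Γ Γ (D.id _)
  | step {Γ Γ' Γ'' : CtxL} {f : D.Hom (denCtx D Θ Γ) (denCtx D Θ Γ')}
      {g : D.Hom (denCtx D Θ Γ') (denCtx D Θ Γ'')} : Sw Θ Γ Γ' f → Perm Γ' Γ'' g →
      Perm Γ Γ'' (f ;; g)

/-- The ways in which a variable is distributed over the two parts of a context, where `Na` and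
`Nb` are the names occurring in the two parts. -/
inductive Route (Na Nb : List ℕ) (x : ℕ) : ∀ (A : Ty) (oa ob : Option Ty),
    D.Hom (denTy D Θ A) (D.tens (denOpt Θ oa) (denOpt Θ ob)) → Prop
  | both (A : Ty) : Route Na Nb x (.bang A) (some (.bang A)) (some (.bang A)) (D.dup (denTy D Θ A))
  | left (A : Ty) : x ∉ Nb → Route Na Nb x A (some A) none (D.runitInv (denTy D Θ A))
  | right (A : Ty) : x ∉ Na → Route Na Nb x A none (some A) (D.lunitInv (denTy D Θ A))

/-- The ways in which an optional variable is distributed over the two parts of a context. -/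
inductive ORoute (Na Nb : List ℕ) (x : ℕ) : ∀ (o oa ob : Option Ty),
    D.Hom (denOpt Θ o) (D.tens (denOpt Θ oa) (denOpt Θ ob)) → Prop
  | none : ORoute Na Nb x none none none (D.lunitInv D.unit)
  | some {A : Ty} {oa ob : Option Ty}
      {k : D.Hom (denTy D Θ A) (D.tens (denOpt Θ oa) (denOpt Θ ob))} : Route Θ Na Nb x A oa ob k →
      ORoute Na Nb x (some A) oa ob k

/-- Splittings of a context into two parts, with duplication of variables of type `!A`. -/
inductive Spl (Na Nb : List ℕ) : ∀ Γ Γa Γb : CtxL,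
    D.Hom (denCtx D Θ Γ) (D.tens (denCtx D Θ Γa) (denCtx D Θ Γb)) → Prop
  | nil : Spl Na Nb [] [] [] (D.lunitInv D.unit)
  | cons {x : ℕ} {A : Ty} {oa ob : Option Ty}
      {k : D.Hom (denTy D Θ A) (D.tens (denOpt Θ oa) (denOpt Θ ob))} {Γ Γa Γb : CtxL}
      {f : D.Hom (denCtx D Θ Γ) (D.tens (denCtx D Θ Γa) (denCtx D Θ Γb))} :
      Route Θ Na Nb x A oa ob k → Spl Na Nb Γ Γa Γb f →
      Spl Na Nb ((x, A) :: Γ) (ocons x oa Γa) (ocons x ob Γb)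
        (cons4 k f (hmap Θ x oa Γa) (hmap Θ x ob Γb))

variable {Θ}

section Perm

theorem Perm.mem_iff {Γ Γ' : CtxL} {f : D.Hom (denCtx D Θ Γ) (denCtx D Θ Γ')}
    (h : Perm Θ Γ Γ' f) {p : ℕ × Ty} : p ∈ Γ ↔ p ∈ Γ' := by
  have hs {Γ Γ' : CtxL} {f : D.Hom (denCtx D Θ Γ) (denCtx D Θ Γ')} (h : Sw Θ Γ Γ' f) :
      p ∈ Γ ↔ p ∈ Γ' := by
    induction h with
    | head => simp only [List.mem_cons]; tauto
    | tail _ _ ih => simp only [List.mem_cons, ih]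
  induction h with
  | refl => rfl
  | step h _ ih => exact (hs h).trans ih

variable [LC D]

theorem Perm.of_sw {Γ Γ' : CtxL} {f : D.Hom (denCtx D Θ Γ) (denCtx D Θ Γ')} (h : Sw Θ Γ Γ' f) :
    Perm Θ Γ Γ' f := by
  have := Perm.step h (.refl Γ')
  rwa [comp_id'] at this

theorem Perm.trans {Γ Γ' Γ'' : CtxL} {f : D.Hom (denCtx D Θ Γ) (denCtx D Θ Γ')}
    {g : D.Hom (denCtx D Θ Γ') (denCtx D Θ Γ'')} (h : Perm Θ Γ Γ' f) (h' : Perm Θ Γ' Γ'' g) :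
    Perm Θ Γ Γ'' (f ;; g) := by
  induction h with
  | refl => rwa [id_comp']
  | step hs _ ih =>
    rw [comp_assoc']
    exact .step hs (ih h')

theorem Perm.tail (p : ℕ × Ty) {Γ Γ' : CtxL} {f : D.Hom (denCtx D Θ Γ) (denCtx D Θ Γ')}
    (h : Perm Θ Γ Γ' f) : Perm Θ (p :: Γ) (p :: Γ') (D.id (denTy D Θ p.2) ⊠ f) := by
  induction h with
  | refl Γ => exact (congrArg (Perm Θ (p :: Γ) (p :: Γ)) (tmap_id' _ _)).mpr (.refl _)
  | @step Γ Γ' Γ'' f g hs _ ih =>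
    refine (congrArg (Perm Θ (p :: Γ) (p :: Γ'')) ?_).mp (.step (.tail p hs) ih)
    exact (tmap_comp_tmap ..).trans (congrArg (· ⊠ (f ;; g)) (id_comp' _))

theorem Perm.ocons (x : ℕ) (o : Option Ty) {Γ Γ' : CtxL}
    {f : D.Hom (denCtx D Θ Γ) (denCtx D Θ Γ')} (h : Perm Θ Γ Γ' f) :
    ∃ g, Perm Θ (ocons x o Γ) (ocons x o Γ') g ∧
      (D.id _ ⊠ f) ;; hmap Θ x o Γ' = hmap Θ x o Γ ;; g := by
  cases o with
  | none => exact ⟨f, h, lunit_natural' f⟩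
  | some A => exact ⟨_, h.tail (x, A), (comp_id' _).trans (id_comp' _).symm⟩

theorem hmap_swp (x y : ℕ) (o o' : Option Ty) (Γ : CtxL) :
    ∃ g, Perm Θ (QLamSem.ocons x o (QLamSem.ocons y o' Γ))
        (QLamSem.ocons y o' (QLamSem.ocons x o Γ)) g ∧
      swp D _ _ _ ;; (D.id _ ⊠ hmap Θ x o Γ) ;; hmap Θ y o' (QLamSem.ocons x o Γ) =
        ((D.id _ ⊠ hmap Θ y o' Γ) ;; hmap Θ x o (QLamSem.ocons y o' Γ)) ;; g := by
  have id₂ (P Q R : D.Obj) : (D.id P ⊠ D.id (D.tens Q R)) = D.id _ := tmap_id' _ _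
  cases o with
  | none =>
    refine ⟨_, .refl _, ?_⟩
    cases o' with
    | none =>
      refine .trans ?_ (comp_id' _).symm
      exact (comp_eq_assoc (swp_unit D.unit (denCtx D Θ Γ)) _).trans (lunit_natural' _).symm
    | some B =>
      refine .trans ?_ (comp_id' _).symm
      refine ((congrArg (_ ;; ·) (comp_id' _)).trans (swp_unit (denTy D Θ B) (denCtx D Θ Γ))).trans
        ((congrArg (· ;; _) (id₂ D.unit (denTy D Θ B) (denCtx D Θ Γ))).trans (id_comp' _)).symm
  | some A =>
    cases o' with
    | none =>
      refine ⟨_, .refl _, .trans ?_ (comp_id' _).symm⟩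
      refine ((congrArg (_ ;; ·) ((congrArg (· ;; _)
        (id₂ D.unit (denTy D Θ A) (denCtx D Θ Γ))).trans (id_comp' _))).trans
        (swp_lunit (denTy D Θ A) (denCtx D Θ Γ))).trans (comp_id' _).symm
    | some B =>
      refine ⟨_, .of_sw (.head (x, A) (y, B) Γ), ?_⟩
      refine ((congrArg (swp D _ _ _ ;; ·) ((comp_id' _).trans
        (id₂ (denTy D Θ B) (denTy D Θ A) (denCtx D Θ Γ)))).trans (comp_id' _)).trans ?_
      exact ((congrArg (· ;; swp D _ _ _) ((comp_id' _).trans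
        (id₂ (denTy D Θ A) (denTy D Θ B) (denCtx D Θ Γ)))).trans (id_comp' _)).symm

/-- Permutations commute with splittings. -/
theorem Spl.perm {Na Nb : List ℕ} {Γ₀ Γ Γa Γb : CtxL}
    {p : D.Hom (denCtx D Θ Γ₀) (denCtx D Θ Γ)} (hp : Perm Θ Γ₀ Γ p)
    {f : D.Hom (denCtx D Θ Γ) (D.tens (denCtx D Θ Γa) (denCtx D Θ Γb))}
    (hf : Spl Θ Na Nb Γ Γa Γb f) :
    ∃ (Γa₀ Γb₀ : CtxL) (f₀ : D.Hom (denCtx D Θ Γ₀) (D.tens (denCtx D Θ Γa₀) (denCtx D Θ Γb₀)))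
      (pa : D.Hom (denCtx D Θ Γa₀) (denCtx D Θ Γa)) (pb : D.Hom (denCtx D Θ Γb₀) (denCtx D Θ Γb)),
      Spl Θ Na Nb Γ₀ Γa₀ Γb₀ f₀ ∧ Perm Θ Γa₀ Γa pa ∧ Perm Θ Γb₀ Γb pb ∧
      p ;; f = f₀ ;; (pa ⊠ pb) := by
  have sw {Γ₀ Γ Γa Γb : CtxL} {p : D.Hom (denCtx D Θ Γ₀) (denCtx D Θ Γ)} (hp : Sw Θ Γ₀ Γ p)
      {f : D.Hom (denCtx D Θ Γ) (D.tens (denCtx D Θ Γa) (denCtx D Θ Γb))}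
      (hf : Spl Θ Na Nb Γ Γa Γb f) :
      ∃ (Γa₀ Γb₀ : CtxL) (f₀ : D.Hom (denCtx D Θ Γ₀) (D.tens (denCtx D Θ Γa₀) (denCtx D Θ Γb₀)))
        (pa : D.Hom (denCtx D Θ Γa₀) (denCtx D Θ Γa))
        (pb : D.Hom (denCtx D Θ Γb₀) (denCtx D Θ Γb)),
        Spl Θ Na Nb Γ₀ Γa₀ Γb₀ f₀ ∧ Perm Θ Γa₀ Γa pa ∧ Perm Θ Γb₀ Γb pb ∧
        p ;; f = f₀ ;; (pa ⊠ pb) := by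
    induction hp generalizing Γa Γb with
    | head p q Γ =>
      cases hf with
      | @cons y B oa ob k _ _ _ _ hk hf =>
        cases hf with
        | @cons x A oa' ob' k' _ Γa Γb f hk' hf =>
          obtain ⟨ga, hga, ea⟩ := hmap_swp (Θ := Θ) x y oa' oa Γa
          obtain ⟨gb, hgb, eb⟩ := hmap_swp (Θ := Θ) x y ob' ob Γb
          refine ⟨_, _, _, ga, gb, .cons hk' (.cons hk hf), hga, hgb, ?_⟩
          have e₁ : cons4 k (cons4 k' f (hmap Θ x oa' Γa) (hmap Θ x ob' Γb))
              (hmap Θ y oa (QLamSem.ocons x oa' Γa)) (hmap Θ y ob (QLamSem.ocons x ob' Γb)) =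
              cons4 k (cons4 k' f (D.id _) (D.id _)) ((D.id _ ⊠ hmap Θ x oa' Γa) ;; hmap Θ y oa _)
                ((D.id _ ⊠ hmap Θ x ob' Γb) ;; hmap Θ y ob _) := by
            rw [← cons4_mid_right, cons4_post, id_comp', id_comp']
          have e₂ : cons4 k' (cons4 k f (hmap Θ y oa Γa) (hmap Θ y ob Γb))
              (hmap Θ x oa' (QLamSem.ocons y oa Γa)) (hmap Θ x ob' (QLamSem.ocons y ob Γb)) =
              cons4 k' (cons4 k f (D.id _) (D.id _)) ((D.id _ ⊠ hmap Θ y oa Γa) ;; hmap Θ x oa' _)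
                ((D.id _ ⊠ hmap Θ y ob Γb) ;; hmap Θ x ob' _) := by
            rw [← cons4_mid_right, cons4_post, id_comp', id_comp']
          refine (congrArg (swp D _ _ _ ;; ·) e₁).trans ((cons4_swp ..).trans ?_)
          refine .trans ?_ ((congrArg (· ;; (ga ⊠ gb)) e₂).trans (cons4_post ..)).symm
          rw [ea, eb]
    | tail p hp ih =>
      cases hf with
      | @cons x A oa ob k _ Γa Γb f hk hf =>
        obtain ⟨Γa₀, Γb₀, f₀, pa, pb, hf₀, ha, hb, e⟩ := ih hf
        obtain ⟨ga, hga, ea⟩ := ha.ocons x oa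
        obtain ⟨gb, hgb, eb⟩ := hb.ocons x ob
        refine ⟨_, _, _, ga, gb, .cons hk hf₀, hga, hgb, ?_⟩
        refine (cons4_pre ..).trans ?_
        rw [id_comp', e, cons4_mid_right, ea, eb]
        exact (cons4_post ..).symm
  induction hp generalizing Γa Γb with
  | refl => exact ⟨_, _, f, _, _, hf, .refl _, .refl _, by rw [tmap_id', comp_id', id_comp']⟩
  | step hs _ ih =>
    obtain ⟨_, _, f₁, pa, pb, hf₁, ha, hb, e⟩ := ih hf
    obtain ⟨_, _, f₀, pa', pb', hf₀, ha', hb', e'⟩ := sw hs hf₁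
    exact ⟨_, _, f₀, _, _, hf₀, ha'.trans ha, hb'.trans hb, by
      rw [comp_assoc', e, ← comp_assoc', e', comp_assoc', tmap_comp_tmap]⟩

end Perm

end Splitting

end QLamSem

namespace QLamSem

section Structural

local notation:80 f:81 ";;" g:80 => LCDData.comp _ f g
local notation:90 f:91 "⊠" g:90 => LCDData.tmap _ f g

variable {D : LCDData} [LC D]

theorem id_tmap_comp (A : D.Obj) {B C E : D.Obj} (f : D.Hom B C) (g : D.Hom C E) :
    D.id A ⊠ (f ;; g) = (D.id A ⊠ f) ;; (D.id A ⊠ g) := by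
  rw [tmap_comp_tmap, id_comp']

theorem tmap_assoc_conj {P A B E F G : D.Obj} (s : D.Hom F (D.tens A B)) (k : D.Hom B E)
    (j : D.Hom (D.tens A E) G) :
    ((D.id P ⊠ s) ;; D.assocInv P A B) ;; (D.id (D.tens P A) ⊠ k) ;; D.assoc P A E ;; (D.id P ⊠ j) =
      D.id P ⊠ (s ;; (D.id A ⊠ k) ;; j) := by
  rw [id_tmap_comp, id_tmap_comp, comp_assoc', ← tmap_id', comp_congr_assoc (assoc_natural' ..),
    comp_eq_assoc (assocInv_assoc ..), id_comp']

theorem cons4_assoc {P P₁ P₂ F A A₁ A₂ B B₁ B₂ C₁ C₂ : D.Obj} (k : D.Hom P (D.tens P₁ P₂))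
    (s : D.Hom F (D.tens A B)) (d : D.Hom A (D.tens A₁ A₂)) (f : D.Hom B (D.tens B₁ B₂))
    (j₁ : D.Hom (D.tens A₁ B₁) C₁) (j₂ : D.Hom (D.tens A₂ B₂) C₂) :
    ((D.id P ⊠ s) ;; D.assocInv P A B) ;; (((k ⊠ d) ;; mid4 D P₁ P₂ A₁ A₂) ⊠ f) ;;
        mid4 D (D.tens P₁ A₁) (D.tens P₂ A₂) B₁ B₂ ;;
        ((D.assoc P₁ A₁ B₁ ;; (D.id P₁ ⊠ j₁)) ⊠ (D.assoc P₂ A₂ B₂ ;; (D.id P₂ ⊠ j₂))) =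
      cons4 k (s ;; (d ⊠ f) ;; mid4 D A₁ A₂ B₁ B₂ ;; (j₁ ⊠ j₂)) (D.id _) (D.id _) := by
  have e₁ : ((k ⊠ d) ;; mid4 D P₁ P₂ A₁ A₂) ⊠ f =
      ((k ⊠ d) ⊠ f) ;; (mid4 D P₁ P₂ A₁ A₂ ⊠ D.id _) := by rw [tmap_comp_tmap, comp_id']
  have e₂ := comp_congr_assoc (mid4_assoc P₁ P₂ A₁ A₂ B₁ B₂) ((D.id P₁ ⊠ j₁) ⊠ (D.id P₂ ⊠ j₂))
  simp only [comp_assoc'] at e₂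
  rw [e₁, ← tmap_comp_tmap (D.assoc P₁ A₁ B₁), comp_assoc', comp_assoc', e₂,
    comp_congr_assoc (assoc_natural' ..), comp_eq_assoc (assocInv_assoc ..), id_comp', cons4,
    tmap_id', comp_id', tmap_comp_tmap_assoc, id_comp', ← mid4_natural, tmap_comp_tmap_assoc,
    tmap_comp_tmap_assoc]
  simp only [comp_assoc', tmap_id', comp_id']

variable {Θ : ℕ → D.Obj}

theorem perm_swapMor (Γ₁ : CtxL) (p q : ℕ × Ty) (Γ₂ : CtxL) :
    Perm Θ (Γ₁ ++ q :: p :: Γ₂) (Γ₁ ++ p :: q :: Γ₂) (swapMor D Θ Γ₁ p q Γ₂) := by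
  induction Γ₁ with
  | nil =>
    refine (congrArg (Perm Θ (q :: p :: Γ₂) (p :: q :: Γ₂)) ?_).mp (.of_sw (.head q p Γ₂))
    exact ((congrArg (_ ;; ·) (lunit_natural' _)).trans
      ((comp_eq_assoc (lunitInv_lunit _) _).trans (id_comp' _))).symm
  | cons r Γ₁ ih =>
    exact (congrArg (Perm Θ _ _) (tmap_assoc_conj ..)).mpr (ih.tail r)

theorem spl_right (Na Nb : List ℕ) (Γ : CtxL) (h : ∀ x ∈ names Γ, x ∉ Na) :
    Spl Θ Na Nb Γ [] Γ (D.lunitInv (denCtx D Θ Γ)) := by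
  induction Γ with
  | nil => exact .nil
  | cons p Γ ih =>
    have := Spl.cons (.right p.2 (h p.1 (by simp [names])))
      (ih fun x hx => h x (by simp only [names, List.map_cons, List.mem_cons] at hx ⊢; exact .inr hx))
    exact (congrArg (Spl Θ Na Nb (p :: Γ) [] (p :: Γ)) cons4_lunitInv).mp this

theorem spl_splitCtx {Na Nb : List ℕ} {Γ₁ Γ₂ : CtxL} (h₁ : ∀ x ∈ names Γ₁, x ∉ Nb)
    (h₂ : ∀ x ∈ names Γ₂, x ∉ Na) :
    Spl Θ Na Nb (Γ₁ ++ Γ₂) Γ₁ Γ₂ (splitCtx D Θ Γ₁ Γ₂) := by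
  induction Γ₁ with
  | nil => exact spl_right Na Nb Γ₂ h₂
  | cons p Γ₁ ih =>
    have := Spl.cons (.left p.2 (h₁ p.1 (by simp [names])))
      (ih fun x hx => h₁ x (by simp only [names, List.map_cons, List.mem_cons] at hx ⊢; exact .inr hx))
    exact (congrArg (Spl Θ Na Nb (p :: Γ₁ ++ Γ₂) (p :: Γ₁) Γ₂) (cons4_runitInv _)).mp this

theorem spl_dup {Na Nb : List ℕ} (Δ : CtxL) {Γ₁ Γ₂ : CtxL} (h₁ : ∀ x ∈ names Γ₁, x ∉ Nb)
    (h₂ : ∀ x ∈ names Γ₂, x ∉ Na) :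
    Spl Θ Na Nb (bangify Δ ++ (Γ₁ ++ Γ₂)) (bangify Δ ++ Γ₁) (bangify Δ ++ Γ₂)
      (splitCtx D Θ (bangify Δ) (Γ₁ ++ Γ₂) ;; (dupCtx D Θ Δ ⊠ splitCtx D Θ Γ₁ Γ₂) ;;
        mid4 D (denCtx D Θ (bangify Δ)) (denCtx D Θ (bangify Δ)) (denCtx D Θ Γ₁) (denCtx D Θ Γ₂) ;;
        (joinCtx D Θ (bangify Δ) Γ₁ ⊠ joinCtx D Θ (bangify Δ) Γ₂)) := by
  induction Δ with
  | nil =>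
    refine (congrArg (Spl Θ Na Nb (Γ₁ ++ Γ₂) Γ₁ Γ₂) ?_).mp (spl_splitCtx h₁ h₂)
    exact ((congrArg (_ ;; ·) (cons4_lunit _)).trans
      ((comp_eq_assoc (lunitInv_lunit _) _).trans (id_comp' _))).symm
  | cons p Δ ih =>
    exact (congrArg (Spl Θ Na Nb _ _ _) (cons4_assoc ..)).mpr (.cons (.both (x := p.1) p.2) ih)

theorem spl_splitDup {Δ Γ₁ Γ₂ : CtxL} (h : (names (bangify Δ ++ Γ₁ ++ Γ₂)).Nodup) :
    Spl Θ (names (bangify Δ ++ Γ₁)) (names (bangify Δ ++ Γ₂)) (bangify Δ ++ Γ₁ ++ Γ₂)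
      (bangify Δ ++ Γ₁) (bangify Δ ++ Γ₂) (splitDup D Θ Δ Γ₁ Γ₂) := by
  have tr {Na Nb : List ℕ} {Γ Γ' Γa Γb : CtxL} (e : Γ = Γ')
      {f : D.Hom (denCtx D Θ Γ') (D.tens (denCtx D Θ Γa) (denCtx D Θ Γb))}
      (hf : Spl Θ Na Nb Γ' Γa Γb f) :
      Spl Θ Na Nb Γ Γa Γb (eqHom D (congrArg (denCtx D Θ) e) ;; f) := by
    subst e
    rwa [eqHom_self, id_comp']
  refine tr (List.append_assoc ..) (spl_dup Δ (fun x hx hx' => ?_) fun x hx hx' => ?_)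
  all_goals
    simp only [names, List.map_append, List.nodup_append, List.mem_append] at h hx hx'
    obtain ⟨⟨-, -, h₁⟩, -, h₂⟩ := h
    rcases hx' with hx' | hx'
    · first | exact h₁ x hx' x hx rfl | exact h₂ x (.inl hx') x hx rfl
    · first | exact h₂ x (.inr hx') x hx rfl | exact h₂ x (.inr hx) x hx' rfl

theorem perm_extHom (Γ : CtxL) (x : ℕ) (A : Ty) :
    Perm Θ ((x, A) :: Γ) (Γ ++ [(x, A)])
      (D.symm (denTy D Θ A) (denCtx D Θ Γ) ;; extHom D Θ Γ x A) := by
  induction Γ with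
  | nil => exact (congrArg (Perm Θ [(x, A)] [(x, A)]) (symm_unit (denTy D Θ A))).mpr (.refl _)
  | cons p Γ ih =>
    have e {X P C X' E : D.Obj} (r : D.Hom X X') (j : D.Hom (D.tens C X') E) :
        D.symm X (D.tens P C) ;; (D.id (D.tens P C) ⊠ r) ;; D.assoc P C X' ;; (D.id P ⊠ j) =
          swp D X P C ;; (D.id P ⊠ (D.symm X C ;; (D.id C ⊠ r) ;; j)) := by
      rw [id_tmap_comp, id_tmap_comp, ← tmap_id', comp_congr_assoc (assoc_natural' ..),
        ← comp_assoc', symm_assoc, comp_assoc']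
    have h := (Perm.of_sw (.head (x, A) p Γ)).trans (ih.tail p)
    exact (congrArg (Perm Θ ((x, A) :: p :: Γ) (p :: Γ ++ [(x, A)])) (e ..)).mpr h

theorem perm_ext2Hom (Γ : CtxL) (x : ℕ) (A : Ty) (y : ℕ) (B : Ty) :
    Perm Θ ((x, A) :: (y, B) :: Γ) (Γ ++ [(x, A), (y, B)])
      (D.assocInv (denTy D Θ A) (denTy D Θ B) (denCtx D Θ Γ) ;;
        D.symm (D.tens (denTy D Θ A) (denTy D Θ B)) (denCtx D Θ Γ) ;; ext2Hom D Θ Γ x A y B) := by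
  induction Γ with
  | nil =>
    exact (congrArg (Perm Θ [(x, A), (y, B)] [(x, A), (y, B)])
      (symm_unit₂ (denTy D Θ A) (denTy D Θ B))).mpr (.refl _)
  | cons p Γ ih =>
    have e {X Y P C X' E : D.Obj} (r : D.Hom (D.tens X Y) X') (j : D.Hom (D.tens C X') E) :
        D.assocInv X Y (D.tens P C) ;; D.symm (D.tens X Y) (D.tens P C) ;;
            (D.id (D.tens P C) ⊠ r) ;; D.assoc P C X' ;; (D.id P ⊠ j) =
          ((D.id X ⊠ swp D Y P C) ;; swp D X P (D.tens Y C)) ;;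
            (D.id P ⊠ (D.assocInv X Y C ;; D.symm (D.tens X Y) C ;; (D.id C ⊠ r) ;; j)) := by
      rw [id_tmap_comp, id_tmap_comp, id_tmap_comp, ← tmap_id',
        comp_congr_assoc (assoc_natural' ..), ← comp_assoc' (D.symm _ _), symm_assoc]
      simp only [comp_assoc']
      rw [← comp_assoc' (D.assocInv _ _ _), assocInv_swp']
      simp only [comp_assoc']
    have h := ((Perm.of_sw (.head (y, B) p Γ)).tail (x, A)).trans
      (.of_sw (.head (x, A) p ((y, B) :: Γ))) |>.trans (ih.tail p)
    exact (congrArg (Perm Θ ((x, A) :: (y, B) :: p :: Γ) (p :: Γ ++ [(x, A), (y, B)]))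
      (e ..)).mpr h

theorem promCtx_eps (Δ : CtxL) : promCtx D Θ Δ ;; D.eps _ = D.id _ := by
  induction Δ with
  | nil => exact m0_eps
  | cons p Δ ih =>
    refine (comp_assoc' ..).trans ((congrArg (_ ;; ·) (m2_eps _ _)).trans ?_)
    refine (tmap_comp_tmap ..).trans ?_
    exact (congrArg₂ (D.tmap · ·) (delta_eps _) ih).trans (tmap_id' _ _)

/-- Inversion of a splitting of an optionally extended context. -/
theorem Spl.inv {Na Nb : List ℕ} {x : ℕ} {o : Option Ty} {Γ Γa Γb : CtxL}
    {f : D.Hom (denCtx D Θ (ocons x o Γ)) (D.tens (denCtx D Θ Γa) (denCtx D Θ Γb))}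
    (h : Spl Θ Na Nb (ocons x o Γ) Γa Γb f) :
    ∃ (oa ob : Option Ty) (k : D.Hom (denOpt Θ o) (D.tens (denOpt Θ oa) (denOpt Θ ob)))
      (Γa' Γb' : CtxL) (f' : D.Hom (denCtx D Θ Γ) (D.tens (denCtx D Θ Γa') (denCtx D Θ Γb'))),
      ORoute Θ Na Nb x o oa ob k ∧ Spl Θ Na Nb Γ Γa' Γb' f' ∧
      ∀ P : ∀ Γa Γb : CtxL, D.Hom (D.tens (denOpt Θ o) (denCtx D Θ Γ))
          (D.tens (denCtx D Θ Γa) (denCtx D Θ Γb)) → Prop,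
        P (ocons x oa Γa') (ocons x ob Γb') (cons4 k f' (hmap Θ x oa Γa') (hmap Θ x ob Γb')) →
        P Γa Γb (hmap Θ x o Γ ;; f) := by
  cases o with
  | none =>
    exact ⟨none, none, _, Γa, Γb, f, .none, h, fun P hP =>
      (congrArg (P Γa Γb) (cons4_lunit f)).mp hP⟩
  | some A =>
    cases h with
    | @cons _ _ oa ob k _ Γa Γb f hk hf =>
      exact ⟨oa, ob, k, Γa, Γb, f, .some hk, hf, fun P hP =>
        (congrArg (P _ _) (id_comp' _)).mpr hP⟩

end Structural

end QLamSem

namespace QLamSem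

section Worlds

local notation:80 f:81 ";;" g:80 => LCDData.comp _ f g
local notation:90 f:91 "⊠" g:90 => LCDData.tmap _ f g

variable {D : LCDData} (Θ : ℕ → D.Obj)

/-- The optional types that are not a type without leading `!`. -/
def NeedCo : Option Ty → Prop
  | none => True
  | some A => IsBang A

/-- `Core`, extended to optional types. -/
def SlotCore {Y : D.Obj} : ∀ (o o' : Option Ty), D.Hom Y (denOpt Θ o) → D.Hom Y (denOpt Θ o') → Prop
  | some A, some A', m, m' => Core Θ A A' m m'
  | _, _, _, _ => True

/-- Related values for a variable `x` that occurs optionally in each of two contexts, where `N`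
and `N'` are the names occurring in the two contexts. -/
structure SlotRel (N N' : List ℕ) (x : ℕ) {Y : D.Obj} (o o' : Option Ty)
    (m : D.Hom Y (denOpt Θ o)) (m' : D.Hom Y (denOpt Θ o')) : Prop where
  co : NeedCo o ∨ NeedCo o' → IsCo D Y
  left : o.isSome → x ∈ N' → o'.isSome
  right : o'.isSome → x ∈ N → o.isSome
  core : SlotCore Θ o o' m m'

/-- Related substitutions for two contexts whose common variables occur in the same order. -/
inductive Wd (N N' : List ℕ) : ∀ (X : D.Obj) (Γ Γ' : CtxL),
    D.Hom X (denCtx D Θ Γ) → D.Hom X (denCtx D Θ Γ') → Prop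
  | nil : Wd N N' D.unit [] [] (D.id D.unit) (D.id D.unit)
  | cons {x : ℕ} {o o' : Option Ty} {Y : D.Obj} {m : D.Hom Y (denOpt Θ o)}
      {m' : D.Hom Y (denOpt Θ o')} {X : D.Obj} {Γ Γ' : CtxL} {γ : D.Hom X (denCtx D Θ Γ)}
      {γ' : D.Hom X (denCtx D Θ Γ')} : SlotRel Θ N N' x o o' m m' → Wd N N' X Γ Γ' γ γ' →
      Wd N N' (D.tens Y X) (ocons x o Γ) (ocons x o' Γ') ((m ⊠ γ) ;; hmap Θ x o Γ)
        ((m' ⊠ γ') ;; hmap Θ x o' Γ')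

/-- Related substitutions for two contexts, up to permutation. -/
def WdP (N N' : List ℕ) (X : D.Obj) (Γ Γ' : CtxL) (γ : D.Hom X (denCtx D Θ Γ))
    (γ' : D.Hom X (denCtx D Θ Γ')) : Prop :=
  ∃ (Γ₀ Γ₀' : CtxL) (γ₀ : D.Hom X (denCtx D Θ Γ₀)) (γ₀' : D.Hom X (denCtx D Θ Γ₀'))
    (p : D.Hom (denCtx D Θ Γ₀) (denCtx D Θ Γ)) (p' : D.Hom (denCtx D Θ Γ₀') (denCtx D Θ Γ')),
    Wd Θ N N' X Γ₀ Γ₀' γ₀ γ₀' ∧ Perm Θ Γ₀ Γ p ∧ Perm Θ Γ₀' Γ' p' ∧ γ = γ₀ ;; p ∧ γ' = γ₀' ;; p'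

/-- `Keep o oa m ma` holds if `ma` is `m` or discards the variable. -/
inductive Keep {Y : D.Obj} : ∀ (o oa : Option Ty), D.Hom Y (denOpt Θ o) → D.Hom Y (denOpt Θ oa) → Prop
  | keep (o : Option Ty) (m : D.Hom Y (denOpt Θ o)) : Keep o o m m
  | drop (o : Option Ty) (m : D.Hom Y (denOpt Θ o)) (ma : D.Hom Y D.unit) : Keep o none m ma

variable {Θ}

theorem SlotCore.keep {Y : D.Obj} {o o' oa oa' : Option Ty} {m : D.Hom Y (denOpt Θ o)}
    {m' : D.Hom Y (denOpt Θ o')} {ma : D.Hom Y (denOpt Θ oa)} {ma' : D.Hom Y (denOpt Θ oa')}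
    (h : SlotCore Θ o o' m m') (hk : Keep Θ o oa m ma) (hk' : Keep Θ o' oa' m' ma') :
    SlotCore Θ oa oa' ma ma' := by
  cases hk with
  | drop => trivial
  | keep => cases hk' with
    | drop => cases o <;> trivial
    | keep => exact h

namespace ORoute

variable {Na Nb : List ℕ} {x : ℕ} {o oa ob : Option Ty}
  {k : D.Hom (denOpt Θ o) (D.tens (denOpt Θ oa) (denOpt Θ ob))}

theorem isSome_iff (h : ORoute Θ Na Nb x o oa ob k) :
    ((oa.isSome → o.isSome) ∧ (ob.isSome → o.isSome)) ∧
      (o.isSome → x ∈ Na → oa.isSome) ∧ (o.isSome → x ∈ Nb → ob.isSome) := by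
  cases h with
  | none => simp
  | some h => cases h <;> simp_all [Option.isSome]

variable [LC D]

theorem exists_keep (h : ORoute Θ Na Nb x o oa ob k) {Y : D.Obj} {c : D.Hom Y (D.L Y)}
    (hc : c ;; D.eps Y = D.id Y) (m : D.Hom Y (denOpt Θ o)) :
    ∃ (ma : D.Hom Y (denOpt Θ oa)) (mb : D.Hom Y (denOpt Θ ob)),
      Keep Θ o oa m ma ∧ Keep Θ o ob m mb ∧ m ;; k = coDup c ;; (ma ⊠ mb) := by
  have hl {P : D.Obj} (m : D.Hom Y P) : m ;; D.lunitInv P = coDup c ;; (coDisc c ⊠ m) := by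
    rw [lunitInv_natural, ← coDup_coDisc_left hc, comp_assoc', tmap_comp_tmap, id_comp', comp_id']
  have hr {P : D.Obj} (m : D.Hom Y P) : m ;; D.runitInv P = coDup c ;; (m ⊠ coDisc c) := by
    rw [runitInv_natural, ← coDup_coDisc_right hc, comp_assoc', tmap_comp_tmap, id_comp', comp_id']
  cases h with
  | none => exact ⟨_, _, .drop _ _ _, .keep _ _, hl m⟩
  | some h =>
    cases h with
    | both A =>
      refine ⟨m, m, .keep _ _, .keep _ _, ?_⟩
      refine (congrArg (m ;; ·) (coDup_delta (denTy D Θ A)).symm).trans ?_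
      exact coDup_natural hc (delta_eps _) m
    | left => exact ⟨_, _, .keep _ _, .drop _ _ _, hr m⟩
    | right => exact ⟨_, _, .drop _ _ _, .keep _ _, hl m⟩

end ORoute

variable {N N' Na Na' Nb Nb' : List ℕ}

theorem mem_ocons {x : ℕ} {o : Option Ty} {Γ : CtxL} {p : ℕ × Ty} :
    p ∈ ocons x o Γ ↔ (p.1 = x ∧ o = some p.2) ∨ p ∈ Γ := by
  cases o with
  | none => simp [ocons]
  | some A => simp [ocons, Prod.ext_iff, eq_comm]

theorem Wd.mono {M M' : List ℕ} {X : D.Obj} {Γ Γ' : CtxL} {γ : D.Hom X (denCtx D Θ Γ)}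
    {γ' : D.Hom X (denCtx D Θ Γ')} (h : Wd Θ N N' X Γ Γ' γ γ')
    (hl : ∀ p ∈ Γ, p.1 ∈ M' → p.1 ∈ N') (hr : ∀ p ∈ Γ', p.1 ∈ M → p.1 ∈ N) :
    Wd Θ M M' X Γ Γ' γ γ' := by
  induction h with
  | nil => exact .nil
  | @cons x o o' Y m m' X Γ Γ' γ γ' hs _ ih =>
    refine .cons ⟨hs.co, fun s t => ?_, fun s t => ?_, hs.core⟩
      (ih (fun p hp => hl p (mem_ocons.2 (.inr hp))) (fun p hp => hr p (mem_ocons.2 (.inr hp))))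
    · obtain ⟨A, rfl⟩ := Option.isSome_iff_exists.1 s
      exact hs.left s (hl (x, A) (mem_ocons.2 (.inl ⟨rfl, rfl⟩)) t)
    · obtain ⟨A, rfl⟩ := Option.isSome_iff_exists.1 s
      exact hs.right s (hr (x, A) (mem_ocons.2 (.inl ⟨rfl, rfl⟩)) t)

theorem WdP.mono {M M' : List ℕ} {X : D.Obj} {Γ Γ' : CtxL} {γ : D.Hom X (denCtx D Θ Γ)}
    {γ' : D.Hom X (denCtx D Θ Γ')} (h : WdP Θ N N' X Γ Γ' γ γ')
    (hl : ∀ p ∈ Γ, p.1 ∈ M' → p.1 ∈ N') (hr : ∀ p ∈ Γ', p.1 ∈ M → p.1 ∈ N) :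
    WdP Θ M M' X Γ Γ' γ γ' := by
  obtain ⟨Γ₀, Γ₀', γ₀, γ₀', q, q', hw, hq, hq', rfl, rfl⟩ := h
  exact ⟨_, _, _, _, _, _, hw.mono (fun p hp => hl p (hq.mem_iff.1 hp))
    (fun p hp => hr p (hq'.mem_iff.1 hp)), hq, hq', rfl, rfl⟩

variable [LC D]

theorem slotRel_unit (x : ℕ) : SlotRel Θ N N' x none none (D.id D.unit) (D.id D.unit) :=
  ⟨fun _ => isCo_unit, by simp, by simp, trivial⟩

/-- Related values can be distributed over the two parts of a splitting. -/
theorem SlotRel.split {x : ℕ} {Y : D.Obj} {o o' : Option Ty} {m : D.Hom Y (denOpt Θ o)}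
    {m' : D.Hom Y (denOpt Θ o')} (h : SlotRel Θ N N' x o o' m m') {oa ob oa' ob' : Option Ty}
    {k : D.Hom (denOpt Θ o) (D.tens (denOpt Θ oa) (denOpt Θ ob))}
    {k' : D.Hom (denOpt Θ o') (D.tens (denOpt Θ oa') (denOpt Θ ob'))}
    (hk : ORoute Θ Na Nb x o oa ob k) (hk' : ORoute Θ Na' Nb' x o' oa' ob' k')
    (ha : Na ⊆ N) (hb : Nb ⊆ N) (ha' : Na' ⊆ N') (hb' : Nb' ⊆ N')
    (hoa : ¬ NeedCo oa → x ∈ Na') (hob : ¬ NeedCo ob → x ∈ Nb') :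
    ∃ (Ya Yb : D.Obj) (g : D.Hom Y (D.tens Ya Yb)) (ma : D.Hom Ya (denOpt Θ oa))
      (mb : D.Hom Yb (denOpt Θ ob)) (ma' : D.Hom Ya (denOpt Θ oa')) (mb' : D.Hom Yb (denOpt Θ ob')),
      SlotRel Θ Na Na' x oa oa' ma ma' ∧ SlotRel Θ Nb Nb' x ob ob' mb mb' ∧
      m ;; k = g ;; (ma ⊠ mb) ∧ m' ;; k' = g ;; (ma' ⊠ mb') := by
  by_cases hY : IsCo D Y
  · obtain ⟨c, hc⟩ := hY
    obtain ⟨ma, mb, hma, hmb, e⟩ := hk.exists_keep hc m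
    obtain ⟨ma', mb', hma', hmb', e'⟩ := hk'.exists_keep hc m'
    obtain ⟨⟨i₁, i₂⟩, i₃, i₄⟩ := hk.isSome_iff
    obtain ⟨⟨i₁', i₂'⟩, i₃', i₄'⟩ := hk'.isSome_iff
    exact ⟨Y, Y, coDup c, ma, mb, ma', mb',
      ⟨fun _ => ⟨c, hc⟩, fun s t => i₃' (h.left (i₁ s) (ha' t)) t,
        fun s t => i₃ (h.right (i₁' s) (ha t)) t, h.core.keep hma hma'⟩,
      ⟨fun _ => ⟨c, hc⟩, fun s t => i₄' (h.left (i₂ s) (hb' t)) t,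
        fun s t => i₄ (h.right (i₂' s) (hb t)) t, h.core.keep hmb hmb'⟩, e, e'⟩
  · have hn := fun hn => hY (h.co hn)
    replace hn := not_or.1 hn
    cases hk with
    | none => exact (hn.1 trivial).elim
    | @some A _ _ _ hk =>
    cases hk' with
    | none => exact (hn.2 trivial).elim
    | @some A' _ _ _ hk' =>
    cases hk with
    | both => exact (hn.1 trivial).elim
    | left =>
      cases hk' with
      | both => exact (hn.2 trivial).elim
      | left =>
        exact ⟨Y, D.unit, D.runitInv Y, m, D.id _, m', D.id _, ⟨h.co, by simp, by simp, h.core⟩,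
          slotRel_unit x, runitInv_natural m, runitInv_natural m'⟩
      | right _ hx => exact (hx (hoa hn.1)).elim
    | right =>
      cases hk' with
      | both => exact (hn.2 trivial).elim
      | left _ hx => exact (hx (hob hn.1)).elim
      | right =>
        exact ⟨D.unit, Y, D.lunitInv Y, D.id _, m, D.id _, m', slotRel_unit x,
          ⟨h.co, by simp, by simp, h.core⟩, lunitInv_natural m, lunitInv_natural m'⟩

theorem Wd.split {X : D.Obj} {Γ Γ' : CtxL} {γ : D.Hom X (denCtx D Θ Γ)}
    {γ' : D.Hom X (denCtx D Θ Γ')} (h : Wd Θ N N' X Γ Γ' γ γ') {Γa Γb Γa' Γb' : CtxL}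
    {f : D.Hom (denCtx D Θ Γ) (D.tens (denCtx D Θ Γa) (denCtx D Θ Γb))}
    {f' : D.Hom (denCtx D Θ Γ') (D.tens (denCtx D Θ Γa') (denCtx D Θ Γb'))}
    (hf : Spl Θ Na Nb Γ Γa Γb f) (hf' : Spl Θ Na' Nb' Γ' Γa' Γb' f')
    (ha : Na ⊆ N) (hb : Nb ⊆ N) (ha' : Na' ⊆ N') (hb' : Nb' ⊆ N')
    (hΓa : ∀ p ∈ Γa, ¬ IsBang p.2 → p.1 ∈ Na') (hΓb : ∀ p ∈ Γb, ¬ IsBang p.2 → p.1 ∈ Nb') :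
    ∃ (Xa Xb : D.Obj) (g : D.Hom X (D.tens Xa Xb)) (γa : D.Hom Xa (denCtx D Θ Γa))
      (γb : D.Hom Xb (denCtx D Θ Γb)) (γa' : D.Hom Xa (denCtx D Θ Γa'))
      (γb' : D.Hom Xb (denCtx D Θ Γb')), Wd Θ Na Na' Xa Γa Γa' γa γa' ∧
      Wd Θ Nb Nb' Xb Γb Γb' γb γb' ∧ γ ;; f = g ;; (γa ⊠ γb) ∧ γ' ;; f' = g ;; (γa' ⊠ γb') := by
  induction h generalizing Γa Γb Γa' Γb' with
  | nil =>
    cases hf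
    cases hf'
    exact ⟨_, _, D.lunitInv D.unit, _, _, _, _, .nil, .nil,
      lunitInv_natural _, lunitInv_natural _⟩
  | @cons x o o' Y m m' X Γ Γ' γ γ' hs _ ih =>
    obtain ⟨oa, ob, k, Γa₁, Γb₁, f₁, hk, hf₁, hP⟩ := hf.inv
    obtain ⟨oa', ob', k', Γa₁', Γb₁', f₁', hk', hf₁', hP'⟩ := hf'.inv
    revert hΓa hΓb
    rw [comp_assoc', comp_assoc']
    refine hP (fun Γa Γb w => (∀ p ∈ Γa, ¬ IsBang p.2 → p.1 ∈ Na') →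
      (∀ p ∈ Γb, ¬ IsBang p.2 → p.1 ∈ Nb') → ∃ (Xa Xb : D.Obj) (g : D.Hom _ (D.tens Xa Xb))
      (γa : D.Hom Xa (denCtx D Θ Γa))
      (γb : D.Hom Xb (denCtx D Θ Γb)) (γa' : D.Hom Xa (denCtx D Θ Γa'))
      (γb' : D.Hom Xb (denCtx D Θ Γb')), Wd Θ Na Na' Xa Γa Γa' γa γa' ∧
      Wd Θ Nb Nb' Xb Γb Γb' γb γb' ∧ (m ⊠ γ) ;; w = g ;; (γa ⊠ γb) ∧ _ = g ;; (γa' ⊠ γb')) ?_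
    refine hP' (fun Γa' Γb' w' => _ → _ → ∃ (Xa Xb : D.Obj) (g : D.Hom _ (D.tens Xa Xb))
      (γa : D.Hom Xa (denCtx D Θ (ocons x oa Γa₁)))
      (γb : D.Hom Xb (denCtx D Θ (ocons x ob Γb₁))) (γa' : D.Hom Xa (denCtx D Θ Γa'))
      (γb' : D.Hom Xb (denCtx D Θ Γb')), Wd Θ Na Na' Xa _ Γa' γa γa' ∧
      Wd Θ Nb Nb' Xb _ Γb' γb γb' ∧ _ = g ;; (γa ⊠ γb) ∧
      (m' ⊠ γ') ;; w' = g ;; (γa' ⊠ γb')) fun hΓa hΓb => ?_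
    have nb {o : Option Ty} {Γ : CtxL} {N : List ℕ}
        (h : ∀ p ∈ ocons x o Γ, ¬ IsBang p.2 → p.1 ∈ N) : ¬ NeedCo o → x ∈ N := by
      cases o with
      | none => exact fun h => (h trivial).elim
      | some A => exact h (x, A) (mem_ocons.2 (.inl ⟨rfl, rfl⟩))
    obtain ⟨Ya, Yb, g₀, ma, mb, ma', mb', hma, hmb, e, e'⟩ :=
      hs.split hk hk' ha hb ha' hb' (nb hΓa) (nb hΓb)
    obtain ⟨Xa, Xb, g, γa, γb, γa', γb', hwa, hwb, i, i'⟩ := ih hf₁ hf₁'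
      (fun p hp => hΓa p (mem_ocons.2 (.inr hp))) (fun p hp => hΓb p (mem_ocons.2 (.inr hp)))
    refine ⟨_, _, cons4 g₀ g (D.id _) (D.id _), _, _, _, _, .cons hma hwa, .cons hmb hwb, ?_, ?_⟩
    · rw [cons4_post, id_comp', id_comp', ← cons4_mid, ← e, ← i]
      exact cons4_pre ..
    · rw [cons4_post, id_comp', id_comp', ← cons4_mid, ← e', ← i']
      exact cons4_pre ..

theorem WdP.split {X : D.Obj} {Γ Γ' : CtxL} {γ : D.Hom X (denCtx D Θ Γ)}
    {γ' : D.Hom X (denCtx D Θ Γ')} (h : WdP Θ N N' X Γ Γ' γ γ') {Γa Γb Γa' Γb' : CtxL}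
    {f : D.Hom (denCtx D Θ Γ) (D.tens (denCtx D Θ Γa) (denCtx D Θ Γb))}
    {f' : D.Hom (denCtx D Θ Γ') (D.tens (denCtx D Θ Γa') (denCtx D Θ Γb'))}
    (hf : Spl Θ Na Nb Γ Γa Γb f) (hf' : Spl Θ Na' Nb' Γ' Γa' Γb' f')
    (ha : Na ⊆ N) (hb : Nb ⊆ N) (ha' : Na' ⊆ N') (hb' : Nb' ⊆ N')
    (hΓa : ∀ p ∈ Γa, ¬ IsBang p.2 → p.1 ∈ Na') (hΓb : ∀ p ∈ Γb, ¬ IsBang p.2 → p.1 ∈ Nb') :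
    ∃ (Xa Xb : D.Obj) (g : D.Hom X (D.tens Xa Xb)) (γa : D.Hom Xa (denCtx D Θ Γa))
      (γb : D.Hom Xb (denCtx D Θ Γb)) (γa' : D.Hom Xa (denCtx D Θ Γa'))
      (γb' : D.Hom Xb (denCtx D Θ Γb')), WdP Θ Na Na' Xa Γa Γa' γa γa' ∧
      WdP Θ Nb Nb' Xb Γb Γb' γb γb' ∧ γ ;; f = g ;; (γa ⊠ γb) ∧ γ' ;; f' = g ;; (γa' ⊠ γb') := by
  obtain ⟨Γ₀, Γ₀', γ₀, γ₀', p, p', hw, hp, hp', rfl, rfl⟩ := h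
  obtain ⟨Γa₀, Γb₀, f₀, pa, pb, hf₀, hpa, hpb, e⟩ := hf.perm hp
  obtain ⟨Γa₀', Γb₀', f₀', pa', pb', hf₀', hpa', hpb', e'⟩ := hf'.perm hp'
  obtain ⟨Xa, Xb, g, γa, γb, γa', γb', hwa, hwb, i, i'⟩ := hw.split hf₀ hf₀' ha hb ha' hb'
    (fun q hq => hΓa q (hpa.mem_iff.1 hq)) (fun q hq => hΓb q (hpb.mem_iff.1 hq))
  refine ⟨Xa, Xb, g, _, _, _, _, ⟨_, _, _, _, _, _, hwa, hpa, hpa', rfl, rfl⟩,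
    ⟨_, _, _, _, _, _, hwb, hpb, hpb', rfl, rfl⟩, ?_, ?_⟩
  · rw [comp_assoc', e, ← comp_assoc', i, comp_assoc', tmap_comp_tmap]
  · rw [comp_assoc', e', ← comp_assoc', i', comp_assoc', tmap_comp_tmap]

theorem WdP.perm {X : D.Obj} {Γ Γ' Γ₁ Γ₁' : CtxL} {γ : D.Hom X (denCtx D Θ Γ)}
    {γ' : D.Hom X (denCtx D Θ Γ')} (h : WdP Θ N N' X Γ Γ' γ γ')
    {p : D.Hom (denCtx D Θ Γ) (denCtx D Θ Γ₁)} {p' : D.Hom (denCtx D Θ Γ') (denCtx D Θ Γ₁')}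
    (hp : Perm Θ Γ Γ₁ p) (hp' : Perm Θ Γ' Γ₁' p') : WdP Θ N N' X Γ₁ Γ₁' (γ ;; p) (γ' ;; p') := by
  obtain ⟨Γ₀, Γ₀', γ₀, γ₀', q, q', hw, hq, hq', rfl, rfl⟩ := h
  exact ⟨_, _, _, _, _, _, hw, hq.trans hp, hq'.trans hp', comp_assoc' .., comp_assoc' ..⟩

theorem Wd.isCo {X : D.Obj} {Γ Γ' : CtxL} {γ : D.Hom X (denCtx D Θ Γ)}
    {γ' : D.Hom X (denCtx D Θ Γ')} (h : Wd Θ N N' X Γ Γ' γ γ')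
    (hb : (∀ p ∈ Γ, IsBang p.2) ∨ ∀ p ∈ Γ', IsBang p.2) : IsCo D X := by
  have nc {x : ℕ} {o : Option Ty} {Γ : CtxL} (h : ∀ p ∈ ocons x o Γ, IsBang p.2) : NeedCo o := by
    cases o with
    | none => trivial
    | some A => exact h (x, A) (mem_ocons.2 (.inl ⟨rfl, rfl⟩))
  induction h with
  | nil => exact isCo_unit
  | cons hs _ ih =>
    exact (hs.co (hb.imp nc nc)).tens (ih (hb.imp (fun h p hp => h p (mem_ocons.2 (.inr hp)))
      (fun h p hp => h p (mem_ocons.2 (.inr hp)))))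

theorem WdP.isCo {X : D.Obj} {Γ Γ' : CtxL} {γ : D.Hom X (denCtx D Θ Γ)}
    {γ' : D.Hom X (denCtx D Θ Γ')} (h : WdP Θ N N' X Γ Γ' γ γ')
    (hb : (∀ p ∈ Γ, IsBang p.2) ∨ ∀ p ∈ Γ', IsBang p.2) : IsCo D X := by
  obtain ⟨Γ₀, Γ₀', γ₀, γ₀', q, q', hw, hq, hq', -, -⟩ := h
  exact hw.isCo (hb.imp (fun h p hp => h p (hq.mem_iff.1 hp)) fun h p hp => h p (hq'.mem_iff.1 hp))

theorem wd_id (N N' : List ℕ) (Γ : CtxL) :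
    Wd Θ N N' (denCtx D Θ Γ) Γ Γ (D.id _) (D.id _) := by
  induction Γ with
  | nil => exact .nil
  | cons p Γ ih =>
    have e : (D.id (denTy D Θ p.2) ⊠ D.id (denCtx D Θ Γ)) ;; D.id _ = D.id _ :=
      (comp_id' _).trans (tmap_id' _ _)
    refine (congrArg₂ (Wd Θ N N' _ (p :: Γ) (p :: Γ)) e e).mp
      (.cons (x := p.1) (o := some p.2) (o' := some p.2) ⟨fun h => ?_, by simp, by simp,
        (core_self p.2).1 _⟩ ih)
    obtain ⟨x, A⟩ := p
    cases A with
    | bang A => exact isCo_L _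
    | _ => exact (or_self_iff.1 h).elim

theorem wdP_id (N N' : List ℕ) (Γ : CtxL) :
    WdP Θ N N' (denCtx D Θ Γ) Γ Γ (D.id _) (D.id _) :=
  ⟨_, _, _, _, _, _, wd_id N N' Γ, .refl _, .refl _, (id_comp' _).symm, (id_comp' _).symm⟩

/-- Extends related substitutions by related values for a fresh variable. -/
theorem WdP.cons {x : ℕ} {A A' : Ty} {X Y : D.Obj} {Γ Γ' : CtxL} {γ : D.Hom X (denCtx D Θ Γ)}
    {γ' : D.Hom X (denCtx D Θ Γ')} (h : WdP Θ (names Γ) (names Γ') X Γ Γ' γ γ')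
    (hx : x ∉ names Γ) (hx' : x ∉ names Γ') {v : D.Hom Y (denTy D Θ A)}
    {v' : D.Hom Y (denTy D Θ A')} (hco : IsBang A ∨ IsBang A' → IsCo D Y)
    (hv : Core Θ A A' v v') :
    WdP Θ (names ((x, A) :: Γ)) (names ((x, A') :: Γ')) (D.tens Y X) ((x, A) :: Γ) ((x, A') :: Γ')
      (v ⊠ γ) (v' ⊠ γ') := by
  have e {P G H : D.Obj} (v : D.Hom Y P) (γ : D.Hom X G) (q : D.Hom G H) :
      v ⊠ (γ ;; q) = ((v ⊠ γ) ;; D.id _) ;; (D.id P ⊠ q) := by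
    rw [comp_id', tmap_comp_tmap, comp_id']
  have fresh {Γ Γ' : CtxL} {A : Ty} (h : x ∉ names Γ) :
      ∀ p ∈ Γ, p.1 ∈ names ((x, A) :: Γ') → p.1 ∈ names Γ' := by
    intro p hp hm
    refine (List.mem_cons.1 hm).resolve_left fun e => h ?_
    exact (show p.1 = x from e) ▸ List.mem_map_of_mem hp
  obtain ⟨Γ₀, Γ₀', γ₀, γ₀', q, q', hw, hq, hq', rfl, rfl⟩ := h.mono (fresh (A := A') hx)
    (fresh (A := A) hx')
  have hc := Wd.cons (x := x) (o := some A) (o' := some A') ⟨hco, by simp, by simp, hv⟩ hw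
  refine ⟨_, _, _, _, _, _, hc, hq.tail (x, A), hq'.tail (x, A'), ?_, ?_⟩
  · exact e ..
  · exact e ..

end Worlds

end QLamSem

namespace QLamSem

section FreeVariables

/-- `PFree x M` holds if `x` occurs free in the untyped term `M`. -/
def PFree (x : ℕ) : PTm → Prop
  | .var y => y = x
  | .cst _ => False
  | .star => False
  | .lam y M => y ≠ x ∧ PFree x M
  | .app M N => PFree x M ∨ PFree x N
  | .pair M N => PFree x M ∨ PFree x N
  | .letv y M N => PFree x M ∨ (y ≠ x ∧ PFree x N)
  | .letPair y z M N => PFree x M ∨ (y ≠ x ∧ z ≠ x ∧ PFree x N)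
  | .letUnit M N => PFree x M ∨ PFree x N

theorem mem_names {Γ : CtxL} {p : ℕ × Ty} (h : p ∈ Γ) : p.1 ∈ names Γ :=
  List.mem_map_of_mem h

theorem names_append (Γ Γ' : CtxL) : names (Γ ++ Γ') = names Γ ++ names Γ' :=
  List.map_append

theorem names_cons (p : ℕ × Ty) (Γ : CtxL) : names (p :: Γ) = p.1 :: names Γ := rfl

theorem names_nil : names [] = [] := rfl

theorem names_bangify (Δ : CtxL) : names (bangify Δ) = names Δ := by
  simp [names, bangify, Function.comp_def]

theorem isBang_of_mem_bangify {Δ : CtxL} {p : ℕ × Ty} (h : p ∈ bangify Δ) : IsBang p.2 := by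
  obtain ⟨q, -, rfl⟩ := List.mem_map.1 h
  trivial

variable {cty : ℕ → Ty} {Γ : CtxL} {M : Tm} {A : Ty}

theorem TypingD.mem_names_of_free (d : TypingD cty Γ M A) {x : ℕ} (h : PFree x (erase M)) :
    x ∈ names Γ := by
  induction d with
  | cst | star => exact h.elim
  | _ =>
    simp only [erase, PFree, names_append, names_cons, names_nil, List.mem_append, List.mem_cons,
      List.not_mem_nil, or_false] at *
    grind

theorem TypingD.free_of_mem (d : TypingD cty Γ M A) {p : ℕ × Ty} (hp : p ∈ Γ)
    (hb : ¬ IsBang p.2) : PFree p.1 (erase M) := by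
  induction d with
  | cst | star => exact (hb (isBang_of_mem_bangify hp)).elim
  | lamS => exact (hb (isBang_of_mem_bangify hp)).elim
  | @var Δ x A B _ _ =>
    rcases List.mem_append.1 hp with hp | hp
    · exact (hb (isBang_of_mem_bangify hp)).elim
    · rw [List.mem_singleton.1 hp]
      rfl
  | _ =>
    have hn {Γ : CtxL} (h : p ∈ Γ) := mem_names h
    have hbang {Δ : CtxL} (h : p ∈ bangify Δ) := hb (isBang_of_mem_bangify h)
    simp only [erase, PFree, names_append, List.mem_append, List.mem_cons,
      List.not_mem_nil, or_false] at *
    grind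

end FreeVariables

section Variable

local notation:80 f:81 ";;" g:80 => LCDData.comp _ f g
local notation:90 f:91 "⊠" g:90 => LCDData.tmap _ f g

variable {D : LCDData} {Θ : ℕ → D.Obj}

theorem Perm.length_eq {Γ Γ' : CtxL} {f : D.Hom (denCtx D Θ Γ) (denCtx D Θ Γ')}
    (h : Perm Θ Γ Γ' f) : Γ.length = Γ'.length := by
  have hs {Γ Γ' : CtxL} {f : D.Hom (denCtx D Θ Γ) (denCtx D Θ Γ')} (h : Sw Θ Γ Γ' f) :
      Γ.length = Γ'.length := by
    induction h with
    | head => rfl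
    | tail _ _ ih => simp [ih]
  induction h with
  | refl => rfl
  | step h _ ih => exact (hs h).trans ih

theorem Perm.singleton {Γ : CtxL} {q : ℕ × Ty} {f : D.Hom (denCtx D Θ Γ) (denCtx D Θ [q])}
    (h : Perm Θ Γ [q] f) : ∃ e : Γ = [q], f = eqHom D (congrArg (denCtx D Θ) e) := by
  have hs {Γ Γ' : CtxL} {f : D.Hom (denCtx D Θ Γ) (denCtx D Θ Γ')} (h : Sw Θ Γ Γ' f) :
      2 ≤ Γ'.length := by
    induction h with
    | head => simp
    | tail _ _ ih => simp only [List.length_cons]; omega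
  cases h with
  | refl => exact ⟨rfl, rfl⟩
  | step h h' =>
    have := hs h
    rw [h'.length_eq] at this
    simp at this

variable (Θ) in
/-- The relation between substitutions for contexts with at most one variable. -/
def SingleRel : ∀ (X : D.Obj) (Γ Γ' : CtxL), D.Hom X (denCtx D Θ Γ) → D.Hom X (denCtx D Θ Γ') → Prop
  | _, [], [], γ, γ' => γ = γ'
  | _, [p], [p'], γ, γ' => Rel Θ p.2 p'.2 (γ ;; D.runit _) (γ' ;; D.runit _)
  | _, _, _, _, _ => True

variable [LC D]

theorem tmap_lunit_runit {X Y A : D.Obj} (m : D.Hom Y D.unit) (γ : D.Hom X (D.tens A D.unit)) :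
    ((m ⊠ γ) ;; D.lunit _) ;; D.runit A = ((m ⊠ D.id X) ;; D.lunit X) ;; γ ;; D.runit A := by
  have : (m ⊠ γ) = (m ⊠ D.id X) ;; (D.id _ ⊠ γ) := by rw [tmap_comp_tmap, comp_id', id_comp']
  simp only [comp_assoc']
  rw [this, comp_assoc', comp_congr_assoc (lunit_natural' γ)]

theorem tmap_id_runit {X Y A : D.Obj} (m : D.Hom Y A) (γ : D.Hom X D.unit) :
    ((m ⊠ γ) ;; D.id _) ;; D.runit A = ((D.id Y ⊠ γ) ;; D.runit Y) ;; m := by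
  have : (m ⊠ γ) = (D.id Y ⊠ γ) ;; (m ⊠ D.id _) := by rw [tmap_comp_tmap, comp_id', id_comp']
  rw [comp_id', this, comp_assoc', comp_assoc', runit_natural']

theorem Wd.singleRel {x : ℕ} {X : D.Obj} {Γ Γ' : CtxL} {γ : D.Hom X (denCtx D Θ Γ)}
    {γ' : D.Hom X (denCtx D Θ Γ')} (h : Wd Θ [x] [x] X Γ Γ' γ γ') (hx : ∀ p ∈ Γ, p.1 = x)
    (hx' : ∀ p ∈ Γ', p.1 = x) : SingleRel Θ X Γ Γ' γ γ' := by
  induction h with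
  | nil => rfl
  | @cons y o o' Y m m' X Γ Γ' γ γ' hs _ ih =>
    have ih := ih (fun p hp => hx p (mem_ocons.2 (.inr hp)))
      (fun p hp => hx' p (mem_ocons.2 (.inr hp)))
    have eq {o : Option Ty} {Γ : CtxL} (h : ∀ p ∈ ocons y o Γ, p.1 = x) (ho : o.isSome) :
        y ∈ [x] := by
      obtain ⟨A, rfl⟩ := Option.isSome_iff_exists.1 ho
      exact List.mem_singleton.2 (h (y, A) (mem_ocons.2 (.inl ⟨rfl, rfl⟩)))
    cases o with
    | none =>
      cases o' with
      | some A' => exact (Bool.false_ne_true (hs.right rfl (eq hx' rfl))).elim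
      | none =>
        obtain rfl : m = m' := (hs.co (.inl trivial)).unit_unique m m'
        match Γ, Γ', γ, γ', ih with
        | [], [], γ, γ', ih =>
          exact congrArg (fun δ => (m ⊠ δ) ;; D.lunit D.unit) ih
        | [p], [p'], γ, γ', ih =>
          have := Rel.pre ih ((m ⊠ D.id X) ;; D.lunit X)
          exact (congrArg₂ (Rel Θ p.2 p'.2) (tmap_lunit_runit m γ) (tmap_lunit_runit m γ')).mpr this
        | [], _ :: _, _, _, _ | _ :: _ :: _, _, _, _, _ | [_], [], _, _, _
        | [_], _ :: _ :: _, _, _, _ => trivial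
    | some A =>
      cases o' with
      | none => exact (Bool.false_ne_true (hs.left rfl (eq hx rfl))).elim
      | some A' =>
        match Γ, Γ', γ, γ', ih with
        | [], [], γ, γ', ih =>
          have hr : Rel Θ A A' m m' := Core.rel hs.core hs.co
          have := hr.pre ((D.id Y ⊠ γ) ;; D.runit Y)
          refine (congrArg₂ (Rel Θ A A') (tmap_id_runit m γ) ((congrArg (fun δ =>
            ((m' ⊠ δ) ;; D.id _) ;; D.runit _) ih.symm).trans (tmap_id_runit m' γ))).mpr this
        | [], _ :: _, _, _, _ | _ :: _, _, _, _, _ => trivial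

theorem WdP.singleton {x : ℕ} {A A' : Ty} {X : D.Obj} {γ : D.Hom X (denCtx D Θ [(x, A)])}
    {γ' : D.Hom X (denCtx D Θ [(x, A')])} (h : WdP Θ [x] [x] X [(x, A)] [(x, A')] γ γ') :
    Rel Θ A A' (γ ;; D.runit (denTy D Θ A)) (γ' ;; D.runit (denTy D Θ A')) := by
  obtain ⟨Γ₀, Γ₀', γ₀, γ₀', p, p', hw, hp, hp', rfl, rfl⟩ := h
  obtain ⟨rfl, rfl⟩ := hp.singleton
  obtain ⟨rfl, rfl⟩ := hp'.singleton
  have := hw.singleRel (by simp) (by simp)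
  exact (congrArg₂ (Rel Θ A A') (congrArg (· ;; _) (comp_id' γ₀))
    (congrArg (· ;; _) (comp_id' γ₀'))).mpr this

theorem tmap_lunit_comp {X Xa Xb A B : D.Obj} (g : D.Hom X (D.tens Xa Xb)) (d : D.Hom Xa D.unit)
    (v : D.Hom Xb A) (f : D.Hom A B) :
    g ;; (d ⊠ v) ;; D.lunit A ;; f = (g ;; (d ⊠ D.id Xb) ;; D.lunit Xb) ;; v ;; f := by
  have : (d ⊠ v) = (d ⊠ D.id Xb) ;; (D.id _ ⊠ v) := by rw [tmap_comp_tmap, comp_id', id_comp']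
  simp only [comp_assoc']
  rw [this, comp_assoc', comp_congr_assoc (lunit_natural' v)]

theorem WdP.var {Δ Δ' : CtxL} {x : ℕ} {A A' B B' : Ty} (hx : x ∉ names Δ) (hx' : x ∉ names Δ')
    {s : D.Hom (denTy D Θ A) (denTy D Θ B)} {s' : D.Hom (denTy D Θ A') (denTy D Θ B')}
    (hs : IsSub Θ A B s) (hs' : IsSub Θ A' B' s') {X : D.Obj}
    {γ : D.Hom X (denCtx D Θ (bangify Δ ++ [(x, A)]))}
    {γ' : D.Hom X (denCtx D Θ (bangify Δ' ++ [(x, A')]))}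
    (h : WdP Θ (names (bangify Δ ++ [(x, A)])) (names (bangify Δ' ++ [(x, A')])) X _ _ γ γ') :
    Rel Θ B B'
      (γ ;; splitCtx D Θ (bangify Δ) [(x, A)] ;; (discCtx D Θ Δ ⊠ D.runit (denTy D Θ A)) ;;
        D.lunit (denTy D Θ A) ;; s)
      (γ' ;; splitCtx D Θ (bangify Δ') [(x, A')] ;; (discCtx D Θ Δ' ⊠ D.runit (denTy D Θ A')) ;;
        D.lunit (denTy D Θ A') ;; s') := by
  have spl {Δ : CtxL} {A : Ty} (hx : x ∉ names Δ) : Spl Θ (names (bangify Δ)) [x]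
      (bangify Δ ++ [(x, A)]) (bangify Δ) [(x, A)] (splitCtx D Θ (bangify Δ) [(x, A)]) := by
    rw [← names_bangify] at hx
    refine spl_splitCtx (fun y hy e => hx ?_) fun y hy e => hx ?_
    · exact (show y = x from List.mem_singleton.1 e) ▸ hy
    · exact (show y = x from List.mem_singleton.1 hy) ▸ e
  obtain ⟨Xa, Xb, g, γa, γb, γa', γb', ha, hb, e, e'⟩ := h.split (spl hx) (spl hx')
    (by simp [names_append]) (by simp [names_append, names_cons]) (by simp [names_append])
    (by simp [names_append, names_cons])
    (fun p hp hb => (hb (isBang_of_mem_bangify hp)).elim) (by simp)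
  have hd : γa ;; discCtx D Θ Δ = γa' ;; discCtx D Θ Δ' :=
    (ha.isCo (.inl fun p hp => isBang_of_mem_bangify hp)).unit_unique _ _
  have hr := (hs.rel hs' hb.singleton).pre
    (g ;; ((γa ;; discCtx D Θ Δ) ⊠ D.id Xb) ;; D.lunit Xb)
  rw [← tmap_lunit_comp] at hr
  have step {Γ : CtxL} {γ : D.Hom X (denCtx D Θ Γ)} {P Q B C : D.Obj}
      {f : D.Hom (denCtx D Θ Γ) (D.tens P Q)} {γa : D.Hom Xa P} {γb : D.Hom Xb Q}
      (e : γ ;; f = g ;; (γa ⊠ γb)) (d : D.Hom P D.unit) (r : D.Hom Q B) (k : D.Hom (D.tens D.unit B) C) :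
      γ ;; f ;; (d ⊠ r) ;; k = g ;; ((γa ;; d) ⊠ (γb ;; r)) ;; k := by
    rw [comp_congr_assoc e, tmap_comp_tmap_assoc]
  refine (congrArg₂ (Rel Θ B B') (step e (discCtx D Θ Δ) (D.runit (denTy D Θ A)) _)
    (step e' (discCtx D Θ Δ') (D.runit (denTy D Θ A')) _)).mpr ?_
  rw [← hd]
  refine (congrArg (Rel Θ B B' _) ?_).mp hr
  exact (tmap_lunit_comp ..).symm

end Variable

end QLamSem

namespace QLamSem

section Environments

local notation:80 f:81 ";;" g:80 => LCDData.comp _ f g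
local notation:90 f:91 "⊠" g:90 => LCDData.tmap _ f g

variable {D : LCDData} {Θ : ℕ → D.Obj}

variable (Θ) in
/-- Related substitutions for two contexts, each variable being relevant in both. -/
def Env (X : D.Obj) (Γ Γ' : CtxL) (γ : D.Hom X (denCtx D Θ Γ)) (γ' : D.Hom X (denCtx D Θ Γ')) :
    Prop :=
  WdP Θ (names Γ) (names Γ') X Γ Γ' γ γ'

theorem Perm.mem_names {Γ Γ' : CtxL} {f : D.Hom (denCtx D Θ Γ) (denCtx D Θ Γ')}
    (h : Perm Θ Γ Γ' f) {x : ℕ} : x ∈ names Γ ↔ x ∈ names Γ' := by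
  simp only [names, List.mem_map, h.mem_iff]

variable [LC D]

theorem Env.perm {X : D.Obj} {Γ Γ' Γ₁ Γ₁' : CtxL} {γ : D.Hom X (denCtx D Θ Γ)}
    {γ' : D.Hom X (denCtx D Θ Γ')} (h : Env Θ X Γ Γ' γ γ')
    {p : D.Hom (denCtx D Θ Γ) (denCtx D Θ Γ₁)} {p' : D.Hom (denCtx D Θ Γ') (denCtx D Θ Γ₁')}
    (hp : Perm Θ Γ Γ₁ p) (hp' : Perm Θ Γ' Γ₁' p') : Env Θ X Γ₁ Γ₁' (γ ;; p) (γ' ;; p') :=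
  (WdP.perm h hp hp').mono (fun _ _ h => hp'.mem_names.2 h) fun _ _ h => hp.mem_names.2 h

/-- Extending related substitutions by related arguments. -/
theorem Env.ext {X Y : D.Obj} {Γ Γ' : CtxL} {γ : D.Hom X (denCtx D Θ Γ)}
    {γ' : D.Hom X (denCtx D Θ Γ')} (h : Env Θ X Γ Γ' γ γ') {x : ℕ} (hx : x ∉ names Γ)
    (hx' : x ∉ names Γ') {A A' : Ty} {a : D.Hom Y (denTy D Θ A)} {a' : D.Hom Y (denTy D Θ A')}
    (ha : Rel Θ A A' a a') :
    ∃ (Z : D.Obj) (f : D.Hom (D.tens X Y) Z) (δ : D.Hom Z (denCtx D Θ (Γ ++ [(x, A)])))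
      (δ' : D.Hom Z (denCtx D Θ (Γ' ++ [(x, A')]))), Env Θ Z _ _ δ δ' ∧
      (γ ⊠ a) ;; extHom D Θ Γ x A = f ;; δ ∧ (γ' ⊠ a') ;; extHom D Θ Γ' x A' = f ;; δ' := by
  obtain ⟨W, u, w, w', hco, hw, rfl, rfl⟩ := ha
  have e {G A H : D.Obj} (γ : D.Hom X G) (w : D.Hom W A) (k : D.Hom (D.tens G A) H) :
      (γ ⊠ (u ;; w)) ;; k = ((D.id X ⊠ u) ;; D.symm X W) ;; (w ⊠ γ) ;; D.symm A G ;; k := by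
    rw [comp_congr_assoc (symm_natural' w γ), comp_assoc', ← comp_assoc' (D.symm X W),
      symm_symm', id_comp', tmap_comp_tmap_assoc, id_comp']
  exact ⟨_, _, _, _, (WdP.cons h hx hx' hco hw).perm (perm_extHom ..) (perm_extHom ..) |>.mono
    (fun _ _ h => (perm_extHom (Θ := Θ) ..).mem_names.2 h)
    (fun _ _ h => (perm_extHom (Θ := Θ) ..).mem_names.2 h), e .., e ..⟩

theorem Env.ext2 {X Y Y₂ : D.Obj} {Γ Γ' : CtxL} {γ : D.Hom X (denCtx D Θ Γ)}
    {γ' : D.Hom X (denCtx D Θ Γ')} (h : Env Θ X Γ Γ' γ γ') {x y : ℕ} (hxy : x ≠ y)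
    (hx : x ∉ names Γ) (hx' : x ∉ names Γ') (hy : y ∉ names Γ) (hy' : y ∉ names Γ')
    {A A' B B' : Ty} {a : D.Hom Y (denTy D Θ A)} {a' : D.Hom Y (denTy D Θ A')}
    (ha : Rel Θ A A' a a') {b : D.Hom Y₂ (denTy D Θ B)} {b' : D.Hom Y₂ (denTy D Θ B')}
    (hb : Rel Θ B B' b b') :
    ∃ (Z : D.Obj) (f : D.Hom (D.tens X (D.tens Y Y₂)) Z)
      (δ : D.Hom Z (denCtx D Θ (Γ ++ [(x, A), (y, B)])))
      (δ' : D.Hom Z (denCtx D Θ (Γ' ++ [(x, A'), (y, B')]))), Env Θ Z _ _ δ δ' ∧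
      (γ ⊠ (a ⊠ b)) ;; ext2Hom D Θ Γ x A y B = f ;; δ ∧
      (γ' ⊠ (a' ⊠ b')) ;; ext2Hom D Θ Γ' x A' y B' = f ;; δ' := by
  obtain ⟨W, u, w, w', hco, hw, rfl, rfl⟩ := ha
  obtain ⟨W₂, t, z, z', hco₂, hz, rfl, rfl⟩ := hb
  have e {G A B H : D.Obj} (γ : D.Hom X G) (w : D.Hom W A) (z : D.Hom W₂ B)
      (k : D.Hom (D.tens G (D.tens A B)) H) :
      (γ ⊠ ((u ;; w) ⊠ (t ;; z))) ;; k =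
        ((D.id X ⊠ (u ⊠ t)) ;; D.symm X (D.tens W W₂) ;; D.assoc W W₂ X) ;;
          (w ⊠ (z ⊠ γ)) ;; D.assocInv A B G ;; D.symm (D.tens A B) G ;; k := by
    rw [comp_congr_assoc (assocInv_natural w z γ), comp_congr_assoc (symm_natural' (w ⊠ z) γ)]
    simp only [comp_assoc']
    rw [← comp_assoc' (D.assoc W W₂ X), assoc_assocInv, id_comp',
      ← comp_assoc' (D.symm X _), symm_symm', id_comp', tmap_comp_tmap_assoc, id_comp',
      tmap_comp_tmap]
  have hx₂ {Γ : CtxL} {B : Ty} (hx : x ∉ names Γ) : x ∉ names ((y, B) :: Γ) := by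
    simpa [names_cons] using ⟨hxy, hx⟩
  exact ⟨_, _, _, _, ((WdP.cons h hy hy' hco₂ hz).cons (hx₂ hx) (hx₂ hx') hco hw).perm
    (perm_ext2Hom ..) (perm_ext2Hom ..) |>.mono
    (fun _ _ h => (perm_ext2Hom (Θ := Θ) ..).mem_names.2 h)
    (fun _ _ h => (perm_ext2Hom (Θ := Θ) ..).mem_names.2 h), e .., e ..⟩

theorem Env.split {X : D.Obj} {Δ Γ₁ Γ₂ Δ' Γ₁' Γ₂' : CtxL}
    {γ : D.Hom X (denCtx D Θ (bangify Δ ++ Γ₁ ++ Γ₂))}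
    {γ' : D.Hom X (denCtx D Θ (bangify Δ' ++ Γ₁' ++ Γ₂'))} (h : Env Θ X _ _ γ γ')
    (hn : (names (bangify Δ ++ Γ₁ ++ Γ₂)).Nodup) (hn' : (names (bangify Δ' ++ Γ₁' ++ Γ₂')).Nodup)
    (h₁ : ∀ p ∈ bangify Δ ++ Γ₁, ¬ IsBang p.2 → p.1 ∈ names (bangify Δ' ++ Γ₁'))
    (h₂ : ∀ p ∈ bangify Δ ++ Γ₂, ¬ IsBang p.2 → p.1 ∈ names (bangify Δ' ++ Γ₂')) :
    ∃ (Xa Xb : D.Obj) (g : D.Hom X (D.tens Xa Xb)) (γa : D.Hom Xa (denCtx D Θ (bangify Δ ++ Γ₁)))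
      (γb : D.Hom Xb (denCtx D Θ (bangify Δ ++ Γ₂)))
      (γa' : D.Hom Xa (denCtx D Θ (bangify Δ' ++ Γ₁')))
      (γb' : D.Hom Xb (denCtx D Θ (bangify Δ' ++ Γ₂'))),
      Env Θ Xa _ _ γa γa' ∧ Env Θ Xb _ _ γb γb' ∧ γ ;; splitDup D Θ Δ Γ₁ Γ₂ = g ;; (γa ⊠ γb) ∧
        γ' ;; splitDup D Θ Δ' Γ₁' Γ₂' = g ;; (γa' ⊠ γb') := by
  refine WdP.split h (spl_splitDup hn) (spl_splitDup hn') ?_ ?_ ?_ ?_ h₁ h₂ <;>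
  · intro x hx
    simp only [names_append, List.mem_append] at hx ⊢
    tauto

theorem comp_tmap_glue {X Xa Xb G P Q A B C : D.Obj} {γ : D.Hom X G} {f : D.Hom G (D.tens P Q)}
    {g : D.Hom X (D.tens Xa Xb)} {γa : D.Hom Xa P} {γb : D.Hom Xb Q}
    (e : γ ;; f = g ;; (γa ⊠ γb)) (h : D.Hom P A) (k : D.Hom Q B) (r : D.Hom (D.tens A B) C) :
    γ ;; f ;; (h ⊠ k) ;; r = g ;; ((γa ;; h) ⊠ (γb ;; k)) ;; r := by
  rw [comp_congr_assoc e, tmap_comp_tmap_assoc]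

end Environments

section Pairs

local notation:80 f:81 ";;" g:80 => LCDData.comp _ f g
local notation:90 f:91 "⊠" g:90 => LCDData.tmap _ f g

variable {D : LCDData} {Θ : ℕ → D.Obj}

theorem castHom_comp_castHom {A A' B B' : D.Obj} (h₁ : A = A') (h₂ : B = B') {f : D.Hom A B}
    {g : D.Hom B A} (e : f ;; g = D.id A) :
    D.castHom h₁ h₂ f ;; D.castHom h₂ h₁ g = D.id A' := by
  subst h₁ h₂
  exact e

variable [LC D]

theorem tmap_eqHom {A A' B B' : D.Obj} (h : A = A') (h' : B = B') :
    (eqHom D h ⊠ eqHom D h') = eqHom D (congrArg₂ D.tens h h') := by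
  subst h h'
  exact tmap_id' ..

theorem m2n_collapseL (n : ℕ) (X Y : D.Obj) :
    m2n D n X Y ;; collapseL D n (D.tens X Y) = collapseL D n X ⊠ collapseL D n Y := by
  induction n with
  | zero => exact (id_comp' _).trans (tmap_id' ..).symm
  | succ n ih =>
    refine (comp_assoc' ..).trans ?_
    refine (congrArg (_ ;; ·) (comp_congr_assoc (Lmap_eps_comm (m2n D n X Y)) _)).trans ?_
    rw [ih]
    refine (comp_eq_assoc (m2_eps ..) _).trans ?_
    exact tmap_comp_tmap ..

theorem m2n_m2nInv (n : ℕ) (X Y : D.Obj) : m2n D n X Y ;; m2nInv D n X Y = D.id _ := by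
  induction n with
  | zero => exact id_comp' _
  | succ n ih =>
    refine (comp_assoc' ..).trans ?_
    refine (congrArg (_ ;; ·) (comp_eq_assoc ((Lmap_comp' ..).symm.trans
      ((congrArg D.Lmap ih).trans (Lmap_id' _))) _)).trans ?_
    refine (congrArg (_ ;; ·) (id_comp' _)).trans ?_
    exact m2_m2Inv ..

theorem castHom_comp_eqHom {A A' B B' C : D.Obj} (h₁ : A = A') (h₂ : B = B') (f : D.Hom A B)
    (c : D.Hom B C) :
    D.castHom h₁ h₂ f ;; eqHom D h₂.symm ;; c = eqHom D h₁.symm ;; f ;; c := by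
  subst h₁ h₂
  simp [LCDData.castHom, eqHom_self]

theorem m2nD_col (n : ℕ) (A B : Ty) :
    m2nD D Θ n A B ;; col n (.tensor A B) = col n A ⊠ col n B := by
  refine (congrArg (m2nD D Θ n A B ;; ·) (col_eq n (.tensor A B))).trans
    ((castHom_comp_eqHom _ (denTy_bangN D Θ n (.tensor A B)).symm _ _).trans ?_)
  refine (congrArg (_ ;; ·) (m2n_collapseL n (denTy D Θ A) (denTy D Θ B))).trans ?_
  rw [col_eq, col_eq, ← tmap_comp_tmap, tmap_eqHom]

theorem m2nD_m2nDInv (n : ℕ) (A B : Ty) : m2nD D Θ n A B ;; m2nDInv D Θ n A B = D.id _ :=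
  castHom_comp_castHom _ (denTy_bangN D Θ n (.tensor A B)).symm (m2n_m2nInv ..)

end Pairs

end QLamSem

namespace QLamSem

section Constructs

local notation:80 f:81 ";;" g:80 => LCDData.comp _ f g
local notation:90 f:91 "⊠" g:90 => LCDData.tmap _ f g

variable {D : LCDData} {Θ : ℕ → D.Obj}

theorem isBang_bangN {n : ℕ} (hn : 1 ≤ n) (A : Ty) : IsBang (bangN n A) := by
  obtain ⟨n, rfl⟩ : ∃ k, n = k + 1 := ⟨n - 1, by omega⟩
  trivial

theorem IsBang.bangN {n : ℕ} {A : Ty} (h : IsBang A) : IsBang (bangN n A) := by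
  cases n with
  | zero => exact h
  | succ n => trivial

variable [LC D]

theorem exists_col {X : D.Obj} (hX : IsCo D X) (n : ℕ) {A : Ty} (f : D.Hom X (denTy D Θ A)) :
    ∃ g : D.Hom X (denTy D Θ (bangN n A)), g ;; col n A = f := by
  induction n with
  | zero => exact ⟨f, comp_id' f⟩
  | succ n ih =>
    obtain ⟨g, hg⟩ := ih
    obtain ⟨c, hc⟩ := hX
    refine ⟨c ;; D.Lmap g, (comp_assoc' ..).trans ?_⟩
    refine (congrArg (c ;; ·) (comp_congr_assoc (Lmap_eps_comm g) _)).trans ?_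
    exact (comp_eq_assoc hc _).trans ((id_comp' _).trans hg)

theorem Rel.pair {n n' : ℕ} {A₁ A₂ A₁' A₂' : Ty} {X Y : D.Obj}
    {v : D.Hom X (denTy D Θ (bangN n A₁))} {v' : D.Hom X (denTy D Θ (bangN n' A₁'))}
    {w : D.Hom Y (denTy D Θ (bangN n A₂))} {w' : D.Hom Y (denTy D Θ (bangN n' A₂'))}
    (hv : Rel Θ (bangN n A₁) (bangN n' A₁') v v') (hw : Rel Θ (bangN n A₂) (bangN n' A₂') w w') :
    Rel Θ (bangN n (.tensor A₁ A₂)) (bangN n' (.tensor A₁' A₂'))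
      ((v ⊠ w) ;; m2nD D Θ n A₁ A₂) ((v' ⊠ w') ;; m2nD D Θ n' A₁' A₂') := by
  obtain ⟨P, u, p, p', hP, hp, rfl, rfl⟩ := hv
  obtain ⟨Q, t, q, q', hQ, hq, rfl, rfl⟩ := hw
  have hb {n : ℕ} {A B : Ty} (h : IsBang (bangN n (.tensor A B))) : 1 ≤ n := by
    cases n with
    | zero => exact h.elim
    | succ n => omega
  have hco : IsBang (bangN n (.tensor A₁ A₂)) ∨ IsBang (bangN n' (.tensor A₁' A₂')) →
      (IsBang (bangN n A₁) ∨ IsBang (bangN n' A₁')) ∧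
        (IsBang (bangN n A₂) ∨ IsBang (bangN n' A₂')) := by
    rintro (h | h)
    · exact ⟨.inl (isBang_bangN (hb h) _), .inl (isBang_bangN (hb h) _)⟩
    · exact ⟨.inr (isBang_bangN (hb h) _), .inr (isBang_bangN (hb h) _)⟩
  have e {n : ℕ} {A₁ A₂ : Ty} (p : D.Hom P (denTy D Θ (bangN n A₁)))
      (q : D.Hom Q (denTy D Θ (bangN n A₂))) :
      ((p ⊠ q) ;; m2nD D Θ n A₁ A₂) ;; col n (.tensor A₁ A₂) =
        D.id _ ;; ((p ;; col n A₁) ⊠ (q ;; col n A₂)) :=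
    (comp_assoc' ..).trans <| (congrArg ((p ⊠ q) ;; ·) (m2nD_col n A₁ A₂)).trans <|
      (tmap_comp_tmap ..).trans (id_comp' _).symm
  refine ⟨D.tens P Q, u ⊠ t, (p ⊠ q) ;; m2nD D Θ n A₁ A₂, (p' ⊠ q') ;; m2nD D Θ n' A₁' A₂',
    fun h => (hP (hco h).1).tens (hQ (hco h).2), core_bangN.2 (core_tensor.2
      ⟨P, Q, D.id _, _, _, _, _, (core_bangN.1 hp).rel fun h => hP (h.imp IsBang.bangN IsBang.bangN),
        (core_bangN.1 hq).rel fun h => hQ (h.imp IsBang.bangN IsBang.bangN), e p q, e p' q'⟩), (tmap_comp_tmap_assoc ..).symm,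
      (tmap_comp_tmap_assoc ..).symm⟩

theorem Rel.unpair {n n' : ℕ} {A₁ A₂ A₁' A₂' : Ty} {X : D.Obj}
    {a : D.Hom X (denTy D Θ (bangN n (.tensor A₁ A₂)))}
    {a' : D.Hom X (denTy D Θ (bangN n' (.tensor A₁' A₂')))}
    (h : Rel Θ (bangN n (.tensor A₁ A₂)) (bangN n' (.tensor A₁' A₂')) a a') :
    ∃ (P Q : D.Obj) (u : D.Hom X (D.tens P Q)) (p : D.Hom P (denTy D Θ (bangN n A₁)))
      (p' : D.Hom P (denTy D Θ (bangN n' A₁'))) (q : D.Hom Q (denTy D Θ (bangN n A₂)))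
      (q' : D.Hom Q (denTy D Θ (bangN n' A₂'))), Rel Θ (bangN n A₁) (bangN n' A₁') p p' ∧
      Rel Θ (bangN n A₂) (bangN n' A₂') q q' ∧ a ;; m2nDInv D Θ n A₁ A₂ = u ;; (p ⊠ q) ∧
      a' ;; m2nDInv D Θ n' A₁' A₂' = u ;; (p' ⊠ q') := by
  obtain ⟨Y, s, w, w', hco, hw, rfl, rfl⟩ := h
  obtain ⟨P, Q, u, p, p', q, q', hp, hq, e, e'⟩ := core_tensor.1 (core_bangN.1 hw)
  by_cases hn : n = 0 ∧ n' = 0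
  · obtain ⟨rfl, rfl⟩ := hn
    have e₀ {A₁ A₂ : Ty} {w : D.Hom Y (D.tens (denTy D Θ A₁) (denTy D Θ A₂))} {f}
        (h : w ;; D.id _ = f) : (s ;; w) ;; D.id _ = s ;; f := (comp_assoc' ..).trans (by rw [h])
    exact ⟨P, Q, s ;; u, p, p', q, q', hp, hq, (e₀ e).trans (comp_assoc' ..).symm,
      (e₀ e').trans (comp_assoc' ..).symm⟩
  · have hY : IsCo D Y := hco (by
      rcases Nat.eq_zero_or_pos n with h0 | h0
      · exact .inr (isBang_bangN (by omega) _)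
      · exact .inl (isBang_bangN h0 _))
    obtain ⟨c, hc⟩ := hY
    have lift (m : ℕ) {P : D.Obj} {A : Ty} (p : D.Hom P (denTy D Θ A)) :=
      exists_col (isCo_L P) m (D.eps P ;; p)
    obtain ⟨f, hf⟩ := lift n p
    obtain ⟨f', hf'⟩ := lift n' p'
    obtain ⟨g, hg⟩ := lift n q
    obtain ⟨g', hg'⟩ := lift n' q'
    have eps {R : D.Obj} (k : D.Hom (D.tens P Q) R) :
        c ;; D.Lmap u ;; D.m2Inv P Q ;; (D.eps P ⊠ D.eps Q) ;; k = u ;; k := by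
      rw [comp_eq_assoc (m2Inv_eps ..), comp_congr_assoc (Lmap_eps_comm u), comp_eq_assoc hc,
        id_comp']
    have key {n : ℕ} {A₁ A₂ : Ty} {w : D.Hom Y (denTy D Θ (bangN n (.tensor A₁ A₂)))}
        {p : D.Hom P (denTy D Θ A₁)} {q : D.Hom Q (denTy D Θ A₂)}
        {f : D.Hom (D.L P) (denTy D Θ (bangN n A₁))} {g : D.Hom (D.L Q) (denTy D Θ (bangN n A₂))}
        (e : w ;; col n (.tensor A₁ A₂) = u ;; (p ⊠ q)) (hf : f ;; col n A₁ = D.eps P ;; p)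
        (hg : g ;; col n A₂ = D.eps Q ;; q) :
        (s ;; w) ;; m2nDInv D Θ n A₁ A₂ = (s ;; c ;; D.Lmap u ;; D.m2Inv P Q) ;; (f ⊠ g) := by
      have hw : w = (c ;; D.Lmap u ;; D.m2Inv P Q ;; (f ⊠ g)) ;; m2nD D Θ n A₁ A₂ := by
        refine col_ext ⟨c, hc⟩ (e.trans ?_)
        simp only [comp_assoc']
        have hm := (congrArg ((f ⊠ g) ;; ·) (m2nD_col n A₁ A₂)).trans ((tmap_comp_tmap ..).trans
          ((congrArg₂ _ hf hg).trans (tmap_comp_tmap ..).symm))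
        refine Eq.trans ?_ (congrArg (fun k => c ;; D.Lmap u ;; D.m2Inv P Q ;; k) hm.symm)
        exact (eps _).symm
      rw [hw]
      simp only [comp_assoc']
      rw [m2nD_m2nDInv, comp_id']
    have rel {P : D.Obj} {A A' : Ty} {p : D.Hom P (denTy D Θ A)} {p' : D.Hom P (denTy D Θ A')}
        (hp : Rel Θ A A' p p') {n n' : ℕ} {f : D.Hom (D.L P) (denTy D Θ (bangN n A))}
        {f' : D.Hom (D.L P) (denTy D Θ (bangN n' A'))} (hf : f ;; col n A = D.eps P ;; p)
        (hf' : f' ;; col n' A' = D.eps P ;; p') : Rel Θ (bangN n A) (bangN n' A') f f' :=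
      Core.rel (core_bangN.2 ((congrArg₂ (Core Θ A A') hf hf').mpr (hp.pre _).core))
        fun _ => isCo_L P
    exact ⟨_, _, _, f, f', g, g', rel hp hf hf', rel hq hg hg', key e hf hg, key e' hf' hg'⟩

theorem RelT.app {A A' B B' : Ty} {X Y : D.Obj} {c : D.Hom X (D.T (denTy D Θ (.arrow A B)))}
    {c' : D.Hom X (D.T (denTy D Θ (.arrow A' B')))} {d : D.Hom Y (D.T (denTy D Θ A))}
    {d' : D.Hom Y (D.T (denTy D Θ A'))} (hc : RelT Θ (.arrow A B) (.arrow A' B') c c')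
    (hd : RelT Θ A A' d d') :
    RelT Θ B B'
      ((c ⊠ d) ;; D.Psi1 (denTy D Θ (.arrow A B)) (denTy D Θ A) ;;
        D.klift (D.appnt (denTy D Θ A) (denTy D Θ B)))
      ((c' ⊠ d') ;; D.Psi1 (denTy D Θ (.arrow A' B')) (denTy D Θ A') ;;
        D.klift (D.appnt (denTy D Θ A') (denTy D Θ B'))) := by
  obtain ⟨Z, u, v, v', hv, rfl, rfl⟩ := hc
  obtain ⟨W, t, w, w', hw, rfl, rfl⟩ := hd
  have e {P Q R : D.Obj} (v : D.Hom Z P) (w : D.Hom W Q) (k : D.Hom (D.tens P Q) (D.T R)) :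
      ((u ;; D.Tmap v) ⊠ (t ;; D.Tmap w)) ;; D.Psi1 P Q ;; D.klift k =
        ((u ⊠ t) ;; D.Psi1 Z W) ;; D.klift ((v ⊠ w) ;; k) := by
    rw [← tmap_comp_tmap_assoc, comp_congr_assoc (Psi1_natural v w), Tmap_klift, comp_assoc']
  have := RelT.bind ((u ⊠ t) ;; D.Psi1 Z W) (core_arrow.1 hv.core W w w' hw)
  exact (congrArg₂ (RelT Θ B B') (e ..) (e ..)).mpr this

theorem RelT.pair {n n' : ℕ} {A₁ A₂ A₁' A₂' : Ty} {X Y : D.Obj}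
    {c : D.Hom X (D.T (denTy D Θ (bangN n A₁)))} {c' : D.Hom X (D.T (denTy D Θ (bangN n' A₁')))}
    {d : D.Hom Y (D.T (denTy D Θ (bangN n A₂)))} {d' : D.Hom Y (D.T (denTy D Θ (bangN n' A₂')))}
    (hc : RelT Θ (bangN n A₁) (bangN n' A₁') c c')
    (hd : RelT Θ (bangN n A₂) (bangN n' A₂') d d') :
    RelT Θ (bangN n (.tensor A₁ A₂)) (bangN n' (.tensor A₁' A₂'))
      ((c ⊠ d) ;; D.Psi1 _ _ ;; D.Tmap (m2nD D Θ n A₁ A₂))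
      ((c' ⊠ d') ;; D.Psi1 _ _ ;; D.Tmap (m2nD D Θ n' A₁' A₂')) := by
  obtain ⟨Z, u, v, v', hv, rfl, rfl⟩ := hc
  obtain ⟨W, t, w, w', hw, rfl, rfl⟩ := hd
  have e {P Q R : D.Obj} (v : D.Hom Z P) (w : D.Hom W Q) (k : D.Hom (D.tens P Q) R) :
      ((u ;; D.Tmap v) ⊠ (t ;; D.Tmap w)) ;; D.Psi1 P Q ;; D.Tmap k =
        ((u ⊠ t) ;; D.Psi1 Z W) ;; D.Tmap ((v ⊠ w) ;; k) := by
    rw [← tmap_comp_tmap_assoc, comp_congr_assoc (Psi1_natural v w), ← Tmap_comp', comp_assoc']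
  exact ⟨_, _, _, _, hv.pair hw, e .., e ..⟩

theorem RelT.let {A A' B B' : Ty} {X Y P P' H H' : D.Obj} {c : D.Hom X (D.T (denTy D Θ A))}
    {c' : D.Hom X (D.T (denTy D Θ A'))} (hc : RelT Θ A A' c c') {b : D.Hom Y P} {b' : D.Hom Y P'}
    {h : D.Hom (D.tens P (denTy D Θ A)) H} {h' : D.Hom (D.tens P' (denTy D Θ A')) H'}
    {k : D.Hom H (D.T (denTy D Θ B))} {k' : D.Hom H' (D.T (denTy D Θ B'))}
    (hk : ∀ {Z : D.Obj} (v : D.Hom Z (denTy D Θ A)) (v' : D.Hom Z (denTy D Θ A')),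
      Rel Θ A A' v v' → RelT Θ B B' ((b ⊠ v) ;; h ;; k) ((b' ⊠ v') ;; h' ;; k')) :
    RelT Θ B B' ((c ⊠ b) ;; D.symm _ _ ;; D.str P (denTy D Θ A) ;; D.Tmap h ;; D.klift k)
      ((c' ⊠ b') ;; D.symm _ _ ;; D.str P' (denTy D Θ A') ;; D.Tmap h' ;; D.klift k') := by
  obtain ⟨Z, u, v, v', hv, rfl, rfl⟩ := hc
  have e {P A H R : D.Obj} (b : D.Hom Y P) (v : D.Hom Z A) (h : D.Hom (D.tens P A) H)
      (k : D.Hom H (D.T R)) :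
      ((u ;; D.Tmap v) ⊠ b) ;; D.symm _ _ ;; D.str P A ;; D.Tmap h ;; D.klift k =
        ((u ⊠ D.id Y) ;; D.symm _ _ ;; D.str Y Z) ;; D.klift ((b ⊠ v) ;; h ;; k) := by
    simp only [comp_assoc', ← Tmap_klift]
    rw [← comp_congr_assoc (str_natural' b v), ← comp_congr_assoc (symm_natural' (D.Tmap v) b),
      tmap_comp_tmap_assoc, id_comp']
  exact (congrArg₂ (RelT Θ B B') (e ..) (e ..)).mpr (RelT.bind _ (hk v v' hv))

theorem tmap_symm_comp {X Y P A H R : D.Obj} (v : D.Hom X A) (b : D.Hom Y P)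
    (h : D.Hom (D.tens P A) H) (k : D.Hom H R) :
    (v ⊠ b) ;; D.symm A P ;; h ;; k = D.symm X Y ;; (b ⊠ v) ;; h ;; k :=
  comp_congr_assoc (symm_natural' v b) _

end Constructs

end QLamSem

namespace QLamSem

section Fundamental

local notation:80 f:81 ";;" g:80 => LCDData.comp _ f g
local notation:90 f:91 "⊠" g:90 => LCDData.tmap _ f g

variable {D : LCDData} {Θ : ℕ → D.Obj}

variable (Θ) in
/-- Related substitutions are sent to related values. -/
def FundV (Γ Γ' : CtxL) (A A' : Ty) (v : D.Hom (denCtx D Θ Γ) (denTy D Θ A))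
    (v' : D.Hom (denCtx D Θ Γ') (denTy D Θ A')) : Prop :=
  ∀ ⦃X : D.Obj⦄ (γ : D.Hom X (denCtx D Θ Γ)) (γ' : D.Hom X (denCtx D Θ Γ')),
    Env Θ X Γ Γ' γ γ' → Rel Θ A A' (γ ;; v) (γ' ;; v')

variable (Θ) in
/-- Related substitutions are sent to related computations. -/
def FundC (Γ Γ' : CtxL) (A A' : Ty) (c : D.Hom (denCtx D Θ Γ) (D.T (denTy D Θ A)))
    (c' : D.Hom (denCtx D Θ Γ') (D.T (denTy D Θ A'))) : Prop :=
  ∀ ⦃X : D.Obj⦄ (γ : D.Hom X (denCtx D Θ Γ)) (γ' : D.Hom X (denCtx D Θ Γ')),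
    Env Θ X Γ Γ' γ γ' → RelT Θ A A' (γ ;; c) (γ' ;; c')

/-- Every linear variable of the first context occurs in the second one. -/
def LinearIn (Γ Γ' : CtxL) : Prop := ∀ p ∈ Γ, ¬ IsBang p.2 → p.1 ∈ names Γ'

variable [LC D]

theorem FundV.eta {Γ Γ' : CtxL} {A A' : Ty} {v : D.Hom (denCtx D Θ Γ) (denTy D Θ A)}
    {v' : D.Hom (denCtx D Θ Γ') (denTy D Θ A')} (h : FundV Θ Γ Γ' A A' v v') :
    FundC Θ Γ Γ' A A' (v ;; D.eta _) (v' ;; D.eta _) := fun _ γ γ' hγ =>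
  (congrArg₂ (RelT Θ A A') (comp_assoc' γ v _) (comp_assoc' γ' v' _)).mp (h γ γ' hγ).eta

/-! Binding a variable. -/

section Binding

variable {X Y : D.Obj} {Γ Γ' : CtxL} {γ : D.Hom X (denCtx D Θ Γ)} {γ' : D.Hom X (denCtx D Θ Γ')}
  {x : ℕ} {A A' B B' : Ty} {a : D.Hom Y (denTy D Θ A)} {a' : D.Hom Y (denTy D Θ A')}

theorem FundC.ext {k : D.Hom (denCtx D Θ (Γ ++ [(x, A)])) (D.T (denTy D Θ B))}
    {k' : D.Hom (denCtx D Θ (Γ' ++ [(x, A')])) (D.T (denTy D Θ B'))}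
    (hk : FundC Θ (Γ ++ [(x, A)]) (Γ' ++ [(x, A')]) B B' k k') (hγ : Env Θ X Γ Γ' γ γ')
    (hx : x ∉ names Γ) (hx' : x ∉ names Γ') (ha : Rel Θ A A' a a') :
    RelT Θ B B' ((γ ⊠ a) ;; extHom D Θ Γ x A ;; k) ((γ' ⊠ a') ;; extHom D Θ Γ' x A' ;; k') := by
  obtain ⟨Z, f, δ, δ', hδ, e, e'⟩ := hγ.ext hx hx' ha
  exact (congrArg₂ (RelT Θ B B') (comp_congr_assoc e k) (comp_congr_assoc e' k')).mpr
    ((hk δ δ' hδ).pre f)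

theorem FundV.ext {k : D.Hom (denCtx D Θ (Γ ++ [(x, A)])) (denTy D Θ B)}
    {k' : D.Hom (denCtx D Θ (Γ' ++ [(x, A')])) (denTy D Θ B')}
    (hk : FundV Θ (Γ ++ [(x, A)]) (Γ' ++ [(x, A')]) B B' k k') (hγ : Env Θ X Γ Γ' γ γ')
    (hx : x ∉ names Γ) (hx' : x ∉ names Γ') (ha : Rel Θ A A' a a') :
    Rel Θ B B' ((γ ⊠ a) ;; extHom D Θ Γ x A ;; k) ((γ' ⊠ a') ;; extHom D Θ Γ' x A' ;; k') := by
  obtain ⟨Z, f, δ, δ', hδ, e, e'⟩ := hγ.ext hx hx' ha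
  exact (congrArg₂ (Rel Θ B B') (comp_congr_assoc e k) (comp_congr_assoc e' k')).mpr
    ((hk δ δ' hδ).pre f)

end Binding

section PairBinding

variable (Θ) in
/-- The morphism extending a substitution by both components of a pair. -/
def extPair (Γ : CtxL) (n x : ℕ) (A : Ty) (y : ℕ) (B : Ty) :
    D.Hom (D.tens (denCtx D Θ Γ) (denTy D Θ (bangN n (.tensor A B))))
      (denCtx D Θ (Γ ++ [(x, bangN n A), (y, bangN n B)])) :=
  (D.id _ ⊠ m2nDInv D Θ n A B) ;; ext2Hom D Θ Γ x (bangN n A) y (bangN n B)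

variable {X Y : D.Obj} {Γ Γ' : CtxL} {γ : D.Hom X (denCtx D Θ Γ)} {γ' : D.Hom X (denCtx D Θ Γ')}
  {x y n n' : ℕ} {A A' B B' C C' : Ty} {a : D.Hom Y (denTy D Θ (bangN n (.tensor A B)))}
  {a' : D.Hom Y (denTy D Θ (bangN n' (.tensor A' B')))}

theorem Env.extPair (hγ : Env Θ X Γ Γ' γ γ') (hxy : x ≠ y) (hx : x ∉ names Γ) (hx' : x ∉ names Γ')
    (hy : y ∉ names Γ) (hy' : y ∉ names Γ')
    (ha : Rel Θ (bangN n (.tensor A B)) (bangN n' (.tensor A' B')) a a') :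
    ∃ (Z : D.Obj) (f : D.Hom (D.tens X Y) Z)
      (δ : D.Hom Z (denCtx D Θ (Γ ++ [(x, bangN n A), (y, bangN n B)])))
      (δ' : D.Hom Z (denCtx D Θ (Γ' ++ [(x, bangN n' A'), (y, bangN n' B')]))), Env Θ Z _ _ δ δ' ∧
      (γ ⊠ a) ;; extPair Θ Γ n x A y B = f ;; δ ∧
      (γ' ⊠ a') ;; extPair Θ Γ' n' x A' y B' = f ;; δ' := by
  obtain ⟨P, Q, u, p, p', q, q', hp, hq, e, e'⟩ := ha.unpair
  obtain ⟨Z, f, δ, δ', hδ, h, h'⟩ := hγ.ext2 hxy hx hx' hy hy' hp hq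
  have key {G M P' Q' R : D.Obj} {γ : D.Hom X G} {a : D.Hom Y M} {m : D.Hom M (D.tens P' Q')}
      {p : D.Hom P P'} {q : D.Hom Q Q'} {r : D.Hom (D.tens G (D.tens P' Q')) R} {δ : D.Hom Z R}
      (e : a ;; m = u ;; (p ⊠ q)) (h : (γ ⊠ (p ⊠ q)) ;; r = f ;; δ) :
      (γ ⊠ a) ;; (D.id G ⊠ m) ;; r = ((D.id X ⊠ u) ;; f) ;; δ := by
    rw [tmap_comp_tmap_assoc, e, comp_assoc', ← h, tmap_comp_tmap_assoc, id_comp', comp_id']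
  exact ⟨Z, _, δ, δ', hδ, key e h, key e' h'⟩

theorem FundC.extPair
    {k : D.Hom (denCtx D Θ (Γ ++ [(x, bangN n A), (y, bangN n B)])) (D.T (denTy D Θ C))}
    {k' : D.Hom (denCtx D Θ (Γ' ++ [(x, bangN n' A'), (y, bangN n' B')])) (D.T (denTy D Θ C'))}
    (hk : FundC Θ _ _ C C' k k') (hγ : Env Θ X Γ Γ' γ γ') (hxy : x ≠ y)
    (hx : x ∉ names Γ) (hx' : x ∉ names Γ') (hy : y ∉ names Γ) (hy' : y ∉ names Γ')
    (ha : Rel Θ (bangN n (.tensor A B)) (bangN n' (.tensor A' B')) a a') :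
    RelT Θ C C' ((γ ⊠ a) ;; QLamSem.extPair Θ Γ n x A y B ;; k)
      ((γ' ⊠ a') ;; QLamSem.extPair Θ Γ' n' x A' y B' ;; k') := by
  obtain ⟨Z, f, δ, δ', hδ, e, e'⟩ := hγ.extPair hxy hx hx' hy hy' ha
  exact (congrArg₂ (RelT Θ C C') (comp_congr_assoc e k) (comp_congr_assoc e' k')).mpr
    ((hk δ δ' hδ).pre f)

theorem FundV.extPair
    {k : D.Hom (denCtx D Θ (Γ ++ [(x, bangN n A), (y, bangN n B)])) (denTy D Θ C)}
    {k' : D.Hom (denCtx D Θ (Γ' ++ [(x, bangN n' A'), (y, bangN n' B')])) (denTy D Θ C')}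
    (hk : FundV Θ _ _ C C' k k') (hγ : Env Θ X Γ Γ' γ γ') (hxy : x ≠ y)
    (hx : x ∉ names Γ) (hx' : x ∉ names Γ') (hy : y ∉ names Γ) (hy' : y ∉ names Γ')
    (ha : Rel Θ (bangN n (.tensor A B)) (bangN n' (.tensor A' B')) a a') :
    Rel Θ C C' ((γ ⊠ a) ;; QLamSem.extPair Θ Γ n x A y B ;; k)
      ((γ' ⊠ a') ;; QLamSem.extPair Θ Γ' n' x A' y B' ;; k') := by
  obtain ⟨Z, f, δ, δ', hδ, e, e'⟩ := hγ.extPair hxy hx hx' hy hy' ha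
  exact (congrArg₂ (Rel Θ C C') (comp_congr_assoc e k) (comp_congr_assoc e' k')).mpr
    ((hk δ δ' hδ).pre f)

end PairBinding

/-! Values without components. -/

theorem discCtx_congr {Δ Δ' : CtxL} {X : D.Obj} {γ : D.Hom X (denCtx D Θ (bangify Δ))}
    {γ' : D.Hom X (denCtx D Θ (bangify Δ'))} (h : Env Θ X _ _ γ γ') :
    γ ;; discCtx D Θ Δ = γ' ;; discCtx D Θ Δ' :=
  (WdP.isCo h (.inl fun _ hp => isBang_of_mem_bangify hp)).unit_unique _ _

theorem fundV_cst {Δ Δ' : CtxL} {A B B' : Ty} (a : D.Hom D.unit (denTy D Θ A))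
    {s : D.Hom (denTy D Θ A) (denTy D Θ B)} {s' : D.Hom (denTy D Θ A) (denTy D Θ B')}
    (hs : IsSub Θ A B s) (hs' : IsSub Θ A B' s') :
    FundV Θ (bangify Δ) (bangify Δ') B B' (discCtx D Θ Δ ;; a ;; s) (discCtx D Θ Δ' ;; a ;; s') :=
  fun _ γ _ hγ => (congrArg₂ (Rel Θ B B') (comp_assoc' ..).symm
    ((comp_congr_assoc (discCtx_congr hγ).symm _).trans (comp_assoc' ..).symm)).mpr
    ((hs.rel hs' (rel_refl a)).pre (γ ;; discCtx D Θ Δ))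

theorem fundV_star {Δ Δ' : CtxL} (n n' : ℕ) :
    FundV Θ (bangify Δ) (bangify Δ') (bangN n .unit) (bangN n' .unit)
      (discCtx D Θ Δ ;; starMap D Θ n) (discCtx D Θ Δ' ;; starMap D Θ n') := by
  intro X γ γ' hγ
  have e : γ' ;; discCtx D Θ Δ' ;; starMap D Θ n' = (γ ;; discCtx D Θ Δ) ;; starMap D Θ n' :=
    (comp_assoc' ..).symm.trans (congrArg (· ;; _) (discCtx_congr hγ).symm)
  refine (congrArg₂ (Rel Θ _ _) (comp_assoc' ..).symm e).mpr (Rel.pre ?_ (γ ;; discCtx D Θ Δ))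
  exact Core.rel (core_bangN.2 (core_unit.2 ((starMap_col n).trans (starMap_col n').symm)))
    fun _ => isCo_unit

theorem comp_PhiInv_appnt {X Y P A B : D.Obj} (γ : D.Hom X P) (k : D.Hom (D.tens P A) (D.T B))
    (y : D.Hom Y A) : ((γ ;; D.PhiInv k) ⊠ y) ;; D.appnt A B = (γ ⊠ y) ;; k := by
  rw [tmap_appnt, Phi_comp, Phi_PhiInv, tmap_comp_tmap_assoc, id_comp', comp_id']

theorem fundV_lam {Γ Γ' : CtxL} {x n n' : ℕ} {A A' B B' : Ty}
    {k : D.Hom (denCtx D Θ (Γ ++ [(x, A)])) (D.T (denTy D Θ B))}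
    {k' : D.Hom (denCtx D Θ (Γ' ++ [(x, A')])) (D.T (denTy D Θ B'))}
    (hk : FundC Θ (Γ ++ [(x, A)]) (Γ' ++ [(x, A')]) B B' k k') (hx : x ∉ names Γ)
    (hx' : x ∉ names Γ') (hb : 1 ≤ n → ∀ p ∈ Γ, IsBang p.2) (hb' : 1 ≤ n' → ∀ p ∈ Γ', IsBang p.2)
    {v : D.Hom (denCtx D Θ Γ) (denTy D Θ (bangN n (.arrow A B)))}
    {v' : D.Hom (denCtx D Θ Γ') (denTy D Θ (bangN n' (.arrow A' B')))}
    (e : v ;; col n (.arrow A B) = D.PhiInv (extHom D Θ Γ x A ;; k))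
    (e' : v' ;; col n' (.arrow A' B') = D.PhiInv (extHom D Θ Γ' x A' ;; k')) :
    FundV Θ Γ Γ' (bangN n (.arrow A B)) (bangN n' (.arrow A' B')) v v' := by
  intro X γ γ' hγ
  have hn {n : ℕ} {A B : Ty} (h : IsBang (bangN n (.arrow A B))) : 1 ≤ n := by
    cases n with
    | zero => exact h.elim
    | succ n => omega
  refine Core.rel (core_bangN.2 (core_arrow.2 fun Y y y' hy => ?_))
    fun h => WdP.isCo hγ (h.imp (fun h => hb (hn h)) fun h => hb' (hn h))
  have key {Γ : CtxL} {n : ℕ} {A B : Ty} {v : D.Hom (denCtx D Θ Γ) (denTy D Θ (bangN n (.arrow A B)))}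
      {K} (e : v ;; col n (.arrow A B) = D.PhiInv K) (γ : D.Hom X (denCtx D Θ Γ))
      (y : D.Hom Y (denTy D Θ A)) :
      (((γ ;; v) ;; col n (.arrow A B)) ⊠ y) ;; D.appnt (denTy D Θ A) (denTy D Θ B) =
        (γ ⊠ y) ;; K :=
    (congrArg (fun f => (f ⊠ y) ;; D.appnt _ _) ((comp_assoc' ..).trans (congrArg (γ ;; ·) e))).trans
      (comp_PhiInv_appnt γ K y)
  exact (congrArg₂ (RelT Θ B B') (key e γ y) (key e' γ' y')).mpr (hk.ext hγ hx hx' hy)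

theorem promCtx_lam_col {Δ : CtxL} {n : ℕ} {A B : Ty}
    (K : D.Hom (denCtx D Θ (bangify Δ)) (denTy D Θ (.arrow A B))) :
    (promCtx D Θ Δ ;; D.Lmap K ;; D.castHom rfl (denTy_bangN D Θ (n + 1) (.arrow A B)).symm
      (padL D n (denTy D Θ (.arrow A B)))) ;; col (n + 1) (.arrow A B) = K := by
  simp only [comp_assoc']
  refine (congrArg (fun f => promCtx D Θ Δ ;; D.Lmap K ;; f) (padL_col n (.arrow A B))).trans ?_
  rw [Lmap_eps_comm, comp_eq_assoc (promCtx_eps Δ), id_comp']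

/-! Constructs that split their context. -/

section Split

variable {Δ Γ₁ Γ₂ Δ' Γ₁' Γ₂' : CtxL} {A A' B B' : Ty}

theorem FundC.app {c : D.Hom (denCtx D Θ (bangify Δ ++ Γ₁)) (D.T (denTy D Θ (.arrow A B)))}
    {c' : D.Hom (denCtx D Θ (bangify Δ' ++ Γ₁')) (D.T (denTy D Θ (.arrow A' B')))}
    {d : D.Hom (denCtx D Θ (bangify Δ ++ Γ₂)) (D.T (denTy D Θ A))}
    {d' : D.Hom (denCtx D Θ (bangify Δ' ++ Γ₂')) (D.T (denTy D Θ A'))}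
    (hc : FundC Θ _ _ (.arrow A B) (.arrow A' B') c c') (hd : FundC Θ _ _ A A' d d')
    (hn : (names (bangify Δ ++ Γ₁ ++ Γ₂)).Nodup) (hn' : (names (bangify Δ' ++ Γ₁' ++ Γ₂')).Nodup)
    (h₁ : LinearIn (bangify Δ ++ Γ₁) (bangify Δ' ++ Γ₁'))
    (h₂ : LinearIn (bangify Δ ++ Γ₂) (bangify Δ' ++ Γ₂')) :
    FundC Θ _ _ B B'
      (splitDup D Θ Δ Γ₁ Γ₂ ;; (c ⊠ d) ;; D.Psi1 (denTy D Θ (.arrow A B)) (denTy D Θ A) ;;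
        D.klift (D.appnt (denTy D Θ A) (denTy D Θ B)))
      (splitDup D Θ Δ' Γ₁' Γ₂' ;; (c' ⊠ d') ;; D.Psi1 (denTy D Θ (.arrow A' B')) (denTy D Θ A') ;;
        D.klift (D.appnt (denTy D Θ A') (denTy D Θ B'))) := by
  intro X γ γ' hγ
  obtain ⟨Xa, Xb, g, γa, γb, γa', γb', ha, hb, e, e'⟩ := hγ.split hn hn' h₁ h₂
  exact (congrArg₂ (RelT Θ B B') (comp_tmap_glue e ..) (comp_tmap_glue e' ..)).mpr
    (((hc γa γa' ha).app (hd γb γb' hb)).pre g)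

theorem FundC.pair {n n' : ℕ}
    {c : D.Hom (denCtx D Θ (bangify Δ ++ Γ₁)) (D.T (denTy D Θ (bangN n A)))}
    {c' : D.Hom (denCtx D Θ (bangify Δ' ++ Γ₁')) (D.T (denTy D Θ (bangN n' A')))}
    {d : D.Hom (denCtx D Θ (bangify Δ ++ Γ₂)) (D.T (denTy D Θ (bangN n B)))}
    {d' : D.Hom (denCtx D Θ (bangify Δ' ++ Γ₂')) (D.T (denTy D Θ (bangN n' B')))}
    (hc : FundC Θ _ _ (bangN n A) (bangN n' A') c c')
    (hd : FundC Θ _ _ (bangN n B) (bangN n' B') d d')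
    (hn : (names (bangify Δ ++ Γ₁ ++ Γ₂)).Nodup) (hn' : (names (bangify Δ' ++ Γ₁' ++ Γ₂')).Nodup)
    (h₁ : LinearIn (bangify Δ ++ Γ₁) (bangify Δ' ++ Γ₁'))
    (h₂ : LinearIn (bangify Δ ++ Γ₂) (bangify Δ' ++ Γ₂')) :
    FundC Θ _ _ (bangN n (.tensor A B)) (bangN n' (.tensor A' B'))
      (splitDup D Θ Δ Γ₁ Γ₂ ;; (c ⊠ d) ;; D.Psi1 _ _ ;; D.Tmap (m2nD D Θ n A B))
      (splitDup D Θ Δ' Γ₁' Γ₂' ;; (c' ⊠ d') ;; D.Psi1 _ _ ;; D.Tmap (m2nD D Θ n' A' B')) := by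
  intro X γ γ' hγ
  obtain ⟨Xa, Xb, g, γa, γb, γa', γb', ha, hb, e, e'⟩ := hγ.split hn hn' h₁ h₂
  exact (congrArg₂ (RelT Θ _ _) (comp_tmap_glue e ..) (comp_tmap_glue e' ..)).mpr
    (((hc γa γa' ha).pair (hd γb γb' hb)).pre g)

theorem FundV.pair {n n' : ℕ}
    {c : D.Hom (denCtx D Θ (bangify Δ ++ Γ₁)) (denTy D Θ (bangN n A))}
    {c' : D.Hom (denCtx D Θ (bangify Δ' ++ Γ₁')) (denTy D Θ (bangN n' A'))}
    {d : D.Hom (denCtx D Θ (bangify Δ ++ Γ₂)) (denTy D Θ (bangN n B))}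
    {d' : D.Hom (denCtx D Θ (bangify Δ' ++ Γ₂')) (denTy D Θ (bangN n' B'))}
    (hc : FundV Θ _ _ (bangN n A) (bangN n' A') c c')
    (hd : FundV Θ _ _ (bangN n B) (bangN n' B') d d')
    (hn : (names (bangify Δ ++ Γ₁ ++ Γ₂)).Nodup) (hn' : (names (bangify Δ' ++ Γ₁' ++ Γ₂')).Nodup)
    (h₁ : LinearIn (bangify Δ ++ Γ₁) (bangify Δ' ++ Γ₁'))
    (h₂ : LinearIn (bangify Δ ++ Γ₂) (bangify Δ' ++ Γ₂')) :
    FundV Θ _ _ (bangN n (.tensor A B)) (bangN n' (.tensor A' B'))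
      (splitDup D Θ Δ Γ₁ Γ₂ ;; (c ⊠ d) ;; m2nD D Θ n A B)
      (splitDup D Θ Δ' Γ₁' Γ₂' ;; (c' ⊠ d') ;; m2nD D Θ n' A' B') := by
  intro X γ γ' hγ
  obtain ⟨Xa, Xb, g, γa, γb, γa', γb', ha, hb, e, e'⟩ := hγ.split hn hn' h₁ h₂
  exact (congrArg₂ (Rel Θ _ _) (comp_tmap_glue e ..) (comp_tmap_glue e' ..)).mpr
    (((hc γa γa' ha).pair (hd γb γb' hb)).pre g)

theorem FundC.let {H H' : D.Obj}
    {c : D.Hom (denCtx D Θ (bangify Δ ++ Γ₁)) (D.T (denTy D Θ A))}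
    {c' : D.Hom (denCtx D Θ (bangify Δ' ++ Γ₁')) (D.T (denTy D Θ A'))}
    {h : D.Hom (D.tens (denCtx D Θ (bangify Δ ++ Γ₂)) (denTy D Θ A)) H}
    {h' : D.Hom (D.tens (denCtx D Θ (bangify Δ' ++ Γ₂')) (denTy D Θ A')) H'}
    {k : D.Hom H (D.T (denTy D Θ B))} {k' : D.Hom H' (D.T (denTy D Θ B'))}
    (hc : FundC Θ _ _ A A' c c')
    (hk : ∀ {Y Z : D.Obj} (b : D.Hom Y (denCtx D Θ (bangify Δ ++ Γ₂)))
      (b' : D.Hom Y (denCtx D Θ (bangify Δ' ++ Γ₂'))) (v : D.Hom Z (denTy D Θ A))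
      (v' : D.Hom Z (denTy D Θ A')), Env Θ Y _ _ b b' → Rel Θ A A' v v' →
        RelT Θ B B' ((b ⊠ v) ;; h ;; k) ((b' ⊠ v') ;; h' ;; k'))
    (hn : (names (bangify Δ ++ Γ₁ ++ Γ₂)).Nodup) (hn' : (names (bangify Δ' ++ Γ₁' ++ Γ₂')).Nodup)
    (h₁ : LinearIn (bangify Δ ++ Γ₁) (bangify Δ' ++ Γ₁'))
    (h₂ : LinearIn (bangify Δ ++ Γ₂) (bangify Δ' ++ Γ₂')) :
    FundC Θ _ _ B B'
      (splitDup D Θ Δ Γ₁ Γ₂ ;; (c ⊠ D.id _) ;; D.symm _ _ ;;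
        D.str (denCtx D Θ (bangify Δ ++ Γ₂)) (denTy D Θ A) ;; D.Tmap h ;; D.klift k)
      (splitDup D Θ Δ' Γ₁' Γ₂' ;; (c' ⊠ D.id _) ;; D.symm _ _ ;;
        D.str (denCtx D Θ (bangify Δ' ++ Γ₂')) (denTy D Θ A') ;; D.Tmap h' ;; D.klift k') := by
  intro X γ γ' hγ
  obtain ⟨Xa, Xb, g, γa, γb, γa', γb', ha, hb, e, e'⟩ := hγ.split hn hn' h₁ h₂
  refine (congrArg₂ (RelT Θ _ _) (comp_tmap_glue e ..) (comp_tmap_glue e' ..)).mpr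
    (((hc γa γa' ha).let fun v v' hv => ?_).pre g)
  rw [comp_id', comp_id']
  exact hk _ _ _ _ hb hv

theorem FundV.let {H H' : D.Obj}
    {c : D.Hom (denCtx D Θ (bangify Δ ++ Γ₁)) (denTy D Θ A)}
    {c' : D.Hom (denCtx D Θ (bangify Δ' ++ Γ₁')) (denTy D Θ A')}
    {h : D.Hom (D.tens (denCtx D Θ (bangify Δ ++ Γ₂)) (denTy D Θ A)) H}
    {h' : D.Hom (D.tens (denCtx D Θ (bangify Δ' ++ Γ₂')) (denTy D Θ A')) H'}
    {k : D.Hom H (denTy D Θ B)} {k' : D.Hom H' (denTy D Θ B')}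
    (hc : FundV Θ _ _ A A' c c')
    (hk : ∀ {Y Z : D.Obj} (b : D.Hom Y (denCtx D Θ (bangify Δ ++ Γ₂)))
      (b' : D.Hom Y (denCtx D Θ (bangify Δ' ++ Γ₂'))) (v : D.Hom Z (denTy D Θ A))
      (v' : D.Hom Z (denTy D Θ A')), Env Θ Y _ _ b b' → Rel Θ A A' v v' →
        Rel Θ B B' ((b ⊠ v) ;; h ;; k) ((b' ⊠ v') ;; h' ;; k'))
    (hn : (names (bangify Δ ++ Γ₁ ++ Γ₂)).Nodup) (hn' : (names (bangify Δ' ++ Γ₁' ++ Γ₂')).Nodup)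
    (h₁ : LinearIn (bangify Δ ++ Γ₁) (bangify Δ' ++ Γ₁'))
    (h₂ : LinearIn (bangify Δ ++ Γ₂) (bangify Δ' ++ Γ₂')) :
    FundV Θ _ _ B B'
      (splitDup D Θ Δ Γ₁ Γ₂ ;; (c ⊠ D.id _) ;; D.symm _ _ ;; h ;; k)
      (splitDup D Θ Δ' Γ₁' Γ₂' ;; (c' ⊠ D.id _) ;; D.symm _ _ ;; h' ;; k') := by
  intro X γ γ' hγ
  obtain ⟨Xa, Xb, g, γa, γb, γa', γb', ha, hb, e, e'⟩ := hγ.split hn hn' h₁ h₂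
  refine (congrArg₂ (Rel Θ _ _) (comp_tmap_glue e ..) (comp_tmap_glue e' ..)).mpr (Rel.pre ?_ g)
  rw [comp_id', comp_id', tmap_symm_comp, tmap_symm_comp]
  exact (hk _ _ _ _ hb (hc γa γa' ha)).pre _

end Split

theorem tmap_runit_comp {X Y P C : D.Obj} (b : D.Hom X P) (v : D.Hom Y D.unit) (k : D.Hom P C) :
    (b ⊠ v) ;; D.runit P ;; k = ((D.id X ⊠ v) ;; D.runit X) ;; b ;; k := by
  rw [comp_assoc', ← comp_congr_assoc (runit_natural' b), tmap_comp_tmap_assoc, id_comp', comp_id']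

end Fundamental

end QLamSem

namespace QLamSem

section Main

local notation:80 f:81 ";;" g:80 => LCDData.comp _ f g
local notation:90 f:91 "⊠" g:90 => LCDData.tmap _ f g

variable {D : LCDData} {Θ : ℕ → D.Obj} {cty : ℕ → Ty}

theorem TypingD.linearIn {Γ Γ' : CtxL} {M M' : Tm} {A A' : Ty} (d : TypingD cty Γ M A)
    (d' : TypingD cty Γ' M' A') (he : erase M = erase M') : LinearIn Γ Γ' := fun _ hp hb =>
  d'.mem_names_of_free (he ▸ d.free_of_mem hp hb)

theorem LinearIn.of_append {Γ Γ' Γ₁ Γ₁' : CtxL} (h : LinearIn (Γ ++ Γ₁) (Γ' ++ Γ₁'))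
    (hd : ∀ x ∈ names Γ₁', x ∉ names Γ) : LinearIn Γ Γ' := fun p hp hb => by
  have h := h p (List.mem_append_left _ hp) hb
  rw [names_append, List.mem_append] at h
  exact h.resolve_right fun hx => hd _ hx (List.mem_map_of_mem hp)

theorem not_mem_names_drop {x : ℕ} {Γ Γ₁ Γ₂ : CtxL} (h : x ∉ names (Γ ++ Γ₁ ++ Γ₂)) :
    x ∉ names (Γ ++ Γ₂) := by
  simp only [names_append, List.mem_append, not_or] at h ⊢
  exact ⟨h.1.1, h.2⟩

variable [LC D] (I : Interp D cty)

/-- The interpretations of two derivations preserve relatedness. -/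
def Fund {Γ Γ' : CtxL} {M M' : Tm} {A A' : Ty} (d : TypingD cty Γ M A)
    (d' : TypingD cty Γ' M' A') : Prop :=
  FundC I.obj Γ Γ' A A' (denC I d) (denC I d') ∧
    ∀ h h', FundV I.obj Γ Γ' A A' (denV I d h) (denV I d' h')

variable {I}

theorem FundV.precomp {Γ Γ' Γ₁ Γ₁' : CtxL} {A A' : Ty} {v : D.Hom (denCtx D Θ Γ₁) (denTy D Θ A)}
    {v' : D.Hom (denCtx D Θ Γ₁') (denTy D Θ A')} (h : FundV Θ Γ₁ Γ₁' A A' v v')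
    {p : D.Hom (denCtx D Θ Γ) (denCtx D Θ Γ₁)} {p' : D.Hom (denCtx D Θ Γ') (denCtx D Θ Γ₁')}
    (hp : Perm Θ Γ Γ₁ p) (hp' : Perm Θ Γ' Γ₁' p') : FundV Θ Γ Γ' A A' (p ;; v) (p' ;; v') :=
  fun _ γ γ' hγ => (congrArg₂ (Rel Θ A A') (comp_assoc' γ p v) (comp_assoc' γ' p' v')).mp
    (h _ _ (hγ.perm hp hp'))

theorem FundC.precomp {Γ Γ' Γ₁ Γ₁' : CtxL} {A A' : Ty}
    {v : D.Hom (denCtx D Θ Γ₁) (D.T (denTy D Θ A))}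
    {v' : D.Hom (denCtx D Θ Γ₁') (D.T (denTy D Θ A'))} (h : FundC Θ Γ₁ Γ₁' A A' v v')
    {p : D.Hom (denCtx D Θ Γ) (denCtx D Θ Γ₁)} {p' : D.Hom (denCtx D Θ Γ') (denCtx D Θ Γ₁')}
    (hp : Perm Θ Γ Γ₁ p) (hp' : Perm Θ Γ' Γ₁' p') : FundC Θ Γ Γ' A A' (p ;; v) (p' ;; v') :=
  fun _ γ γ' hγ => (congrArg₂ (RelT Θ A A') (comp_assoc' γ p v) (comp_assoc' γ' p' v')).mp
    (h _ _ (hγ.perm hp hp'))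

theorem Fund.swap_left {Γ₁ Γ₂ Γ' : CtxL} {p q : ℕ × Ty} {M M' : Tm} {A A' : Ty}
    {d : TypingD cty (Γ₁ ++ p :: q :: Γ₂) M A} {d' : TypingD cty Γ' M' A'} (h : Fund I d d') :
    Fund I d.swap d' := by
  refine ⟨?_, fun hv hv' => ?_⟩
  · exact (congrArg (FundC I.obj _ _ _ _ (denC I d.swap)) (id_comp' _)).mp
      (h.1.precomp (perm_swapMor Γ₁ p q Γ₂) (.refl Γ'))
  · exact (congrArg (FundV I.obj _ _ _ _ (denV I d.swap hv)) (id_comp' _)).mp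
      ((h.2 hv hv').precomp (perm_swapMor Γ₁ p q Γ₂) (.refl Γ'))

theorem Fund.swap_right {Γ₁ Γ₂ Γ' : CtxL} {p q : ℕ × Ty} {M M' : Tm} {A A' : Ty}
    {d : TypingD cty (Γ₁ ++ p :: q :: Γ₂) M A} {d' : TypingD cty Γ' M' A'} (h : Fund I d' d) :
    Fund I d' d.swap := by
  refine ⟨?_, fun hv hv' => ?_⟩
  · exact (congrArg (FundC I.obj _ _ _ _ · (denC I d.swap)) (id_comp' _)).mp
      (h.1.precomp (.refl Γ') (perm_swapMor Γ₁ p q Γ₂))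
  · exact (congrArg (FundV I.obj _ _ _ _ · (denV I d.swap hv')) (id_comp' _)).mp
      ((h.2 hv hv').precomp (.refl Γ') (perm_swapMor Γ₁ p q Γ₂))

/-- Abstractions are related as computations as soon as they are related as values. -/
theorem Fund.of_val {Γ Γ' : CtxL} {M M' : Tm} {A A' : Ty} {d : TypingD cty Γ M A}
    {d' : TypingD cty Γ' M' A'} (h : isValue M = true) (h' : isValue M' = true)
    (e : denC I d = denV I d h ;; D.eta _) (e' : denC I d' = denV I d' h' ;; D.eta _)
    (hv : FundV I.obj Γ Γ' A A' (denV I d h) (denV I d' h')) : Fund I d d' :=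
  ⟨e ▸ e' ▸ hv.eta, fun _ _ => hv⟩

variable {Γ Γ' Δ Δ' : CtxL} {M M' N N' : Tm} {x : ℕ} {A A' B B' : Ty}

theorem denC_lamS {n : ℕ} (hx : x ∉ names Δ) (d : TypingD cty (bangify Δ ++ [(x, A)]) M B) :
    denC I (.lamS (n := n) hx d) = denV I (.lamS (n := n) hx d) rfl ;; D.eta _ :=
  (congrArg (promCtx D I.obj Δ ;; ·) (comp_assoc' _ _ _).symm).trans (comp_assoc' _ _ _).symm

theorem Fund.lam0_lam0 {hx : x ∉ names Γ} {hx' : x ∉ names Γ'}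
    {d : TypingD cty (Γ ++ [(x, A)]) M B} {d' : TypingD cty (Γ' ++ [(x, A')]) M' B'}
    (h : Fund I d d') : Fund I (.lam0 hx d) (.lam0 hx' d') :=
  .of_val rfl rfl rfl rfl <| fundV_lam (n := 0) (n' := 0) h.1 hx hx' (by omega) (by omega)
    (comp_id' _) (comp_id' _)

theorem Fund.lam0_lamS {n : ℕ} {hx : x ∉ names Γ} {hx' : x ∉ names Δ'}
    {d : TypingD cty (Γ ++ [(x, A)]) M B} {d' : TypingD cty (bangify Δ' ++ [(x, A')]) M' B'}
    (h : Fund I d d') : Fund I (.lam0 hx d) (.lamS (n := n) hx' d') :=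
  .of_val rfl rfl rfl (denC_lamS hx' d') <| fundV_lam (n := 0) (n' := n + 1) h.1 hx
    (by rwa [names_bangify]) (by omega) (fun _ _ => isBang_of_mem_bangify) (comp_id' _)
    (promCtx_lam_col _)

theorem Fund.lamS_lam0 {n : ℕ} {hx : x ∉ names Δ} {hx' : x ∉ names Γ'}
    {d : TypingD cty (bangify Δ ++ [(x, A)]) M B} {d' : TypingD cty (Γ' ++ [(x, A')]) M' B'}
    (h : Fund I d d') : Fund I (.lamS (n := n) hx d) (.lam0 hx' d') :=
  .of_val rfl rfl (denC_lamS hx d) rfl <| fundV_lam (n := n + 1) (n' := 0) h.1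
    (by rwa [names_bangify]) hx' (fun _ _ => isBang_of_mem_bangify) (by omega)
    (promCtx_lam_col _) (comp_id' _)

theorem Fund.lamS_lamS {n n' : ℕ} {hx : x ∉ names Δ} {hx' : x ∉ names Δ'}
    {d : TypingD cty (bangify Δ ++ [(x, A)]) M B} {d' : TypingD cty (bangify Δ' ++ [(x, A')]) M' B'}
    (h : Fund I d d') : Fund I (.lamS (n := n) hx d) (.lamS (n := n') hx' d') :=
  .of_val rfl rfl (denC_lamS hx d) (denC_lamS hx' d') <|
    fundV_lam (n := n + 1) (n' := n' + 1) h.1 (by rwa [names_bangify]) (by rwa [names_bangify])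
      (fun _ _ => isBang_of_mem_bangify) (fun _ _ => isBang_of_mem_bangify)
      (promCtx_lam_col _) (promCtx_lam_col _)

theorem denC_var (hx : x ∉ names Δ) (s : SubD A B) :
    denC I (.var (cty := cty) hx s) = denV I (.var (cty := cty) hx s) rfl ;; D.eta _ := by
  refine Eq.symm ((comp_assoc' _ _ _).trans (congrArg (splitCtx D I.obj _ _ ;; ·) ?_))
  exact (comp_assoc' _ _ _).trans (congrArg (_ ;; ·) (comp_assoc' _ _ _))

theorem Fund.var {hx : x ∉ names Δ} {hx' : x ∉ names Δ'} {s : SubD A B} {s' : SubD A' B'} :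
    Fund I (.var hx s) (.var hx' s') :=
  .of_val rfl rfl (denC_var hx s) (denC_var hx' s') fun _ _ _ hγ =>
    WdP.var hx hx' (isSub_Isub s) (isSub_Isub s') hγ

theorem denC_cst {c : ℕ} (s : SubD (.bang (cty c)) B) :
    denC I (.cst (Δ := Δ) s) = denV I (.cst (Δ := Δ) s) rfl ;; D.eta _ :=
  ((comp_assoc' _ _ _).trans (congrArg (discCtx D I.obj Δ ;; ·) (comp_assoc' _ _ _))).symm

theorem Fund.cst {c : ℕ} {s : SubD (.bang (cty c)) B} {s' : SubD (.bang (cty c)) B'} :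
    Fund I (.cst (Δ := Δ) s) (.cst (Δ := Δ') s') :=
  .of_val rfl rfl (denC_cst s) (denC_cst s') (fundV_cst _ (isSub_Isub s) (isSub_Isub s'))

theorem Fund.star {n n' : ℕ} :
    Fund I (.star (Δ := Δ) (n := n)) (.star (Δ := Δ') (n := n')) :=
  .of_val rfl rfl (comp_assoc' _ _ _).symm (comp_assoc' _ _ _).symm (fundV_star n n')

variable {Γ₁ Γ₂ Γ₁' Γ₂' : CtxL} {hn : (names (bangify Δ ++ Γ₁ ++ Γ₂)).Nodup}
  {hn' : (names (bangify Δ' ++ Γ₁' ++ Γ₂')).Nodup}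

theorem Fund.app {d₁ : TypingD cty (bangify Δ ++ Γ₁) M (.arrow A B)}
    {d₂ : TypingD cty (bangify Δ ++ Γ₂) N A}
    {d₁' : TypingD cty (bangify Δ' ++ Γ₁') M' (.arrow A' B')}
    {d₂' : TypingD cty (bangify Δ' ++ Γ₂') N' A'} (h₁ : Fund I d₁ d₁') (h₂ : Fund I d₂ d₂')
    (hM : erase M = erase M') (hN : erase N = erase N') :
    Fund I (.app hn d₁ d₂) (.app hn' d₁' d₂') :=
  ⟨h₁.1.app h₂.1 hn hn' (d₁.linearIn d₁' hM) (d₂.linearIn d₂' hN), fun h => nomatch h⟩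

theorem Fund.pair {n n' : ℕ} {d₁ : TypingD cty (bangify Δ ++ Γ₁) M (bangN n A)}
    {d₂ : TypingD cty (bangify Δ ++ Γ₂) N (bangN n B)}
    {d₁' : TypingD cty (bangify Δ' ++ Γ₁') M' (bangN n' A')}
    {d₂' : TypingD cty (bangify Δ' ++ Γ₂') N' (bangN n' B')} (h₁ : Fund I d₁ d₁')
    (h₂ : Fund I d₂ d₂') (hM : erase M = erase M') (hN : erase N = erase N') :
    Fund I (.pair hn d₁ d₂) (.pair hn' d₁' d₂') :=
  ⟨h₁.1.pair h₂.1 hn hn' (d₁.linearIn d₁' hM) (d₂.linearIn d₂' hN), fun _ _ =>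
    (h₁.2 _ _).pair (h₂.2 _ _) hn hn' (d₁.linearIn d₁' hM) (d₂.linearIn d₂' hN)⟩

theorem Fund.letv {hx : x ∉ names (bangify Δ ++ Γ₁ ++ Γ₂)}
    {hx' : x ∉ names (bangify Δ' ++ Γ₁' ++ Γ₂')} {d₁ : TypingD cty (bangify Δ ++ Γ₁) M A}
    {d₂ : TypingD cty ((bangify Δ ++ Γ₂) ++ [(x, A)]) N B}
    {d₁' : TypingD cty (bangify Δ' ++ Γ₁') M' A'}
    {d₂' : TypingD cty ((bangify Δ' ++ Γ₂') ++ [(x, A')]) N' B'} (h₁ : Fund I d₁ d₁')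
    (h₂ : Fund I d₂ d₂') (hM : erase M = erase M') (hN : erase N = erase N') :
    Fund I (.letv hn hx d₁ d₂) (.letv hn' hx' d₁' d₂') := by
  have k := not_mem_names_drop hx
  have k' := not_mem_names_drop hx'
  have l₁ := d₁.linearIn d₁' hM
  have l₂ : LinearIn (bangify Δ ++ Γ₂) (bangify Δ' ++ Γ₂') :=
    (d₂.linearIn d₂' hN).of_append fun y hy => by
      obtain rfl : y = x := by simpa [names] using hy
      exact k
  exact ⟨h₁.1.let (fun _ _ _ _ hb hv => h₂.1.ext hb k k' hv) hn hn' l₁ l₂, fun _ _ =>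
    (h₁.2 _ _).let (fun _ _ _ _ hb hv => (h₂.2 _ _).ext hb k k' hv) hn hn' l₁ l₂⟩

theorem Fund.letUnit {d₁ : TypingD cty (bangify Δ ++ Γ₁) M .unit}
    {d₂ : TypingD cty (bangify Δ ++ Γ₂) N B} {d₁' : TypingD cty (bangify Δ' ++ Γ₁') M' .unit}
    {d₂' : TypingD cty (bangify Δ' ++ Γ₂') N' B'} (h₁ : Fund I d₁ d₁') (h₂ : Fund I d₂ d₂')
    (hM : erase M = erase M') (hN : erase N = erase N') :
    Fund I (.letUnit hn d₁ d₂) (.letUnit hn' d₁' d₂') := by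
  have l₁ := d₁.linearIn d₁' hM
  have l₂ := d₂.linearIn d₂' hN
  refine ⟨h₁.1.let (A := .unit) (A' := .unit) (fun b b' v v' hb hv => ?_) hn hn' l₁ l₂, fun _ _ =>
    (h₁.2 _ _).let (A := .unit) (A' := .unit) (fun b b' v v' hb hv => ?_) hn hn' l₁ l₂⟩
  · obtain rfl := hv.eq
    exact (congrArg₂ (RelT I.obj B B') (tmap_runit_comp b v _) (tmap_runit_comp b' v _)).mpr
      ((h₂.1 b b' hb).pre _)
  · obtain rfl := hv.eq
    exact (congrArg₂ (Rel I.obj B B') (tmap_runit_comp b v _) (tmap_runit_comp b' v _)).mpr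
      ((h₂.2 _ _ b b' hb).pre _)

theorem Fund.letPair {n n' y : ℕ} {C C' : Ty} {hxy : x ≠ y} {hxy' : x ≠ y}
    {hx : x ∉ names (bangify Δ ++ Γ₁ ++ Γ₂)} {hx' : x ∉ names (bangify Δ' ++ Γ₁' ++ Γ₂')}
    {hy : y ∉ names (bangify Δ ++ Γ₁ ++ Γ₂)} {hy' : y ∉ names (bangify Δ' ++ Γ₁' ++ Γ₂')}
    {d₁ : TypingD cty (bangify Δ ++ Γ₁) M (bangN n (.tensor A B))}
    {d₂ : TypingD cty ((bangify Δ ++ Γ₂) ++ [(x, bangN n A), (y, bangN n B)]) N C}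
    {d₁' : TypingD cty (bangify Δ' ++ Γ₁') M' (bangN n' (.tensor A' B'))}
    {d₂' : TypingD cty ((bangify Δ' ++ Γ₂') ++ [(x, bangN n' A'), (y, bangN n' B')]) N' C'}
    (h₁ : Fund I d₁ d₁') (h₂ : Fund I d₂ d₂') (hM : erase M = erase M')
    (hN : erase N = erase N') :
    Fund I (.letPair hn hxy hx hy d₁ d₂) (.letPair hn' hxy' hx' hy' d₁' d₂') := by
  have kx := not_mem_names_drop hx
  have kx' := not_mem_names_drop hx'
  have ky := not_mem_names_drop hy
  have ky' := not_mem_names_drop hy'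
  have l₁ := d₁.linearIn d₁' hM
  have l₂ : LinearIn (bangify Δ ++ Γ₂) (bangify Δ' ++ Γ₂') :=
    (d₂.linearIn d₂' hN).of_append fun z hz => by
      obtain rfl | rfl : z = x ∨ z = y := by simpa [names] using hz
      · exact kx
      · exact ky
  refine ⟨h₁.1.let (h := QLamSem.extPair ..) (h' := QLamSem.extPair ..) (fun _ _ _ _ hb hv =>
    h₂.1.extPair hb hxy kx kx' ky ky' hv) hn hn' l₁ l₂, fun h h' => ?_⟩
  have key {Γ : CtxL} {P Q R : D.Obj} {n : ℕ} {A B : Ty} (f : D.Hom P Q) (g : D.Hom Q _)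
      (k : D.Hom _ R) : f ;; g ;; D.symm _ _ ;; (D.id _ ⊠ m2nDInv D I.obj n A B) ;;
        ext2Hom D I.obj Γ x _ y _ ;; k =
      f ;; g ;; D.symm _ _ ;; QLamSem.extPair I.obj Γ n x A y B ;; k :=
    congrArg (fun r => f ;; g ;; D.symm _ _ ;; r) (comp_assoc' _ _ _).symm
  exact (congrArg₂ (FundV I.obj _ _ C C') (key ..) (key ..)).mpr
    ((h₁.2 _ _).let (fun _ _ _ _ hb hv => (h₂.2 _ _).extPair hb hxy kx kx' ky ky' hv)
      hn hn' l₁ l₂)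

theorem fund (d : TypingD cty Γ M A) (d' : TypingD cty Γ' M' A') (he : erase M = erase M') :
    Fund I d d' := by
  induction d generalizing Γ' M' A' with
  | swap d ih => exact (ih d' he).swap_left
  | var =>
    induction d' with
    | swap d' ih => exact (ih he).swap_right
    | var =>
      cases he
      exact .var
    | _ => simp [erase] at he
  | cst =>
    induction d' with
    | swap d' ih => exact (ih he).swap_right
    | cst =>
      cases he
      exact .cst
    | _ => simp [erase] at he
  | star =>
    induction d' with
    | swap d' ih => exact (ih he).swap_right
    | star => exact .star
    | _ => simp [erase] at he
  | lam0 hx d ih =>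
    induction d' with
    | swap d' ih => exact (ih he).swap_right
    | lam0 hx' d' =>
      obtain ⟨rfl, e⟩ := PTm.lam.inj he
      exact (ih d' e).lam0_lam0
    | lamS hx' d' =>
      obtain ⟨rfl, e⟩ := PTm.lam.inj he
      exact (ih d' e).lam0_lamS
    | _ => simp [erase] at he
  | lamS hx d ih =>
    induction d' with
    | swap d' ih => exact (ih he).swap_right
    | lam0 hx' d' =>
      obtain ⟨rfl, e⟩ := PTm.lam.inj he
      exact (ih d' e).lamS_lam0
    | lamS hx' d' =>
      obtain ⟨rfl, e⟩ := PTm.lam.inj he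
      exact (ih d' e).lamS_lamS
    | _ => simp [erase] at he
  | app _ _ _ ih₁ ih₂ =>
    induction d' with
    | swap d' ih => exact (ih he).swap_right
    | app _ d₁ d₂ =>
      obtain ⟨e₁, e₂⟩ := PTm.app.inj he
      exact (ih₁ d₁ e₁).app (ih₂ d₂ e₂) e₁ e₂
    | _ => simp [erase] at he
  | pair _ _ _ ih₁ ih₂ =>
    induction d' with
    | swap d' ih => exact (ih he).swap_right
    | pair _ d₁ d₂ =>
      obtain ⟨e₁, e₂⟩ := PTm.pair.inj he
      exact (ih₁ d₁ e₁).pair (ih₂ d₂ e₂) e₁ e₂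
    | _ => simp [erase] at he
  | letv _ _ _ _ ih₁ ih₂ =>
    induction d' with
    | swap d' ih => exact (ih he).swap_right
    | letv _ _ d₁ d₂ =>
      obtain ⟨rfl, e₁, e₂⟩ := PTm.letv.inj he
      exact (ih₁ d₁ e₁).letv (ih₂ d₂ e₂) e₁ e₂
    | _ => simp [erase] at he
  | letUnit _ _ _ ih₁ ih₂ =>
    induction d' with
    | swap d' ih => exact (ih he).swap_right
    | letUnit _ d₁ d₂ =>
      obtain ⟨e₁, e₂⟩ := PTm.letUnit.inj he
      exact (ih₁ d₁ e₁).letUnit (ih₂ d₂ e₂) e₁ e₂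
    | _ => simp [erase] at he
  | letPair _ _ _ _ _ _ ih₁ ih₂ =>
    induction d' with
    | swap d' ih => exact (ih he).swap_right
    | letPair _ _ _ _ d₁ d₂ =>
      obtain ⟨rfl, rfl, e₁, e₂⟩ := PTm.letPair.inj he
      exact (ih₁ d₁ e₁).letPair (ih₂ d₂ e₂) e₁ e₂
    | _ => simp [erase] at he

end Main

end QLamSem

namespace QLamSem

/-- **Statement 18.** If `Erase(M) = Erase(M')` and `Δ ⊢ M : A` and `Δ ⊢ M' : A` are
both valid typing judgments, then for every interpretation in a linear category for
duplication, `⟦M⟧^c = ⟦M'⟧^c`; and if `M` and `M'` are values, also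
`⟦M⟧^v = ⟦M'⟧^v`.  The denotation of a term does not depend on its indexation. -/
theorem denotation_independent_of_indexation
    (D : LCDData) (hD : LCDLaws D) (cty : ℕ → Ty) (I : Interp D cty)
    {Δ : CtxL} {M M' : Tm} {A : Ty}
    (π : TypingD cty Δ M A) (π' : TypingD cty Δ M' A)
    (he : erase M = erase M') :
    denC I π = denC I π' ∧
    ∀ (hM : isValue M = true) (hM' : isValue M' = true),
      denV I π hM = denV I π' hM' := by
  have : LC D := ⟨hD⟩
  have h : Fund I π π' := fund π π' he
  have hid : Env I.obj (denCtx D I.obj Δ) Δ Δ (D.id _) (D.id _) := wdP_id _ _ Δ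
  refine ⟨?_, fun hM hM' => ?_⟩
  · simpa only [id_comp'] using (h.1 _ _ hid).eq
  · simpa only [id_comp'] using (h.2 hM hM' _ _ hid).eq

end QLamSem
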